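/- In the twisted Ringel–Hall algebra H^0_v(C_r) of nilpotent representations of the cyclic quiver C_r (r > 1) over F_q, the central elements c_n = (-1)^n v^{-2rn} ∑_{[M]: dim M = nδ, soc M square-free} (-1)^{dim End(M)} a_M [M] satisfy Δ(c_n) = ∑_{s=0}^{n} c_s ⊗ c_{n-s} (with c_0 = 1), and consequently the elements x_n defined inductively by x_n = n c_n − ∑_{s=1}^{n-1} x_s c_{n-s} are primitive. -/

import Mathlib

set_option synthInstance.maxHeartbeats 1000000

open Finset

namespace CyclicHall

variable (F : Type) [Field F] [Fintype F] (r : ℕ) [NeZero r]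

/-- The shift endomorphism of the total space of a representation of the cyclic quiver
`C_r` (vertex set `ℤ/r`, arrows `i → i+1`). -/
def shift (d : ZMod r → ℕ) (x : ∀ i : ZMod r, Matrix (Fin (d (i + 1))) (Fin (d i)) F)
    (w : ∀ i : ZMod r, Fin (d i) → F) : ∀ i : ZMod r, Fin (d i) → F := fun i =>
  cast (congrArg (fun m => Fin m → F) (congrArg d (sub_add_cancel i 1)))
    ((x (i - 1)).mulVec (w (i - 1)))

/-- A nilpotent representation of the cyclic quiver `C_r` over `F`. -/
structure NRep where
  d : ZMod r → ℕ
  x : ∀ i : ZMod r, Matrix (Fin (d (i + 1))) (Fin (d i)) F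
  nil : ∃ N : ℕ, ∀ w : ∀ i : ZMod r, Fin (d i) → F, (shift F r d x)^[N] w = 0

variable {F r}

/-- Isomorphisms of representations of `C_r`. -/
def RepIso (M N : NRep F r) : Type :=
  {φ : ∀ i : ZMod r, (Fin (M.d i) → F) ≃ₗ[F] (Fin (N.d i) → F) //
    ∀ i, (Matrix.mulVecLin (N.x i)).comp (φ i).toLinearMap
        = (φ (i + 1)).toLinearMap.comp (Matrix.mulVecLin (M.x i))}

/-- `a_M = |Aut(M)|`. -/
noncomputable def aut (M : NRep F r) : ℕ := Nat.card (RepIso M M)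

/-- The endomorphism algebra of a representation, as a subspace of
`∏ᵢ End(F^{dᵢ})`. -/
def endSub (M : NRep F r) :
    Submodule F (∀ i : ZMod r, (Fin (M.d i) → F) →ₗ[F] (Fin (M.d i) → F)) where
  carrier := {φ | ∀ i, (Matrix.mulVecLin (M.x i)).comp (φ i)
      = (φ (i + 1)).comp (Matrix.mulVecLin (M.x i))}
  add_mem' := by
    intro φ ψ hφ hψ
    intro i
    simp only [Pi.add_apply, LinearMap.comp_add, LinearMap.add_comp, hφ i, hψ i]
  zero_mem' := by intro i; simp
  smul_mem' := by
    intro c φ hφ i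
    simp only [Pi.smul_apply, LinearMap.comp_smul, LinearMap.smul_comp, hφ i]

/-- `dim End(M)`. -/
noncomputable def dimEnd (M : NRep F r) : ℕ := Module.finrank F (endSub M)

/-- `M` has square-free socle: each simple occurs at most once in the socle
`soc M = ⊕ᵢ ker(xᵢ)`. -/
def socSquareFree (M : NRep F r) : Prop :=
  ∀ i, Module.finrank F (LinearMap.ker (Matrix.mulVecLin (M.x i))) ≤ 1

/-- Subrepresentations of `M`. -/
def SubRep (M : NRep F r) : Type :=
  {U : ∀ i : ZMod r, Submodule F (Fin (M.d i) → F) //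
    ∀ i, ∀ u ∈ U i, (M.x i).mulVec u ∈ U (i + 1)}

/-- The subrepresentation `U ⊆ M` is isomorphic to `N`. -/
def SubIso (M : NRep F r) (U : SubRep M) (N : NRep F r) : Prop :=
  ∃ φ : ∀ i : ZMod r, (Fin (N.d i) → F) ≃ₗ[F] (U.1 i),
    ∀ i (w : Fin (N.d i) → F),
      (M.x i).mulVec ((φ i w : Fin (M.d i) → F))
        = ((φ (i + 1) ((N.x i).mulVec w) : Fin (M.d (i + 1)) → F))

/-- The quotient representation `M/U` is isomorphic to `N`. -/
def QuotIso (M : NRep F r) (U : SubRep M) (N : NRep F r) : Prop :=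
  ∃ ψ : ∀ i : ZMod r, (Fin (N.d i) → F) ≃ₗ[F] ((Fin (M.d i) → F) ⧸ U.1 i),
    ∀ i (w : Fin (N.d i) → F),
      Submodule.mapQ (U.1 i) (U.1 (i + 1)) (Matrix.mulVecLin (M.x i))
          (fun u hu => by simpa [Matrix.mulVecLin_apply] using U.2 i u hu)
          (ψ i w)
        = ψ (i + 1) ((N.x i).mulVec w)

/-- The Hall number `F^M_{X,Y}`: the number of subrepresentations `U ⊆ M` with `U ≅ Y`
and `M/U ≅ X`. -/
noncomputable def hall (M X Y : NRep F r) : ℕ :=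
  Nat.card {U : SubRep M // SubIso M U Y ∧ QuotIso M U X}

variable (r) in
/-- The Euler form of the cyclic quiver `C_r`:
`⟨a,b⟩ = ∑ᵢ aᵢbᵢ − ∑ᵢ aᵢb_{i+1}`. -/
def euler (a b : ZMod r → ℕ) : ℤ :=
  ∑ i : ZMod r, (a i : ℤ) * b i - ∑ i : ZMod r, (a i : ℤ) * b (i + 1)

open scoped Classical in
/-- The coefficient of the basis element `[Rp i]` in Schiffmann–Hubery's central element
`c_n = (-1)ⁿ v^{-2rn} ∑_{dim M = nδ, soc M square-free} (-1)^{dim End M} a_M [M]`. -/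
noncomputable def ccoef (v : ℂ) {ι : Type} (Rp : ι → NRep F r) (n : ℕ) (i : ι) : ℂ :=
  if ((Rp i).d = fun _ => n) ∧ socSquareFree (Rp i)
  then (-1) ^ n * v ^ (-(2 * (r : ℤ) * n)) * (-1) ^ dimEnd (Rp i) * (aut (Rp i) : ℂ)
  else 0

/-- The coefficient of `[Rp i]` in the Hall-algebra product of elements `y, z` supported
in dimension vectors `dy, dz` respectively. -/
noncomputable def mulCoef (v : ℂ) {ι : Type} (Rp : ι → NRep F r)
    (S : (ZMod r → ℕ) → Finset ι) (y z : ι → ℂ) (dy dz : ZMod r → ℕ) (i : ι) : ℂ :=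
  ∑ j ∈ S dy, ∑ k ∈ S dz,
    v ^ euler r dy dz * (hall (Rp i) (Rp j) (Rp k) : ℂ) * y j * z k

/-- The coefficient of `[Rp j] ⊗ [Rp k]` in `Δ(u)` for `u` given by coefficients
`u : ι → ℂ` (Green's comultiplication, twisted). -/
noncomputable def comulCoef (v : ℂ) {ι : Type} (Rp : ι → NRep F r)
    (S : (ZMod r → ℕ) → Finset ι) (u : ι → ℂ) (j k : ι) : ℂ :=
  ∑ i ∈ S ((Rp j).d + (Rp k).d),
    v ^ euler r (Rp j).d (Rp k).d
      * ((aut (Rp j) : ℂ) * (aut (Rp k) : ℂ) / (aut (Rp i) : ℂ))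
      * (hall (Rp i) (Rp j) (Rp k) : ℂ) * u i

set_option linter.unusedSectionVars false

/-! ### Representations on arbitrary finite-dimensional spaces -/

/-- A finite-dimensional representation of the cyclic quiver `C_r` on arbitrary spaces. -/
structure QRep (F : Type) [Field F] (r : ℕ) where
  V : ZMod r → Type
  [ac : ∀ i, AddCommGroup (V i)]
  [mod : ∀ i, Module F (V i)]
  [fin : ∀ i, Module.Finite F (V i)]
  x : ∀ i, V i →ₗ[F] V (i + 1)

namespace QRep

attribute [instance] QRep.ac QRep.mod QRep.fin

/-- The dimension vector. -/
noncomputable def dim (A : QRep F r) (i : ZMod r) : ℕ := Module.finrank F (A.V i)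

/-- Homomorphisms of representations. -/
def hom (A B : QRep F r) : Submodule F (∀ i, A.V i →ₗ[F] B.V i) where
  carrier := {f | ∀ i a, f (i + 1) (A.x i a) = B.x i (f i a)}
  add_mem' := fun {f g} hf hg i a => by simp [hf i a, hg i a]
  zero_mem' := fun i a => by simp
  smul_mem' := fun c f hf i a => by simp [hf i a]

/-- Isomorphisms of representations. -/
@[ext] structure Iso (A B : QRep F r) where
  toFun : ∀ i, A.V i ≃ₗ[F] B.V i
  comm : ∀ i a, toFun (i + 1) (A.x i a) = B.x i (toFun i a)

namespace Iso

/-- The identity isomorphism. -/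
def refl (A : QRep F r) : Iso A A := ⟨fun _ => LinearEquiv.refl F _, fun _ _ => rfl⟩

/-- The inverse isomorphism. -/
def symm {A B : QRep F r} (φ : Iso A B) : Iso B A :=
  ⟨fun i => (φ.toFun i).symm, fun i b => by
    rw [LinearEquiv.symm_apply_eq, φ.comm, LinearEquiv.apply_symm_apply]⟩

/-- Composition of isomorphisms. -/
def trans {A B C : QRep F r} (φ : Iso A B) (ψ : Iso B C) : Iso A C :=
  ⟨fun i => (φ.toFun i).trans (ψ.toFun i), fun i a => by simp [φ.comm, ψ.comm]⟩

/-- Isomorphisms out of isomorphic objects into isomorphic objects correspond. -/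
def congr {A A' B B' : QRep F r} (φ : Iso A A') (ψ : Iso B B') : Iso A B ≃ Iso A' B' where
  toFun θ := (φ.symm.trans θ).trans ψ
  invFun θ := (φ.trans θ).trans ψ.symm
  left_inv θ := by ext i a; simp [trans, symm]
  right_inv θ := by ext i a; simp [trans, symm]

/-- Homomorphisms between isomorphic objects correspond. -/
def homCongr {A A' B B' : QRep F r} (φ : Iso A A') (ψ : Iso B B') :
    hom A B ≃ₗ[F] hom A' B' where
  toFun f := ⟨fun i => (ψ.toFun i).toLinearMap ∘ₗ f.1 i ∘ₗ (φ.toFun i).symm.toLinearMap,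
    fun i a => by
      have := φ.symm.comm i a
      simp only [symm] at this
      simp [this, f.2 i, ψ.comm]⟩
  map_add' f g := by ext i a; simp
  map_smul' c f := by ext i a; simp
  invFun f := ⟨fun i => (ψ.toFun i).symm.toLinearMap ∘ₗ f.1 i ∘ₗ (φ.toFun i).toLinearMap,
    fun i a => by
      have := ψ.symm.comm i
      simp only [symm] at this
      simp [this, f.2 i, φ.comm]⟩
  left_inv f := by ext i a; simp
  right_inv f := by ext i a; simp

end Iso

instance finiteV (A : QRep F r) (i : ZMod r) : Finite (A.V i) := Module.finite_of_finite F

/-- The dimension of the endomorphism algebra. -/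
noncomputable def e (A : QRep F r) : ℕ := Module.finrank F (hom A A)

/-- The number of automorphisms. -/
noncomputable def autCard (A : QRep F r) : ℕ := Nat.card (Iso A A)

/-- Square-free socle. -/
def Sqf (A : QRep F r) : Prop := ∀ i, Module.finrank F (LinearMap.ker (A.x i)) ≤ 1

/-- The length of the socle. -/
noncomputable def socLen (A : QRep F r) : ℕ := ∑ i, Module.finrank F (LinearMap.ker (A.x i))

/-- All components have the same dimension. -/
def Const (A : QRep F r) : Prop := ∃ n : ℕ, ∀ i, A.dim i = n

open scoped Classical in
/-- The signed automorphism count, supported on representations with square-free socle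
and constant dimension vector. -/
noncomputable def g (A : QRep F r) : ℂ :=
  if A.Const ∧ A.Sqf then (-1) ^ A.e * (A.autCard : ℂ) else 0

/-- Functions on representations which only depend on the isomorphism class. -/
def ClassFun (f : QRep F r → ℂ) : Prop := ∀ A B, Iso A B → f A = f B

namespace Iso

variable {A B : QRep F r}

theorem dim_eq (φ : Iso A B) : A.dim = B.dim := funext fun i => (φ.toFun i).finrank_eq

theorem e_eq (φ : Iso A B) : A.e = B.e := (φ.homCongr φ).finrank_eq

theorem autCard_eq (φ : Iso A B) : A.autCard = B.autCard := Nat.card_congr (φ.congr φ)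

theorem finrank_ker_eq (φ : Iso A B) (i : ZMod r) :
    Module.finrank F (LinearMap.ker (A.x i)) = Module.finrank F (LinearMap.ker (B.x i)) := by
  have : (LinearMap.ker (A.x i)).map (φ.toFun i).toLinearMap = LinearMap.ker (B.x i) := by
    ext b
    constructor
    · rintro ⟨a, ha, rfl⟩
      have ha : A.x i a = 0 := ha
      simp [← φ.comm, ha]
    · intro hb
      refine ⟨(φ.toFun i).symm b, ?_, by simp⟩
      have := φ.symm.comm i b
      have hb : B.x i b = 0 := hb
      simp only [symm, hb, map_zero] at this
      exact this.symm
  rw [← this]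
  exact ((φ.toFun i).submoduleMap (LinearMap.ker (A.x i))).finrank_eq

theorem sqf_iff (φ : Iso A B) : A.Sqf ↔ B.Sqf := by simp only [Sqf, φ.finrank_ker_eq]

theorem const_iff (φ : Iso A B) : A.Const ↔ B.Const := by simp only [Const, φ.dim_eq]

end Iso

theorem classFun_g : ClassFun (g : QRep F r → ℂ) := fun A B φ => by
  unfold g
  rw [φ.e_eq, φ.autCard_eq]
  classical exact if_congr (and_congr φ.const_iff φ.sqf_iff) rfl rfl

/-! ### Extensions -/

/-- Cocycles describing extensions of `X` by `Y`. -/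
abbrev E (X Y : QRep F r) : Type := ∀ i, X.V i →ₗ[F] Y.V (i + 1)

/-- Families of linear maps. -/
abbrev L (X Y : QRep F r) : Type := ∀ i, X.V i →ₗ[F] Y.V i

instance finite_linearMap (X Y : QRep F r) (i j : ZMod r) : Finite (X.V i →ₗ[F] Y.V j) :=
  Module.finite_of_finite F

noncomputable instance fintype_E (X Y : QRep F r) : Fintype (E X Y) := Fintype.ofFinite _

/-- The extension of `X` by `Y` given by a cocycle: `Y` is a subrepresentation with quotient `X`. -/
@[reducible] def ext (X Y : QRep F r) (η : E X Y) : QRep F r where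
  V i := X.V i × Y.V i
  x i := ((X.x i).comp (LinearMap.fst F _ _)).prod
    ((η i).comp (LinearMap.fst F _ _) + (Y.x i).comp (LinearMap.snd F _ _))

theorem ext_x (X Y : QRep F r) (η : E X Y) (i : ZMod r) (a : X.V i) (b : Y.V i) :
    (ext X Y η).x i (a, b) = (X.x i a, η i a + Y.x i b) := rfl

theorem dim_ext (X Y : QRep F r) (η : E X Y) : (ext X Y η).dim = X.dim + Y.dim := by
  funext i
  exact Module.finrank_prod

/-- `∑ᵢ dim Xᵢ · dim Yᵢ`. -/
noncomputable def G (X Y : QRep F r) : ℕ := ∑ i, X.dim i * Y.dim i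

variable (F) in
/-- The order of the ground field, as a complex number. -/
noncomputable def q : ℂ := (Fintype.card F : ℂ)

theorem q_ne_zero : q F ≠ 0 := by
  unfold q; exact_mod_cast Fintype.card_ne_zero

/-- The sum of a class function over all extensions of `X` by `Y`. -/
noncomputable def Rs (f : QRep F r → ℂ) (X Y : QRep F r) : ℂ := ∑ η : E X Y, f (ext X Y η)

/-- Transport of cocycles along isomorphisms. -/
def eCongr {X X' Y Y' : QRep F r} (φ : Iso X X') (ψ : Iso Y Y') : E X Y ≃ E X' Y' :=
  Equiv.piCongrRight fun i => (LinearEquiv.arrowCongr (φ.toFun i) (ψ.toFun (i + 1))).toEquiv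

/-- Extensions given by corresponding cocycles are isomorphic. -/
def extCongr {X X' Y Y' : QRep F r} (φ : Iso X X') (ψ : Iso Y Y') (η : E X Y) :
    Iso (ext X Y η) (ext X' Y' (eCongr φ ψ η)) where
  toFun i := LinearEquiv.prodCongr (φ.toFun i) (ψ.toFun i)
  comm i a := by
    obtain ⟨a, b⟩ := a
    simp [φ.comm, ψ.comm, eCongr]

theorem ClassFun.rs_congr {f : QRep F r → ℂ} (hf : ClassFun f) {X X' Y Y' : QRep F r}
    (φ : Iso X X') (ψ : Iso Y Y') : Rs f X Y = Rs f X' Y' :=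
  Fintype.sum_equiv (eCongr φ ψ) _ _ fun η => hf _ _ (extCongr φ ψ η)

/-- Shearing by a family of linear maps changes the cocycle by a coboundary. -/
def extShear {X Y : QRep F r} (η η' : E X Y) (f : L X Y)
    (h : ∀ i a, Y.x i (f i a) = η i a - η' i a + f (i + 1) (X.x i a)) :
    Iso (ext X Y η) (ext X Y η') where
  toFun i := LinearEquiv.ofLinearMap
    ((LinearMap.fst F _ _).prod ((f i).comp (LinearMap.fst F _ _) + LinearMap.snd F _ _))
    ((LinearMap.fst F _ _).prod (-(f i).comp (LinearMap.fst F _ _) + LinearMap.snd F _ _))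
    (by ext <;> simp) (by ext <;> simp)
  comm i a := by
    obtain ⟨a, b⟩ := a
    refine Prod.ext rfl ?_
    change f (i + 1) (X.x i a) + (η i a + Y.x i b) = η' i a + Y.x i (f i a + b)
    rw [map_add, h]; abel

/-- Reparametrisation of iterated extensions. -/
def eAssoc (X Y Z : QRep F r) :
    (Σ η : E X Y, E (ext X Y η) Z) ≃ (Σ ξ : E Y Z, E X (ext Y Z ξ)) where
  toFun p := ⟨fun i => (p.2 i).comp (LinearMap.inr F (X.V i) (Y.V i)),
    fun i => (p.1 i).prod ((p.2 i).comp (LinearMap.inl F (X.V i) (Y.V i)))⟩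
  invFun p := ⟨fun i => (LinearMap.fst F (Y.V (i + 1)) (Z.V (i + 1))).comp (p.2 i),
    fun i => ((LinearMap.snd F (Y.V (i + 1)) (Z.V (i + 1))).comp (p.2 i)).coprod (p.1 i)⟩
  left_inv p := by
    obtain ⟨η, ζ⟩ := p
    refine Sigma.ext rfl (heq_of_eq ?_)
    funext i
    refine LinearMap.ext fun a => ?_
    obtain ⟨a, b⟩ := a
    change ζ i (a, 0) + ζ i (0, b) = ζ i (a, b)
    rw [← map_add]
    congr 1
    exact Prod.ext (add_zero a) (zero_add b)
  right_inv p := by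
    obtain ⟨ξ, ζ⟩ := p
    have : (fun i => (((LinearMap.snd F (Y.V (i + 1)) (Z.V (i + 1))).comp (ζ i)).coprod
        (ξ i)).comp (LinearMap.inr F (X.V i) (Y.V i))) = ξ := by
      funext i; ext b; simp
    refine Sigma.ext this ?_
    refine heq_of_eq (?_ : (_ : ∀ i, X.V i →ₗ[F] Y.V (i + 1) × Z.V (i + 1)) = ζ)
    funext i
    refine LinearMap.ext fun a => ?_
    refine Prod.ext rfl ?_
    change (ζ i a).2 + ξ i 0 = _
    rw [map_zero, add_zero]

/-- Associativity of extensions. -/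
def extAssoc (X Y Z : QRep F r) (p : Σ η : E X Y, E (ext X Y η) Z) :
    Iso (ext (ext X Y p.1) Z p.2)
      (ext X (ext Y Z (eAssoc X Y Z p).1) (eAssoc X Y Z p).2) where
  toFun i := LinearEquiv.prodAssoc F (X.V i) (Y.V i) (Z.V i)
  comm i a := by
    obtain ⟨⟨a, b⟩, c⟩ := a
    change (X.x i a, (p.1 i a + Y.x i b, p.2 i (a, b) + Z.x i c)) =
      (X.x i a, (p.1 i a + Y.x i b, p.2 i (a, 0) + (p.2 i (0, b) + Z.x i c)))
    have : p.2 i (a, b) = p.2 i (a, 0) + p.2 i (0, b) := by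
      rw [← map_add]; congr 1; exact Prod.ext (add_zero a).symm (zero_add b).symm
    rw [this, add_assoc]

theorem ClassFun.rs_assoc {f : QRep F r → ℂ} (hf : ClassFun f) (X Y Z : QRep F r) :
    ∑ η : E X Y, Rs f (ext X Y η) Z = ∑ ξ : E Y Z, Rs f X (ext Y Z ξ) := by
  unfold Rs
  rw [← Fintype.sum_sigma', ← Fintype.sum_sigma']
  exact Fintype.sum_equiv (eAssoc X Y Z) _ _ fun p => hf _ _ (extAssoc X Y Z p)

theorem G_ext_left (X Y Z : QRep F r) (η : E X Y) : G (ext X Y η) Z = G X Z + G Y Z := by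
  simp [G, dim_ext, add_mul, Finset.sum_add_distrib]

theorem G_ext_right (X Y Z : QRep F r) (η : E X Y) : G Z (ext X Y η) = G Z X + G Z Y := by
  simp [G, dim_ext, mul_add, Finset.sum_add_distrib]

/-! ### The total operator -/

/-- The total space of a representation. -/
abbrev Tot (A : QRep F r) : Type := ∀ i, A.V i

/-- The inclusion of a component into the total space. -/
def sg (A : QRep F r) (i : ZMod r) : A.V i →ₗ[F] A.Tot := LinearMap.single F A.V i

@[simp] theorem sg_same (A : QRep F r) (i : ZMod r) (a : A.V i) : A.sg i a i = a :=
  Pi.single_eq_same _ _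

theorem sg_ne (A : QRep F r) {i k : ZMod r} (h : k ≠ i) (a : A.V i) : A.sg i a k = 0 :=
  Pi.single_eq_of_ne h _

/-- The endomorphism of the total space given by all arrows. -/
def T (A : QRep F r) : Module.End F A.Tot :=
  ∑ i, (A.sg (i + 1)).comp ((A.x i).comp (LinearMap.proj i))

theorem tot_ext {A : QRep F r} {w w' : A.Tot} (h : ∀ i, w (i + 1) = w' (i + 1)) : w = w' := by
  funext i
  obtain ⟨k, rfl⟩ : ∃ k, i = k + 1 := ⟨i - 1, by ring⟩
  exact h k

theorem T_apply_succ (A : QRep F r) (w : A.Tot) (i : ZMod r) :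
    A.T w (i + 1) = A.x i (w i) := by
  simp only [T, LinearMap.sum_apply, Finset.sum_apply, LinearMap.comp_apply, LinearMap.proj_apply]
  rw [Finset.sum_eq_single i]
  · simp
  · intro k _ hk
    exact A.sg_ne (fun h => hk (add_right_cancel h).symm) _
  · simp

theorem T_single (A : QRep F r) (i : ZMod r) (a : A.V i) :
    A.T (A.sg i a) = A.sg (i + 1) (A.x i a) := by
  refine tot_ext fun k => ?_
  rw [T_apply_succ]
  by_cases h : k = i
  · subst h; simp
  · have h' : k + 1 ≠ i + 1 := fun h' => h (add_right_cancel h')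
    simp [A.sg_ne h, A.sg_ne h']

/-- Elements of the total space concentrated in one degree. -/
def Hg {A : QRep F r} (j : ZMod r) (w : A.Tot) : Prop := ∀ i, i ≠ j → w i = 0

theorem hg_sg {A : QRep F r} (j : ZMod r) (a : A.V j) : Hg j (A.sg j a) :=
  fun _ hi => A.sg_ne hi _

theorem Hg.eq_sg {A : QRep F r} {j : ZMod r} {w : A.Tot} (h : Hg j w) : w = A.sg j (w j) := by
  funext i
  by_cases hi : i = j
  · subst hi; simp
  · rw [h i hi]; simp [A.sg_ne hi]

theorem Hg.T {A : QRep F r} {j : ZMod r} {w : A.Tot} (h : Hg j w) : Hg (j + 1) (A.T w) := by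
  rw [h.eq_sg, T_single]; exact hg_sg _ _

theorem Hg.pow_T {A : QRep F r} {j : ZMod r} {w : A.Tot} (h : Hg j w) (k : ℕ) :
    Hg (j + (k : ZMod r)) ((A.T ^ k) w) := by
  induction k with
  | zero => simpa using h
  | succ k ih =>
    rw [pow_succ', Module.End.mul_apply]
    have := ih.T
    push_cast
    rwa [← add_assoc]

theorem pow_T_add (A : QRep F r) (k l : ℕ) (w : A.Tot) :
    (A.T ^ (k + l)) w = (A.T ^ k) ((A.T ^ l) w) := by
  rw [pow_add, Module.End.mul_apply]

theorem T_pow_T (A : QRep F r) (k : ℕ) (w : A.Tot) :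
    A.T ((A.T ^ k) w) = (A.T ^ (k + 1)) w := by
  rw [pow_succ', Module.End.mul_apply]

theorem pow_T_T (A : QRep F r) (k : ℕ) (w : A.Tot) :
    (A.T ^ k) (A.T w) = (A.T ^ (k + 1)) w := by
  rw [pow_succ, Module.End.mul_apply]

/-- The component of `T^k w` in degree `j + k` only depends on the component of `w` in degree
`j`. -/
theorem pow_T_apply_add (A : QRep F r) (k : ℕ) (j : ZMod r) (w : A.Tot) :
    (A.T ^ k) w (j + (k : ZMod r)) = (A.T ^ k) (A.sg j (w j)) (j + (k : ZMod r)) := by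
  induction k generalizing j w with
  | zero =>
    have : ∀ l, l = j → w l = A.sg j (w j) l := by rintro _ rfl; simp
    exact this _ (by simp)
  | succ k ih =>
    have e1 : (j + ((k + 1 : ℕ) : ZMod r)) = (j + 1) + k := by push_cast; ring
    rw [e1, ← pow_T_T, ← pow_T_T, ih (j + 1) (A.T w), T_apply_succ, T_single]

theorem pow_T_sg (A : QRep F r) (k : ℕ) (j : ZMod r) (a : A.V j) :
    (A.T ^ k) (A.sg j a) = A.sg (j + (k : ZMod r)) ((A.T ^ k) (A.sg j a) (j + (k : ZMod r))) :=
  ((hg_sg j a).pow_T k).eq_sg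

/-- The map on total spaces induced by a family of maps. -/
def tmap {A B : QRep F r} (f : ∀ i, A.V i →ₗ[F] B.V i) : A.Tot →ₗ[F] B.Tot :=
  LinearMap.pi fun i => (f i).comp (LinearMap.proj i)

@[simp] theorem tmap_apply {A B : QRep F r} (f : ∀ i, A.V i →ₗ[F] B.V i) (w : A.Tot)
    (i : ZMod r) : tmap f w i = f i (w i) := rfl

theorem tmap_sg {A B : QRep F r} (f : ∀ i, A.V i →ₗ[F] B.V i) (i : ZMod r) (a : A.V i) :
    tmap f (A.sg i a) = B.sg i (f i a) := by
  funext k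
  by_cases h : k = i
  · subst h; simp
  · simp [A.sg_ne h, B.sg_ne h]

theorem tmap_T {A B : QRep F r} {f : ∀ i, A.V i →ₗ[F] B.V i} (hf : f ∈ hom A B) (w : A.Tot) :
    tmap f (A.T w) = B.T (tmap f w) := by
  refine tot_ext fun i => ?_
  rw [tmap_apply, T_apply_succ, T_apply_succ, tmap_apply, hf i]

theorem tmap_pow_T {A B : QRep F r} {f : ∀ i, A.V i →ₗ[F] B.V i} (hf : f ∈ hom A B) (k : ℕ)
    (w : A.Tot) : tmap f ((A.T ^ k) w) = (B.T ^ k) (tmap f w) := by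
  induction k with
  | zero => simp
  | succ k ih => rw [← T_pow_T, tmap_T hf, ih, T_pow_T]

/-- Graded maps of total spaces commuting with the total operators are homomorphisms. -/
theorem exists_hom_of_tot {A B : QRep F r} (Φ : A.Tot →ₗ[F] B.Tot)
    (hT : ∀ w, Φ (A.T w) = B.T (Φ w)) (hg : ∀ i a, Hg i (Φ (A.sg i a))) :
    ∃ f ∈ hom A B, tmap f = Φ := by
  refine ⟨fun i => (LinearMap.proj i).comp (Φ.comp (A.sg i)), ?_, ?_⟩
  · intro i a
    simp only [LinearMap.comp_apply, LinearMap.proj_apply]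
    rw [← T_single, hT, T_apply_succ]
  · refine LinearMap.pi_ext fun i a => ?_
    change tmap _ (A.sg i a) = Φ (A.sg i a)
    rw [tmap_sg, (hg i a).eq_sg]
    simp

/-- Homomorphisms constructed from a functional vanishing on `T^(h+1)` and an element killed
by `T^(h+1)`. -/
theorem exists_hom_functional (V N : QRep F r) (j l : ZMod r) (h : ℕ) (hl : l = j + h)
    (p : V.V l →ₗ[F] F) (hp : ∀ w, p ((V.T ^ (h + 1)) w l) = 0) (n : N.V j)
    (hn : (N.T ^ (h + 1)) (N.sg j n) = 0) :
    ∃ f ∈ hom V N, ∀ w, tmap f w =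
      ∑ k ∈ range (h + 1), p ((V.T ^ (h - k)) w l) • (N.T ^ k) (N.sg j n) := by
  let Φ : V.Tot →ₗ[F] N.Tot := ∑ k ∈ range (h + 1),
    (p.comp ((LinearMap.proj l).comp (V.T ^ (h - k)))).smulRight ((N.T ^ k) (N.sg j n))
  have hΦ : ∀ w, Φ w = ∑ k ∈ range (h + 1), p ((V.T ^ (h - k)) w l) • (N.T ^ k) (N.sg j n) := by
    intro w; simp [Φ]
  suffices h12 : (∀ w, Φ (V.T w) = N.T (Φ w)) ∧ ∀ i a, Hg i (Φ (V.sg i a)) by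
    obtain ⟨f, hf, hfΦ⟩ := exists_hom_of_tot Φ h12.1 h12.2
    exact ⟨f, hf, fun w => by rw [hfΦ, hΦ]⟩
  constructor
  · intro w
    rw [hΦ, hΦ, Finset.sum_range_succ', Finset.sum_range_succ, map_add, map_sum]
    simp only [map_smul, T_pow_T, hn, smul_zero, add_zero, Nat.sub_zero, pow_T_T, hp, zero_smul]
    refine Finset.sum_congr rfl fun k hk => ?_
    have : h - (k + 1) + 1 = h - k := by have := Finset.mem_range.1 hk; omega
    rw [this]
  · intro i a i' hi'
    rw [hΦ, Finset.sum_apply]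
    refine Finset.sum_eq_zero fun k hk => ?_
    have hk := Finset.mem_range.1 hk
    by_cases h1 : i' = j + k
    · rw [((hg_sg i a).pow_T (h - k)) l, map_zero, zero_smul, Pi.zero_apply]
      · intro h2
        apply hi'
        have : ((h - k : ℕ) : ZMod r) = (h : ZMod r) - k := by
          rw [Nat.cast_sub (by omega)]
        rw [hl, this] at h2
        rw [h1]
        linear_combination h2
    · rw [Pi.smul_apply, ((hg_sg j n).pow_T k) i' h1, smul_zero]

/-! ### Nilpotent chains -/

theorem exists_lowest {M : Type*} [AddCommGroup M] [Module F M] (f : Module.End F M) (z : M)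
    (h : ℕ) (hz : (f ^ (h + 1)) z = 0) (c : ℕ → F) (hc : ∃ k ≤ h, c k ≠ 0) :
    ∃ k ≤ h, c k ≠ 0 ∧
      (f ^ (h - k)) (∑ k ∈ range (h + 1), c k • (f ^ k) z) = c k • (f ^ h) z := by
  classical
  refine ⟨Nat.find hc, (Nat.find_spec hc).1, (Nat.find_spec hc).2, ?_⟩
  set m := Nat.find hc
  have hm : m ≤ h := (Nat.find_spec hc).1
  rw [map_sum, Finset.sum_eq_single m]
  · rw [map_smul, ← Module.End.mul_apply, ← pow_add, Nat.sub_add_cancel hm]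
  · intro k hk hkm
    have hk := Finset.mem_range.1 hk
    rcases lt_or_gt_of_ne hkm with h1 | h1
    · have := Nat.find_min hc h1
      have : c k = 0 := by by_contra h2; exact this ⟨by omega, h2⟩
      simp [this]
    · rw [map_smul, ← Module.End.mul_apply, ← pow_add]
      have : h - m + k = (k - m - 1) + (h + 1) := by omega
      rw [this, pow_add, Module.End.mul_apply, hz, map_zero, smul_zero]
  · intro h1; exact absurd (Finset.mem_range.2 (by omega)) h1

theorem linearIndependent_pow {M : Type*} [AddCommGroup M] [Module F M] (f : Module.End F M)
    (z : M) (h : ℕ) (hz : (f ^ (h + 1)) z = 0) (hz' : (f ^ h) z ≠ 0) :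
    LinearIndependent F (fun k : Fin (h + 1) => (f ^ (k : ℕ)) z) := by
  rw [Fintype.linearIndependent_iff]
  intro c hc i
  by_contra hi
  let c' : ℕ → F := fun k => if hk : k < h + 1 then c ⟨k, hk⟩ else 0
  have hc' : ∑ k ∈ range (h + 1), c' k • (f ^ k) z = 0 := by
    rw [Finset.sum_range, ← hc]
    refine Finset.sum_congr rfl fun k _ => ?_
    simp only [c', dif_pos k.2]
  obtain ⟨k, -, hk, hk'⟩ := exists_lowest f z h hz c'
    ⟨i, Nat.lt_succ_iff.1 i.2, by simp only [c', dif_pos i.2]; exact hi⟩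
  rw [hc', map_zero] at hk'
  exact (smul_ne_zero hk hz') hk'.symm

/-- An isomorphism from a homomorphism with bijective components. -/
noncomputable def isoOfBijective {A B : QRep F r} (f : ∀ i, A.V i →ₗ[F] B.V i)
    (hf : f ∈ hom A B) (hb : ∀ i, Function.Bijective (f i)) : Iso A B :=
  ⟨fun i => LinearEquiv.ofBijective (f i) (hb i), hf⟩

/-- The total dimension. -/
noncomputable def tdim (A : QRep F r) : ℕ := ∑ i, A.dim i

theorem finrank_tot (A : QRep F r) : Module.finrank F A.Tot = A.tdim :=
  Module.finrank_pi_fintype F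

/-- The representation `A` is uniserial of length `h + 1`, generated by `z` in degree `j`. -/
structure Uni (A : QRep F r) (h : ℕ) (j : ZMod r) (z : A.V j) : Prop where
  pow : A.T ^ (h + 1) = 0
  rank : A.tdim ≤ h + 1
  ne : (A.T ^ h) (A.sg j z) ≠ 0

namespace Uni

variable {A : QRep F r} {h : ℕ} {j : ZMod r} {z : A.V j}

theorem linearIndependent (U : Uni A h j z) :
    LinearIndependent F (fun k : Fin (h + 1) => (A.T ^ (k : ℕ)) (A.sg j z)) :=
  linearIndependent_pow _ _ _ (by rw [U.pow]; rfl) U.ne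

theorem tdim_eq (U : Uni A h j z) : A.tdim = h + 1 := by
  refine le_antisymm U.rank ?_
  have := U.linearIndependent.fintype_card_le_finrank
  rwa [Fintype.card_fin, finrank_tot] at this

/-- The basis of iterated images of the generator. -/
noncomputable def basis (U : Uni A h j z) : Module.Basis (Fin (h + 1)) F A.Tot :=
  basisOfLinearIndependentOfCardEqFinrank U.linearIndependent
    (by rw [Fintype.card_fin, finrank_tot, U.tdim_eq])

theorem basis_apply (U : Uni A h j z) (k : Fin (h + 1)) :
    U.basis k = (A.T ^ (k : ℕ)) (A.sg j z) := by
  simp [basis]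

theorem exists_coeff (U : Uni A h j z) (w : A.Tot) :
    ∃ c : ℕ → F, w = ∑ k ∈ range (h + 1), c k • (A.T ^ k) (A.sg j z) := by
  refine ⟨fun k => if hk : k < h + 1 then U.basis.repr w ⟨k, hk⟩ else 0, ?_⟩
  rw [Finset.sum_range]
  conv_lhs => rw [← U.basis.sum_repr w]
  refine Finset.sum_congr rfl fun k _ => ?_
  simp only [basis_apply, dif_pos k.2]

/-- The coordinate at the socle. -/
noncomputable def top (U : Uni A h j z) : A.Tot →ₗ[F] F := U.basis.coord (Fin.last h)

theorem top_pow (U : Uni A h j z) {k : ℕ} (hk : k ≤ h) :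
    U.top ((A.T ^ k) (A.sg j z)) = if k = h then 1 else 0 := by
  have := U.basis_apply ⟨k, by omega⟩
  simp only at this
  rw [← this, top, Module.Basis.coord_apply, Module.Basis.repr_self, Finsupp.single_apply]
  simp [Fin.ext_iff]

theorem top_sum (U : Uni A h j z) (c : ℕ → F) :
    U.top (∑ k ∈ range (h + 1), c k • (A.T ^ k) (A.sg j z)) = c h := by
  rw [map_sum, Finset.sum_eq_single h]
  · simp [U.top_pow le_rfl]
  · intro k hk hkh
    rw [map_smul, U.top_pow (by have := Finset.mem_range.1 hk; omega), if_neg hkh, smul_zero]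
  · simp

theorem top_comp (U : Uni A h j z) {k : ℕ} (hk : k ≤ h) :
    U.top (A.sg (j + (h : ZMod r)) ((A.T ^ k) (A.sg j z) (j + (h : ZMod r)))) =
      if k = h then 1 else 0 := by
  by_cases e : (j + (h : ZMod r)) = j + (k : ZMod r)
  · have := (hg_sg j z).pow_T k
    rw [← e] at this
    rw [← this.eq_sg, U.top_pow hk]
  · rw [(hg_sg j z).pow_T k _ e, map_zero, map_zero, if_neg]
    rintro rfl
    exact e rfl

/-- A homomorphism out of a uniserial representation is determined by the image of the
generator. -/
theorem hom_ext (U : Uni A h j z) {N : QRep F r} {f g : ∀ i, A.V i →ₗ[F] N.V i}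
    (hf : f ∈ hom A N) (hg : g ∈ hom A N) (e : f j z = g j z) : f = g := by
  have : tmap f = tmap g := by
    refine U.basis.ext fun k => ?_
    rw [basis_apply, tmap_pow_T hf, tmap_pow_T hg, tmap_sg, tmap_sg, e]
  funext i
  refine LinearMap.ext fun a => ?_
  have := congrFun (congrArg (fun φ => φ (A.sg i a)) this) i
  simpa using this

theorem exists_hom (U : Uni A h j z) {N : QRep F r} (n : N.V j)
    (hn : (N.T ^ (h + 1)) (N.sg j n) = 0) : ∃ f ∈ hom A N, f j z = n := by
  obtain ⟨f, hf, hf'⟩ := exists_hom_functional A N j (j + h) h rfl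
    (U.top.comp (A.sg _)) (by simp [U.pow]) n hn
  refine ⟨f, hf, ?_⟩
  have h1 := congrFun (hf' (A.sg j z)) j
  rw [tmap_sg] at h1
  rw [sg_same] at h1
  rw [h1, Finset.sum_apply, Finset.sum_eq_single 0]
  · have := U.top_comp le_rfl
    simp [this]
  · intro k hk hk0
    have := U.top_comp (k := h - k) (by omega)
    rw [if_neg (by have := Finset.mem_range.1 hk; omega)] at this
    simp [this]
  · simp

theorem finrank_hom_left (U : Uni A h j z) {N : QRep F r} (hN : N.T ^ (h + 1) = 0) :
    Module.finrank F (hom A N) = N.dim j := by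
  let ev : hom A N →ₗ[F] N.V j :=
    { toFun := fun f => f.1 j z, map_add' := fun _ _ => rfl, map_smul' := fun _ _ => rfl }
  refine (LinearEquiv.ofBijective ev ⟨fun f g e => ?_, fun n => ?_⟩).finrank_eq
  · exact Subtype.ext (U.hom_ext f.2 g.2 e)
  · obtain ⟨f, hf, e⟩ := U.exists_hom (N := N) n (by rw [hN]; rfl)
    exact ⟨⟨f, hf⟩, e⟩

theorem finrank_hom_right (U : Uni A h j z) {N : QRep F r} (hN : N.T ^ (h + 1) = 0) :
    Module.finrank F (hom N A) = N.dim (j + h) := by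
  let ev : hom N A →ₗ[F] Module.Dual F (N.V (j + h)) :=
    { toFun := fun f => (U.top.comp (A.sg _)).comp (f.1 (j + h))
      map_add' := fun f g => by ext; simp
      map_smul' := fun c f => by ext; simp }
  rw [(LinearEquiv.ofBijective ev ⟨?_, fun p => ?_⟩).finrank_eq, Subspace.dual_finrank_eq]; rfl
  · rw [← LinearMap.ker_eq_bot, LinearMap.ker_eq_bot']
    rintro ⟨f, hf⟩ hev
    have key : ∀ i a, f i a = 0 := by
      intro i a
      by_contra hne
      obtain ⟨c, hc⟩ := U.exists_coeff (A.sg i (f i a))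
      have hcne : ∃ k ≤ h, c k ≠ 0 := by
        by_contra hcon
        push Not at hcon
        rw [Finset.sum_eq_zero] at hc
        · have := congrFun hc i
          simp at this
          exact hne this
        · intro k hk
          rw [hcon k (by have := Finset.mem_range.1 hk; omega), zero_smul]
      obtain ⟨k, hk, hck, hlow⟩ := exists_lowest A.T (A.sg j z) h (by rw [U.pow]; rfl) c hcne
      rw [← hc, ← tmap_sg, ← tmap_pow_T hf] at hlow
      have h2 := congrFun hlow (j + h)
      rw [tmap_apply] at h2
      have h3 := congrArg (fun φ => φ ((N.T ^ (h - k)) (N.sg i a) (j + h))) hev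
      change U.top (A.sg _ (f (j + h) _)) = 0 at h3
      rw [h2, Pi.smul_apply, map_smul, map_smul, U.top_comp le_rfl] at h3
      simp at h3
      exact hck h3
    refine Subtype.ext ?_
    funext i
    exact LinearMap.ext (key i)
  · obtain ⟨f, hf, hf'⟩ := exists_hom_functional N A j (j + h) h rfl p (by simp [hN]) z
      (by rw [U.pow]; rfl)
    refine ⟨⟨f, hf⟩, LinearMap.ext fun a => ?_⟩
    change U.top (A.sg _ (f (j + h) a)) = p a
    rw [← tmap_sg, hf', U.top_sum (fun k => p ((N.T ^ (h - k)) (N.sg (j + h) a) (j + h)))]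
    simp

theorem nonempty_iso (U : Uni A h j z) {B : QRep F r} {z' : B.V j} (U' : Uni B h j z') :
    Nonempty (Iso A B) := by
  obtain ⟨f, hf, hfz⟩ := U.exists_hom (N := B) z' (by rw [U'.pow]; rfl)
  obtain ⟨g, hg, hgz⟩ := U'.exists_hom (N := A) z (by rw [U.pow]; rfl)
  have h1 : (fun i => (g i).comp (f i)) = fun i => LinearMap.id :=
    U.hom_ext (fun i a => by simp [hf i, hg i]) (fun i a => rfl) (by simp [hfz, hgz])
  have h2 : (fun i => (f i).comp (g i)) = fun i => LinearMap.id :=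
    U'.hom_ext (fun i a => by simp [hf i, hg i]) (fun i a => rfl) (by simp [hfz, hgz])
  exact ⟨⟨fun i => LinearEquiv.ofLinearMap (f i) (g i) (congrFun h2 i) (congrFun h1 i), hf⟩⟩

end Uni

/-! ### Subrepresentations and quotients -/

/-- Subrepresentations. -/
@[ext] structure Sb (A : QRep F r) where
  U : ∀ i, Submodule F (A.V i)
  st : ∀ i, ∀ u ∈ U i, A.x i u ∈ U (i + 1)

/-- A subrepresentation as a representation. -/
@[reducible] def sub (A : QRep F r) (W : Sb A) : QRep F r where
  V i := W.U i
  x i := (A.x i).restrict (W.st i)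

/-- The quotient by a subrepresentation. -/
@[reducible] def quo (A : QRep F r) (W : Sb A) : QRep F r where
  V i := A.V i ⧸ W.U i
  x i := (W.U i).mapQ (W.U (i + 1)) (A.x i) (W.st i)

theorem subtype_mem_hom (A : QRep F r) (W : Sb A) :
    (fun i => (W.U i).subtype) ∈ hom (A.sub W) A := fun _ _ => rfl

theorem mkQ_mem_hom (A : QRep F r) (W : Sb A) :
    (fun i => (W.U i).mkQ) ∈ hom A (A.quo W) := fun _ _ => rfl

theorem inr_mem_hom (X Y : QRep F r) (η : E X Y) :
    (fun i => LinearMap.inr F (X.V i) (Y.V i)) ∈ hom Y (ext X Y η) := fun i a => by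
  simp

theorem fst_mem_hom (X Y : QRep F r) (η : E X Y) :
    (fun i => LinearMap.fst F (X.V i) (Y.V i)) ∈ hom (ext X Y η) X := fun _ _ => rfl

/-- A representation with complementary subrepresentations is a split extension. -/
noncomputable def splitIso {A : QRep F r} (W W' : Sb A) (h : ∀ i, IsCompl (W.U i) (W'.U i)) :
    Iso (ext (A.sub W) (A.sub W') 0) A where
  toFun i := Submodule.prodEquivOfIsCompl _ _ (h i)
  comm i a := by
    obtain ⟨a, b⟩ := a
    simp

/-- The kernel of a homomorphism. -/
def kerSb {A B : QRep F r} {f : ∀ i, A.V i →ₗ[F] B.V i} (hf : f ∈ hom A B) : Sb A where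
  U i := LinearMap.ker (f i)
  st i u hu := by
    rw [LinearMap.mem_ker] at hu ⊢
    rw [hf, hu, map_zero]

/-- The range of a homomorphism. -/
def rangeSb {A B : QRep F r} {f : ∀ i, A.V i →ₗ[F] B.V i} (hf : f ∈ hom A B) : Sb B where
  U i := LinearMap.range (f i)
  st i u hu := by
    obtain ⟨a, rfl⟩ := hu
    exact ⟨A.x i a, hf i a⟩

theorem tmap_injective {A B : QRep F r} {f : ∀ i, A.V i →ₗ[F] B.V i}
    (hi : ∀ i, Function.Injective (f i)) : Function.Injective (tmap f) := fun w w' h => by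
  funext i
  exact hi i (congrFun h i)

theorem tmap_surjective {A B : QRep F r} {f : ∀ i, A.V i →ₗ[F] B.V i}
    (hi : ∀ i, Function.Surjective (f i)) : Function.Surjective (tmap f) := fun w => by
  choose w' hw' using fun i => hi i (w i)
  exact ⟨w', funext hw'⟩

theorem pow_T_eq_zero_of_injective {A B : QRep F r} {f : ∀ i, A.V i →ₗ[F] B.V i}
    (hf : f ∈ hom A B) (hi : ∀ i, Function.Injective (f i)) {k : ℕ} (hk : B.T ^ k = 0) :
    A.T ^ k = 0 := by
  refine LinearMap.ext fun w => tmap_injective hi ?_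
  rw [tmap_pow_T hf, hk]
  simp

theorem pow_T_eq_zero_of_surjective {A B : QRep F r} {f : ∀ i, A.V i →ₗ[F] B.V i}
    (hf : f ∈ hom A B) (hi : ∀ i, Function.Surjective (f i)) {k : ℕ} (hk : A.T ^ k = 0) :
    B.T ^ k = 0 := by
  refine LinearMap.ext fun w => ?_
  obtain ⟨w, rfl⟩ := tmap_surjective hi w
  rw [← tmap_pow_T hf, hk]
  simp

/-- Nilpotent representations. -/
def Nil (A : QRep F r) : Prop := ∃ k, A.T ^ k = 0

theorem Nil.sub {A : QRep F r} (h : A.Nil) (W : Sb A) : (A.sub W).Nil :=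
  h.imp fun _ hk => pow_T_eq_zero_of_injective (subtype_mem_hom A W)
    (fun _ => Subtype.val_injective) hk

theorem Nil.quo {A : QRep F r} (h : A.Nil) (W : Sb A) : (A.quo W).Nil :=
  h.imp fun _ hk => pow_T_eq_zero_of_surjective (mkQ_mem_hom A W)
    (fun _ => Submodule.mkQ_surjective _) hk

theorem Iso.mem_hom {A B : QRep F r} (φ : Iso A B) :
    (fun i => (φ.toFun i).toLinearMap) ∈ hom A B := φ.comm

theorem Nil.iso {A B : QRep F r} (h : A.Nil) (φ : Iso A B) : B.Nil :=
  h.imp fun _ hk => pow_T_eq_zero_of_surjective φ.mem_hom (fun i => (φ.toFun i).surjective) hk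

theorem Nil.ext {X Y : QRep F r} (hX : X.Nil) (hY : Y.Nil) (η : E X Y) :
    (QRep.ext X Y η).Nil := by
  obtain ⟨k, hk⟩ := hX
  obtain ⟨l, hl⟩ := hY
  refine ⟨l + k, LinearMap.ext fun w => ?_⟩
  rw [pow_T_add]
  have h1 := tmap_pow_T (fst_mem_hom X Y η) k w
  rw [hk] at h1
  have h2 : ((QRep.ext X Y η).T ^ k) w =
      tmap (fun i => LinearMap.inr F (X.V i) (Y.V i))
        (fun i => (((QRep.ext X Y η).T ^ k) w i).2 : Y.Tot) := by
    funext i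
    exact Prod.ext (congrFun h1 i) rfl
  rw [h2, ← tmap_pow_T (inr_mem_hom X Y η), hl]
  simp

theorem tdim_ext (X Y : QRep F r) (η : E X Y) : (ext X Y η).tdim = X.tdim + Y.tdim := by
  simp [tdim, dim_ext, Finset.sum_add_distrib]

theorem Iso.tdim_eq {A B : QRep F r} (φ : Iso A B) : A.tdim = B.tdim := by
  rw [tdim, tdim, φ.dim_eq]

theorem tot_eq_sum (A : QRep F r) (w : A.Tot) : w = ∑ i, A.sg i (w i) := by
  funext k
  rw [Finset.sum_apply, Finset.sum_eq_single k]
  · simp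
  · intro i _ hi; exact A.sg_ne hi.symm _
  · simp

/-- A uniserial submodule of maximal height is a direct summand. -/
theorem exists_uni_summand (X : QRep F r) (h : ℕ) (j : ZMod r) (z : X.V j)
    (hX : X.T ^ (h + 1) = 0) (hz : (X.T ^ h) (X.sg j z) ≠ 0) :
    ∃ (B N : Sb X) (z' : B.U j), (∀ i, IsCompl (B.U i) (N.U i)) ∧ Uni (X.sub B) h j z' ∧
      ∀ i, ∀ a ∈ B.U i, ∃ c : ℕ → F,
        X.sg i a = ∑ k ∈ range (h + 1), c k • (X.T ^ k) (X.sg j z) := by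
  classical
  have hz1 : (X.T ^ (h + 1)) (X.sg j z) = 0 := by rw [hX]; rfl
  have hl : (X.T ^ h) (X.sg j z) (j + (h : ZMod r)) ≠ 0 := by
    intro h0
    apply hz
    rw [pow_T_sg, h0, map_zero]
  obtain ⟨p, hp, -⟩ := Submodule.exists_le_ker_of_notMem
    (p := (⊥ : Submodule F (X.V (j + (h : ZMod r))))) (fun h0 => hl ((Submodule.mem_bot F).1 h0))
  obtain ⟨f, hf, hf'⟩ := exists_hom_functional X X j (j + h) h rfl p (by simp [hX]) z hz1
  have hft : tmap f ((X.T ^ h) (X.sg j z)) ≠ 0 := by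
    rw [hf', Finset.sum_eq_single h]
    · simp only [Nat.sub_self, pow_zero, Module.End.one_apply]
      exact smul_ne_zero hp hz
    · intro k hk hkh
      have hk := Finset.mem_range.1 hk
      have : h - k + h = (h - k - 1) + (h + 1) := by omega
      rw [← pow_T_add, this, pow_T_add, hz1]
      simp
    · simp
  have hspan : ∀ i, ∀ a ∈ (rangeSb hf).U i, ∃ c : ℕ → F,
        X.sg i a = ∑ k ∈ range (h + 1), c k • (X.T ^ k) (X.sg j z) := by
    rintro i _ ⟨a, rfl⟩
    exact ⟨fun k => p ((X.T ^ (h - k)) (X.sg i a) (j + h)), by rw [← hf', tmap_sg]⟩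
  have hdisj : ∀ i, Disjoint ((rangeSb hf).U i) ((kerSb hf).U i) := by
    intro i
    rw [Submodule.disjoint_def]
    intro a ha ha'
    by_contra hne
    obtain ⟨c, hc⟩ := hspan i a ha
    have hcne : ∃ k ≤ h, c k ≠ 0 := by
      by_contra hcon
      push Not at hcon
      rw [Finset.sum_eq_zero] at hc
      · have := congrFun hc i
        rw [sg_same] at this
        exact hne this
      · intro k hk
        rw [hcon k (by have := Finset.mem_range.1 hk; omega), zero_smul]
    obtain ⟨k, hk, hck, hlow⟩ := exists_lowest X.T (X.sg j z) h hz1 c hcne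
    rw [← hc] at hlow
    have h2 := congrArg (tmap f) hlow
    rw [tmap_pow_T hf, tmap_sg, LinearMap.mem_ker.1 ha', map_zero, map_zero, map_smul] at h2
    exact smul_ne_zero hck hft h2.symm
  have hz' : f j z ∈ (rangeSb hf).U j := ⟨z, rfl⟩
  refine ⟨rangeSb hf, kerSb hf, ⟨f j z, hz'⟩, fun i => ?_, ⟨?_, ?_, ?_⟩, hspan⟩
  · refine (Submodule.isCompl_iff_disjoint _ _ ?_).2 (hdisj i)
    exact (LinearMap.finrank_range_add_finrank_ker (f i)).ge
  · exact pow_T_eq_zero_of_injective (subtype_mem_hom X _) (fun _ => Subtype.val_injective) hX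
  · rw [← finrank_tot]
    have hle : LinearMap.range (tmap (A := X.sub (rangeSb hf)) (fun i => ((rangeSb hf).U i).subtype)) ≤
        Submodule.span F ((Finset.range (h + 1)).image (fun k => (X.T ^ k) (X.sg j z)) :
          Set X.Tot) := by
      rintro _ ⟨w, rfl⟩
      rw [(X.sub (rangeSb hf)).tot_eq_sum w, map_sum]
      refine Submodule.sum_mem _ fun i _ => ?_
      rw [tmap_sg]
      obtain ⟨c, hc⟩ := hspan i (w i) (w i).2
      change X.sg i (w i) ∈ _
      rw [hc]
      refine Submodule.sum_mem _ fun k hk => Submodule.smul_mem _ _ (Submodule.subset_span ?_)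
      rw [Finset.coe_image]
      exact ⟨k, hk, rfl⟩
    have hinj := tmap_injective (A := X.sub (rangeSb hf)) (f := fun i => ((rangeSb hf).U i).subtype)
      (fun _ => Subtype.val_injective)
    rw [← LinearMap.finrank_range_of_inj hinj]
    refine (Submodule.finrank_mono hle).trans ((finrank_span_finset_le_card _).trans ?_)
    exact Finset.card_image_le.trans (by simp)
  · intro h0
    apply hft
    have h1 := congrArg (tmap (A := X.sub (rangeSb hf)) (fun i => ((rangeSb hf).U i).subtype)) h0
    rw [tmap_pow_T (subtype_mem_hom X _), tmap_sg, map_zero] at h1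
    rw [tmap_pow_T hf, tmap_sg]
    exact h1

theorem exists_height {X : QRep F r} (hX : X.Nil) (h0 : X.tdim ≠ 0) :
    ∃ (h : ℕ) (j : ZMod r) (z : X.V j), X.T ^ (h + 1) = 0 ∧ (X.T ^ h) (X.sg j z) ≠ 0 := by
  classical
  have hn : Nat.find hX ≠ 0 := by
    intro h
    have h1 := Nat.find_spec hX
    rw [h, pow_zero] at h1
    apply h0
    rw [← finrank_tot]
    have : Subsingleton X.Tot := ⟨fun a b => by
      have ha := LinearMap.congr_fun h1 a
      have hb := LinearMap.congr_fun h1 b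
      simp only [Module.End.one_apply, LinearMap.zero_apply] at ha hb
      rw [ha, hb]⟩
    exact Module.finrank_zero_of_subsingleton
  obtain ⟨h, hh⟩ := Nat.exists_eq_succ_of_ne_zero hn
  have h1 := Nat.find_spec hX
  rw [hh] at h1
  have h2 := Nat.find_min hX (m := h) (by omega)
  refine ⟨h, ?_⟩
  by_contra hcon
  push Not at hcon
  apply h2
  refine LinearMap.ext fun w => ?_
  rw [X.tot_eq_sum w, map_sum]
  exact Finset.sum_eq_zero fun i _ => hcon i (w i) h1

/-- A nonzero nilpotent representation has a uniserial summand of maximal height. -/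
theorem exists_uni_decomp {X : QRep F r} (hX : X.Nil) (h0 : X.tdim ≠ 0) :
    ∃ (A N : QRep F r) (h : ℕ) (j : ZMod r) (z : A.V j), Uni A h j z ∧ N.T ^ (h + 1) = 0 ∧
      Nonempty (Iso (ext A N 0) X) := by
  obtain ⟨h, j, z, hT, hz⟩ := exists_height hX h0
  obtain ⟨B, N, z', hc, hU, -⟩ := exists_uni_summand X h j z hT hz
  exact ⟨_, _, h, j, z', hU, pow_T_eq_zero_of_injective (subtype_mem_hom X N)
    (fun _ => Subtype.val_injective) hT, ⟨splitIso B N hc⟩⟩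

/-! ### Counting -/

theorem exists_fiber_card {P Q : Type*} [AddCommGroup P] [AddCommGroup Q] [Fintype P] [Fintype Q]
    (φ : P →+ Q) (hφ : Function.Surjective φ) :
    ∃ K : ℂ, (∀ w : Q → ℂ, ∑ p, w (φ p) = K * ∑ c, w c) ∧
      K * Fintype.card Q = Fintype.card P := by
  classical
  have h1 : ∀ w : Q → ℂ, ∑ p, w (φ p) =
      ((Finset.univ.filter fun p => φ p = 0).card : ℂ) * ∑ c, w c := by
    intro w
    rw [← Finset.sum_fiberwise Finset.univ φ, Finset.mul_sum]
    refine Finset.sum_congr rfl fun c _ => ?_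
    rw [Finset.sum_congr rfl (g := fun _ => w c)
      (fun p hp => by rw [(Finset.mem_filter.1 hp).2]), Finset.sum_const, nsmul_eq_mul]
    rw [AddMonoidHom.card_fiber_eq_of_mem_range φ (hφ c) (hφ 0)]
  refine ⟨_, h1, ?_⟩
  have := h1 fun _ => 1
  simpa using this.symm

theorem card_eq_q_pow (M : Type*) [AddCommGroup M] [Module F M] [Module.Finite F M] [Fintype M] :
    (Fintype.card M : ℂ) = q F ^ Module.finrank F M := by
  rw [Module.card_eq_pow_finrank (K := F), Nat.cast_pow]; rfl

noncomputable instance fintype_hom (X Y : QRep F r) : Fintype (hom X Y) := Fintype.ofFinite _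

/-! ### Automorphisms of representations with square-free socle -/

theorem sg_mem_range_pow (A : QRep F r) (k : ℕ) (i : ZMod r) (s : A.V i) (w : A.Tot)
    (hw : (A.T ^ k) w i = s) : ∃ (j : ZMod r) (n : A.V j), i = j + k ∧
      (A.T ^ k) (A.sg j n) = A.sg i s := by
  obtain ⟨j, rfl⟩ : ∃ j : ZMod r, i = j + k := ⟨i - k, by ring⟩
  refine ⟨j, w j, rfl, ?_⟩
  rw [pow_T_sg, ← hw, ← pow_T_apply_add]

/-- In a nilpotent representation, there are endomorphisms scaling one socle element and
killing the socle in the other degrees. -/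
theorem exists_end_socle {A : QRep F r} (hA : A.Nil) (i : ZMod r) (s : A.V i) (hs : A.x i s = 0)
    (hs0 : s ≠ 0) : ∃ f ∈ hom A A, (∃ c : F, c ≠ 0 ∧ f i s = c • s) ∧
      ∀ k, k ≠ i → ∀ t, A.x k t = 0 → f k t = 0 := by
  classical
  have hex : ∃ k, A.sg i s ∉ LinearMap.range (A.T ^ k) := by
    obtain ⟨k, hk⟩ := hA
    refine ⟨k, ?_⟩
    rw [hk]
    rintro ⟨w, hw⟩
    apply hs0
    have := congrFun hw i
    rw [sg_same] at this
    exact this.symm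
  have hn : Nat.find hex ≠ 0 := fun h0 => by
    have := Nat.find_spec hex
    rw [h0] at this
    exact this ⟨A.sg i s, rfl⟩
  obtain ⟨h, hh⟩ := Nat.exists_eq_succ_of_ne_zero hn
  have h1 := Nat.find_spec hex
  rw [hh] at h1
  have h2 := Nat.find_min hex (m := h) (by omega)
  push Not at h2
  obtain ⟨w, hw⟩ := h2
  obtain ⟨j, n, hij, hn⟩ := A.sg_mem_range_pow h i s w (by rw [hw, sg_same])
  have hTs : ∀ k t, A.x k t = 0 → ∀ m, m ≠ 0 → (A.T ^ m) (A.sg k t) = 0 := by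
    intro k t ht m hm
    obtain ⟨m, rfl⟩ := Nat.exists_eq_succ_of_ne_zero hm
    rw [Nat.succ_eq_add_one, ← pow_T_T, T_single, ht, map_zero, map_zero]
  obtain ⟨p, hp, hp'⟩ := Submodule.exists_le_ker_of_notMem
    (p := LinearMap.range ((LinearMap.proj i : A.Tot →ₗ[F] A.V i).comp (A.T ^ (h + 1))))
    (v := s) (by
      rintro ⟨w, hw⟩
      obtain ⟨j, n, -, hn⟩ := A.sg_mem_range_pow (h + 1) i s w hw
      exact h1 ⟨_, hn⟩)
  obtain ⟨f, hf, hf'⟩ := exists_hom_functional A A j i h hij p (fun w => hp' ⟨w, rfl⟩) n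
    (by rw [← T_pow_T, hn, T_single, hs, map_zero])
  have key : ∀ k t, A.x k t = 0 → tmap f (A.sg k t) = p (A.sg k t i) • A.sg i s := by
    intro k t ht
    rw [hf', Finset.sum_eq_single h]
    · simp [hn]
    · intro m hm hmh
      rw [hTs k t ht (h - m) (by have := Finset.mem_range.1 hm; omega)]
      simp
    · simp
  refine ⟨f, hf, ⟨p s, hp, ?_⟩, fun k hk t ht => ?_⟩
  · have := congrFun (key i s hs) i
    rw [tmap_sg] at this
    simpa using this
  · have := congrFun (key k t ht) k
    rw [tmap_sg, A.sg_ne hk.symm] at this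
    simpa using this

theorem injective_of_socle {A B : QRep F r} (hA : A.Nil) {f : ∀ i, A.V i →ₗ[F] B.V i}
    (hf : f ∈ hom A B) (hs : ∀ i a, A.x i a = 0 → f i a = 0 → a = 0) (i : ZMod r) :
    Function.Injective (f i) := by
  rw [← LinearMap.ker_eq_bot, LinearMap.ker_eq_bot']
  obtain ⟨k, hk⟩ := hA
  have : ∀ k i a, (A.T ^ k) (A.sg i a) = 0 → f i a = 0 → a = 0 := by
    intro k
    induction k with
    | zero =>
      intro i a h _
      have := congrFun h i
      simpa using this
    | succ k ih =>
      intro i a h h'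
      rw [← pow_T_T, T_single] at h
      exact hs i a (ih _ _ h (by rw [hf, h', map_zero])) h'
  exact fun a ha => this k i a (by rw [hk]; rfl) ha

theorem autCard_eq_of_sqf {A : QRep F r} (hA : A.Nil) (hS : A.Sqf) :
    (A.autCard : ℂ) * q F ^ A.socLen = q F ^ A.e * (q F - 1) ^ A.socLen := by
  classical
  let I := {i : ZMod r // LinearMap.ker (A.x i) ≠ ⊥}
  have hcard : Fintype.card I = A.socLen := by
    rw [socLen, Fintype.card_subtype, Finset.card_eq_sum_ones, Finset.sum_filter]
    refine Finset.sum_congr rfl fun i _ => ?_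
    have := hS i
    split_ifs with h
    · have : Module.finrank F (LinearMap.ker (A.x i)) ≠ 0 := fun h0 =>
        h (Submodule.finrank_eq_zero.1 h0)
      omega
    · push Not at h
      rw [h, finrank_bot]
  have hs : ∀ i : I, ∃ s : A.V i, A.x i s = 0 ∧ s ≠ 0 ∧
      ∀ y, A.x i y = 0 → ∃ c : F, y = c • s := by
    rintro ⟨i, hi⟩
    obtain ⟨s, hs, hs0⟩ := Submodule.exists_mem_ne_zero_of_ne_bot hi
    obtain ⟨⟨v, hv⟩, hv'⟩ := finrank_le_one_iff.1 (hS i)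
    refine ⟨s, hs, hs0, fun y hy => ?_⟩
    obtain ⟨c, hc⟩ := hv' ⟨s, hs⟩
    obtain ⟨d, hd⟩ := hv' ⟨y, hy⟩
    have hc : c • v = s := congrArg Subtype.val hc
    have hd : d • v = y := congrArg Subtype.val hd
    have hc0 : c ≠ 0 := by rintro rfl; exact hs0 (by rw [← hc, zero_smul])
    exact ⟨d * c⁻¹, by rw [← hc, ← hd, smul_smul, mul_assoc, inv_mul_cancel₀ hc0, mul_one]⟩
  choose s hs1 hs2 hs3 using hs
  have hp : ∀ i : I, ∃ p : A.V i →ₗ[F] F, p (s i) ≠ 0 := fun i => by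
    obtain ⟨p, hp, -⟩ := Submodule.exists_le_ker_of_notMem
      (p := (⊥ : Submodule F (A.V i))) (fun h0 => hs2 i ((Submodule.mem_bot F).1 h0))
    exact ⟨p, hp⟩
  choose p hp using hp
  let χ : hom A A →ₗ[F] (I → F) :=
    { toFun := fun f i => p i (f.1 i (s i))
      map_add' := fun f g => by funext i; simp
      map_smul' := fun c f => by funext i; simp }
  have hχ : ∀ f : hom A A, ∀ i : I, f.1 i (s i) = 0 ↔ χ f i = 0 := by
    intro f i
    obtain ⟨c, hc⟩ := hs3 i (f.1 i (s i)) (by rw [← f.2, hs1, map_zero])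
    change _ ↔ p i (f.1 i (s i)) = 0
    rw [hc, map_smul]
    simp [hs2 i, hp i]
  have hχs : Function.Surjective χ := by
    have hg : ∀ i : I, ∃ f : hom A A, χ f = Pi.single i 1 := by
      intro i
      obtain ⟨f, hf, ⟨c, hc, hfc⟩, hk⟩ := exists_end_socle hA i (s i) (hs1 i) (hs2 i)
      refine ⟨(c * p i (s i))⁻¹ • ⟨f, hf⟩, ?_⟩
      rw [map_smul]
      funext k
      by_cases hki : k = i
      · subst hki
        have : χ ⟨f, hf⟩ k = c * p k (s k) := by
          change p k (f k (s k)) = _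
          rw [hfc, map_smul, smul_eq_mul]
        rw [Pi.smul_apply, this, Pi.single_eq_same, smul_eq_mul,
          inv_mul_cancel₀ (mul_ne_zero hc (hp k))]
      · have : χ ⟨f, hf⟩ k = 0 := (hχ _ _).1
          (hk k (fun h => hki (Subtype.ext h)) (s k) (hs1 k))
        rw [Pi.smul_apply, this, smul_zero, Pi.single_eq_of_ne hki]
    choose f hf using hg
    intro t
    refine ⟨∑ i, t i • f i, ?_⟩
    rw [map_sum]
    simp only [map_smul, hf]
    funext k
    rw [Finset.sum_apply, Finset.sum_eq_single k]
    · simp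
    · intro i _ hik; simp [Pi.single_eq_of_ne hik.symm]
    · simp
  have haut : A.autCard = (Finset.univ.filter fun f : hom A A => ∀ i, χ f i ≠ 0).card := by
    rw [autCard, ← Fintype.card_subtype, ← Nat.card_eq_fintype_card]
    refine Nat.card_congr (Equiv.ofBijective
      (fun φ => ⟨⟨fun i => (φ.toFun i).toLinearMap, φ.comm⟩, fun i h => ?_⟩) ⟨?_, ?_⟩)
    · rw [← hχ] at h
      exact hs2 i ((φ.toFun i).map_eq_zero_iff.1 h)
    · intro φ ψ h
      ext i a
      have := congrArg (fun f => f.1.1 i a) h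
      exact this
    · rintro ⟨⟨f, hf⟩, hne⟩
      have hinj := injective_of_socle hA hf (fun i a ha hfa => by
        by_contra ha0
        have hi : LinearMap.ker (A.x i) ≠ ⊥ := fun hb => by
          have : a ∈ LinearMap.ker (A.x i) := ha
          rw [hb] at this
          exact ha0 ((Submodule.mem_bot F).1 this)
        obtain ⟨c, rfl⟩ := hs3 ⟨i, hi⟩ a ha
        rw [map_smul] at hfa
        rcases smul_eq_zero.1 hfa with h | h
        · exact ha0 (by rw [h, zero_smul])
        · exact hne ⟨i, hi⟩ ((hχ ⟨f, hf⟩ ⟨i, hi⟩).1 h))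
      exact ⟨isoOfBijective f hf fun i => ⟨hinj i, LinearMap.surjective_of_injective (hinj i)⟩, rfl⟩
  obtain ⟨K, hK, hK'⟩ := exists_fiber_card χ.toAddMonoidHom hχs
  have h1 := hK fun t => if ∀ i, t i ≠ 0 then 1 else 0
  have h2 : ∑ t : I → F, (if ∀ i, t i ≠ 0 then (1 : ℂ) else 0) = (q F - 1) ^ A.socLen := by
    rw [← Finset.sum_filter, Finset.sum_const, nsmul_eq_mul, mul_one, ← hcard]
    have : (Finset.univ.filter fun t : I → F => ∀ i, t i ≠ 0) =
        Fintype.piFinset fun _ => (Finset.univ.erase (0 : F)) := by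
      ext t; simp
    rw [this, Fintype.card_piFinset, Finset.prod_const, Finset.card_erase_of_mem (mem_univ _),
      Finset.card_univ, Finset.card_univ, Nat.cast_pow, Nat.cast_sub Fintype.card_pos]
    simp [q]
  rw [h2] at h1
  have h3 : (A.autCard : ℂ) = K * (q F - 1) ^ A.socLen := by
    rw [← h1, haut, Finset.card_eq_sum_ones, Finset.sum_filter]
    push_cast
    rfl
  rw [card_eq_q_pow (F := F), card_eq_q_pow (F := F), Module.finrank_fintype_fun_eq_card,
    hcard] at hK'
  rw [h3, mul_right_comm, hK']
  rfl

/-! ### Endomorphisms of extensions -/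

/-- Restriction of homomorphisms to the subobject of an extension. -/
def homRes {X Y : QRep F r} (η : E X Y) (Z : QRep F r) : hom (ext X Y η) Z →ₗ[F] hom Y Z where
  toFun f := ⟨fun i => (f.1 i).comp (LinearMap.inr F (X.V i) (Y.V i)), fun i a => by
    have := f.2 i (0, a)
    simpa using this⟩
  map_add' _ _ := rfl
  map_smul' _ _ := rfl

/-- Projection of homomorphisms to the quotient of an extension. -/
def homProj {X Y : QRep F r} (η : E X Y) (Z : QRep F r) : hom Z (ext X Y η) →ₗ[F] hom Z X where
  toFun f := ⟨fun i => (LinearMap.fst F (X.V i) (Y.V i)).comp (f.1 i), fun i a => by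
    have := f.2 i a
    simp [this]⟩
  map_add' _ _ := rfl
  map_smul' _ _ := rfl

theorem finrank_ker_homRes_le {X Y : QRep F r} (η : E X Y) (Z : QRep F r) :
    Module.finrank F (LinearMap.ker (homRes η Z)) ≤ Module.finrank F (hom X Z) := by
  have hker : ∀ f : LinearMap.ker (homRes η Z), ∀ i b, f.1.1 i (0, b) = 0 := fun f i b => by
    have := congrArg (fun g => g.1 i b) f.2
    exact this
  let φ : LinearMap.ker (homRes η Z) →ₗ[F] hom X Z :=
    { toFun := fun f => ⟨fun i => (f.1.1 i).comp (LinearMap.inl F (X.V i) (Y.V i)), fun i a => by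
        have h1 := f.1.2 i (a, 0)
        have h2 := hker f (i + 1) (η i a)
        simp only [LinearMap.comp_apply, LinearMap.inl_apply]
        rw [← h1, ext_x, map_zero, add_zero]
        have : ((X.x i a, η i a) : X.V (i + 1) × Y.V (i + 1)) = (X.x i a, 0) + (0, η i a) := by simp
        rw [this, map_add, h2, add_zero]⟩
      map_add' := fun _ _ => rfl
      map_smul' := fun _ _ => rfl }
  refine LinearMap.finrank_le_finrank_of_injective (f := φ) ?_
  intro f g hfg
  refine Subtype.ext (Subtype.ext ?_)
  funext i
  refine LinearMap.ext fun ⟨a, b⟩ => ?_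
  have h1 : f.1.1 i (a, 0) = g.1.1 i (a, 0) := congrArg (fun g => g.1 i a) hfg
  have : ((a, b) : X.V i × Y.V i) = (a, 0) + (0, b) := by simp
  rw [this, map_add, map_add, h1, hker f i b, hker g i b]

theorem finrank_ker_homProj_le {X Y : QRep F r} (η : E X Y) (Z : QRep F r) :
    Module.finrank F (LinearMap.ker (homProj η Z)) ≤ Module.finrank F (hom Z Y) := by
  have hker : ∀ f : LinearMap.ker (homProj η Z), ∀ i b, (f.1.1 i b).1 = 0 := fun f i b => by
    have := congrArg (fun g => g.1 i b) f.2
    exact this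
  let φ : LinearMap.ker (homProj η Z) →ₗ[F] hom Z Y :=
    { toFun := fun f => ⟨fun i => (LinearMap.snd F (X.V i) (Y.V i)).comp (f.1.1 i), fun i a => by
        have h1 := congrArg Prod.snd (f.1.2 i a)
        have h2 := hker f i a
        simp only [LinearMap.comp_apply, LinearMap.snd_apply]
        rw [h1]
        simp [h2]⟩
      map_add' := fun _ _ => rfl
      map_smul' := fun _ _ => rfl }
  refine LinearMap.finrank_le_finrank_of_injective (f := φ) ?_
  intro f g hfg
  refine Subtype.ext (Subtype.ext ?_)
  funext i
  refine LinearMap.ext fun a => Prod.ext ((hker f i a).trans (hker g i a).symm) ?_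
  exact congrArg (fun g => g.1 i a) hfg

/-- Homomorphisms out of a direct sum. -/
def homSumLeft (X Y Z : QRep F r) : hom (ext X Y 0) Z ≃ₗ[F] hom X Z × hom Y Z where
  toFun f := (⟨fun i => (f.1 i).comp (LinearMap.inl F (X.V i) (Y.V i)), fun i a => by
      have := f.2 i (a, 0)
      simpa using this⟩, homRes 0 Z f)
  map_add' _ _ := rfl
  map_smul' _ _ := rfl
  invFun p := ⟨fun i => (p.1.1 i).coprod (p.2.1 i), fun i a => by
    simp [p.1.2 i, p.2.2 i]⟩
  left_inv f := by
    refine Subtype.ext (funext fun i => LinearMap.ext fun ⟨a, b⟩ => ?_)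
    change f.1 i (a, 0) + f.1 i (0, b) = _
    rw [← map_add]; simp
  right_inv p := by
    refine Prod.ext (Subtype.ext (funext fun i => LinearMap.ext fun a => ?_))
      (Subtype.ext (funext fun i => LinearMap.ext fun a => ?_))
    · change p.1.1 i a + p.2.1 i 0 = _; simp
    · change p.1.1 i 0 + p.2.1 i a = _; simp

/-- Homomorphisms into a direct sum. -/
def homSumRight (X Y Z : QRep F r) : hom Z (ext X Y 0) ≃ₗ[F] hom Z X × hom Z Y where
  toFun f := (homProj 0 Z f, ⟨fun i => (LinearMap.snd F (X.V i) (Y.V i)).comp (f.1 i),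
    fun i a => by
      have := congrArg Prod.snd (f.2 i a)
      simpa using this⟩)
  map_add' _ _ := rfl
  map_smul' _ _ := rfl
  invFun p := ⟨fun i => (p.1.1 i).prod (p.2.1 i), fun i a => by
    simp [p.1.2 i, p.2.2 i]⟩
  left_inv f := rfl
  right_inv p := rfl

theorem e_ext_zero (X Y : QRep F r) : (ext X Y 0).e =
    (Module.finrank F (hom X X) + Module.finrank F (hom Y X)) +
      (Module.finrank F (hom X Y) + Module.finrank F (hom Y Y)) := by
  rw [e, (homSumRight X Y _).finrank_eq, Module.finrank_prod, (homSumLeft X Y X).finrank_eq,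
    (homSumLeft X Y Y).finrank_eq, Module.finrank_prod, Module.finrank_prod]

/-- An extension is split, or has a smaller endomorphism algebra than the split one. -/
theorem ext_split_or_e_lt {X Y : QRep F r} (η : E X Y) :
    Nonempty (Iso (ext X Y η) (ext X Y 0)) ∨ (ext X Y η).e < (ext X Y 0).e := by
  by_cases hid : (⟨fun i => LinearMap.id, fun i a => rfl⟩ : hom Y Y) ∈
      LinearMap.range (homRes η Y)
  · left
    obtain ⟨ρ, hρ⟩ := hid
    have h1 : ∀ i b, ρ.1 i (0, b) = b := fun i b => congrArg (fun g => g.1 i b) hρ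
    refine ⟨extShear η 0 (fun i => (ρ.1 i).comp (LinearMap.inl F (X.V i) (Y.V i))) fun i a => ?_⟩
    have h2 := ρ.2 i (a, 0)
    simp only [LinearMap.comp_apply, LinearMap.inl_apply]
    rw [← h2, ext_x, map_zero, add_zero]
    have : ((X.x i a, η i a) : X.V (i + 1) × Y.V (i + 1)) = (X.x i a, 0) + (0, η i a) := by simp
    rw [this, map_add, h1]
    simp [add_comm]
  · right
    rw [e_ext_zero, e]
    have h1 := LinearMap.finrank_range_add_finrank_ker (homProj η (ext X Y η))
    have h2 := finrank_ker_homProj_le η (ext X Y η)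
    have h3 := Submodule.finrank_le (LinearMap.range (homProj η (ext X Y η)))
    have h4 := LinearMap.finrank_range_add_finrank_ker (homRes η X)
    have h5 := finrank_ker_homRes_le η X
    have h6 := Submodule.finrank_le (LinearMap.range (homRes η X))
    have h7 := LinearMap.finrank_range_add_finrank_ker (homRes η Y)
    have h8 := finrank_ker_homRes_le η Y
    have h9 : Module.finrank F (LinearMap.range (homRes η Y)) < Module.finrank F (hom Y Y) :=
      Submodule.finrank_lt fun h => hid (by rw [h]; exact Submodule.mem_top)
    omega

theorem g_eq {A : QRep F r} (hA : A.Nil) (hC : A.Const) (hS : A.Sqf) :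
    A.g = (-q F) ^ A.e * (1 - 1 / q F) ^ A.socLen := by
  have h := autCard_eq_of_sqf hA hS
  have hq : q F ≠ 0 := q_ne_zero
  have : (A.autCard : ℂ) = q F ^ A.e * (1 - 1 / q F) ^ A.socLen := by
    have h1 : (1 - 1 / q F) = (q F - 1) / q F := by field_simp
    rw [h1, div_pow, ← mul_div_assoc, eq_div_iff (pow_ne_zero _ hq), h]
  rw [g, if_pos ⟨hC, hS⟩, this, neg_pow (q F)]
  ring

theorem g_eq_zero {A : QRep F r} (h : ¬ (A.Const ∧ A.Sqf)) : A.g = 0 := if_neg h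

theorem finrank_ker_le_of_injective {A B : QRep F r} {f : ∀ i, A.V i →ₗ[F] B.V i}
    (hf : f ∈ hom A B) (hi : ∀ i, Function.Injective (f i)) (i : ZMod r) :
    Module.finrank F (LinearMap.ker (A.x i)) ≤ Module.finrank F (LinearMap.ker (B.x i)) := by
  have : ∀ a ∈ LinearMap.ker (A.x i), f i a ∈ LinearMap.ker (B.x i) := fun a ha => by
    rw [LinearMap.mem_ker] at ha ⊢
    rw [← hf, ha, map_zero]
  refine LinearMap.finrank_le_finrank_of_injective (f := (f i).restrict this) fun a b h => ?_
  exact Subtype.ext (hi i (congrArg Subtype.val h))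

theorem Sqf.of_injective {A B : QRep F r} {f : ∀ i, A.V i →ₗ[F] B.V i} (hB : B.Sqf)
    (hf : f ∈ hom A B) (hi : ∀ i, Function.Injective (f i)) : A.Sqf :=
  fun i => (finrank_ker_le_of_injective hf hi i).trans (hB i)

theorem sqf_of_ext {X Y : QRep F r} {η : E X Y} (h : (ext X Y η).Sqf) : Y.Sqf :=
  h.of_injective (inr_mem_hom X Y η) fun _ => LinearMap.inr_injective

theorem finrank_le_one_smul {V : Type*} [AddCommGroup V] [Module F V] [Module.Finite F V]
    {P : Submodule F V} (h : Module.finrank F P ≤ 1) {a b : V} (ha : a ∈ P) (hb : b ∈ P)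
    (hb0 : b ≠ 0) : ∃ c : F, a = c • b := by
  obtain ⟨⟨v, hv⟩, hv'⟩ := finrank_le_one_iff.1 h
  obtain ⟨c, hc⟩ := hv' ⟨b, hb⟩
  obtain ⟨d, hd⟩ := hv' ⟨a, ha⟩
  have hc : c • v = b := congrArg Subtype.val hc
  have hd : d • v = a := congrArg Subtype.val hd
  have hc0 : c ≠ 0 := by rintro rfl; exact hb0 (by rw [← hc, zero_smul])
  exact ⟨d * c⁻¹, by rw [← hc, ← hd, smul_smul, mul_assoc, inv_mul_cancel₀ hc0, mul_one]⟩

/-- The top of a representation with square-free socle has a hyperplane stable under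
endomorphisms, outside of which endomorphisms act transitively. -/
theorem exists_stable_hyperplane {Z : QRep F r} (hZ : Z.Nil) (hS : Z.Sqf) (j : ZMod r)
    (hj : LinearMap.range (Z.x j) ≠ ⊤) :
    ∃ P : Submodule F (Z.V (j + 1)), LinearMap.range (Z.x j) ≤ P ∧
      Module.finrank F P + 1 = Z.dim (j + 1) ∧
      (∀ f ∈ hom Z Z, ∀ y ∈ P, f (j + 1) y ∈ P) ∧
      ∀ y, y ∉ P → ∀ n, ∃ f ∈ hom Z Z, n - f (j + 1) y ∈ LinearMap.range (Z.x j) := by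
  classical
  let W : ℕ → Submodule F (Z.V (j + 1)) := fun h =>
    LinearMap.ker ((Z.T ^ h).comp (Z.sg (j + 1))) ⊔ LinearMap.range (Z.x j)
  have hW : ∀ h y, y ∈ W h ↔ ∃ u, (Z.T ^ h) (Z.sg (j + 1) (y - Z.x j u)) = 0 := by
    intro h y
    rw [Submodule.mem_sup]
    constructor
    · rintro ⟨a, ha, _, ⟨u, rfl⟩, rfl⟩
      refine ⟨u, ?_⟩
      rw [add_sub_cancel_right]
      exact ha
    · rintro ⟨u, hu⟩
      exact ⟨y - Z.x j u, hu, Z.x j u, ⟨u, rfl⟩, by abel⟩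
  have hex : ∃ h, W h = ⊤ := by
    obtain ⟨k, hk⟩ := hZ
    refine ⟨k, ?_⟩
    rw [eq_top_iff]
    intro y _
    rw [hW]
    exact ⟨0, by rw [hk]; rfl⟩
  have hn : Nat.find hex ≠ 0 := fun h0 => by
    have := Nat.find_spec hex
    rw [h0] at this
    apply hj
    rw [eq_top_iff, ← this]
    intro y hy
    obtain ⟨u, hu⟩ := (hW _ _).1 hy
    have := congrFun hu (j + 1)
    simp only [pow_zero, Module.End.one_apply, sg_same] at this
    exact ⟨u, (sub_eq_zero.1 this).symm⟩
  obtain ⟨h, hh⟩ := Nat.exists_eq_succ_of_ne_zero hn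
  have h1 := Nat.find_spec hex
  rw [hh, Nat.succ_eq_add_one] at h1
  have h2 : W h ≠ ⊤ := Nat.find_min hex (m := h) (by omega)
  have hlift : ∀ y, ∃ u, (Z.T ^ (h + 1)) (Z.sg (j + 1) (y - Z.x j u)) = 0 := fun y =>
    (hW _ _).1 (h1 ▸ Submodule.mem_top)
  have hle : LinearMap.range (Z.x j) ≤ W h := le_sup_right
  refine ⟨W h, hle, ?_, ?_, ?_⟩
  · have hlt : Module.finrank F (W h) < Z.dim (j + 1) := Submodule.finrank_lt h2
    obtain ⟨y, hy⟩ : ∃ y, y ∉ W h := by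
      by_contra hcon
      push Not at hcon
      exact h2 (eq_top_iff.2 fun y _ => hcon y)
    obtain ⟨u, hu⟩ := hlift y
    have hy' : (Z.T ^ h) (Z.sg (j + 1) (y - Z.x j u)) ≠ 0 := fun h0 => hy ((hW _ _).2 ⟨u, h0⟩)
    have htop : W h ⊔ Submodule.span F {y - Z.x j u} = ⊤ := by
      rw [eq_top_iff]
      intro y' _
      obtain ⟨u', hu'⟩ := hlift y'
      have hsoc : ∀ y, (Z.T ^ (h + 1)) (Z.sg (j + 1) y) = 0 →
          (Z.T ^ h) (Z.sg (j + 1) y) ((j + 1) + (h : ZMod r)) ∈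
            LinearMap.ker (Z.x ((j + 1) + (h : ZMod r))) := by
        intro y hy
        rw [LinearMap.mem_ker, ← T_apply_succ, T_pow_T, hy]
        rfl
      obtain ⟨c, hc⟩ := finrank_le_one_smul (hS _) (hsoc _ hu') (hsoc _ hu) (fun h0 => hy' (by
        rw [pow_T_sg, h0, map_zero]))
      rw [Submodule.mem_sup]
      refine ⟨y' - c • (y - Z.x j u), ?_, c • (y - Z.x j u),
        Submodule.smul_mem _ _ (Submodule.mem_span_singleton_self _), by abel⟩
      rw [hW]
      refine ⟨u', ?_⟩
      rw [sub_right_comm, map_sub, map_sub, map_smul, map_smul, pow_T_sg Z h _ (y' - _), hc,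
        map_smul, ← pow_T_sg, sub_self]
    have h3 := Submodule.finrank_add_le_finrank_add_finrank (W h)
      (Submodule.span F {y - Z.x j u})
    rw [htop, finrank_top] at h3
    have h4 := finrank_span_le_card (R := F) ({y - Z.x j u} : Set (Z.V (j + 1)))
    rw [Set.toFinset_singleton, Finset.card_singleton] at h4
    have h5 : Module.finrank F (Z.V (j + 1)) = Z.dim (j + 1) := rfl
    omega
  · intro f hf y hy
    obtain ⟨u, hu⟩ := (hW _ _).1 hy
    refine (hW _ _).2 ⟨f j u, ?_⟩
    rw [← hf, ← map_sub, ← tmap_sg, ← tmap_pow_T hf, hu, map_zero]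
  · intro y hy n
    obtain ⟨u, hu⟩ := hlift y
    obtain ⟨u', hu'⟩ := hlift n
    set y' := y - Z.x j u with hy'
    obtain ⟨p, hp, hp'⟩ := Submodule.exists_le_ker_of_notMem
      (p := LinearMap.range ((LinearMap.proj ((j + 1) + (h : ZMod r)) :
        Z.Tot →ₗ[F] Z.V ((j + 1) + (h : ZMod r))).comp (Z.T ^ (h + 1))))
      (v := (Z.T ^ h) (Z.sg (j + 1) y') ((j + 1) + (h : ZMod r))) (by
        rintro ⟨w, hw⟩
        apply hy
        rw [hW]
        refine ⟨u + w j, ?_⟩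
        rw [map_add, ← sub_sub, ← hy', map_sub, map_sub, sub_eq_zero, pow_T_sg, ← hw,
          pow_T_sg Z h]
        congr 1
        simp only [LinearMap.comp_apply, LinearMap.proj_apply]
        rw [← pow_T_T, pow_T_apply_add, T_apply_succ])
    obtain ⟨f, hf, hf'⟩ := exists_hom_functional Z Z (j + 1) _ h rfl p (fun w => hp' ⟨w, rfl⟩)
      (n - Z.x j u') hu'
    set c := p ((Z.T ^ h) (Z.sg (j + 1) y') ((j + 1) + (h : ZMod r)))
    have h3 : f (j + 1) y' - c • (n - Z.x j u') ∈ LinearMap.range (Z.x j) := by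
      have := congrFun (hf' (Z.sg (j + 1) y')) (j + 1)
      rw [tmap_sg, sg_same, Finset.sum_range_succ', Pi.add_apply] at this
      simp only [pow_zero, Module.End.one_apply, Nat.sub_zero, Pi.smul_apply, sg_same] at this
      rw [this, add_sub_cancel_right, Finset.sum_apply]
      refine Submodule.sum_mem _ fun k _ => ?_
      rw [Pi.smul_apply, ← T_pow_T, T_apply_succ]
      exact Submodule.smul_mem _ _ ⟨_, rfl⟩
    refine ⟨c⁻¹ • f, Submodule.smul_mem _ _ hf, ?_⟩
    have h4 : n - (c⁻¹ • f) (j + 1) y = Z.x j u' - Z.x j (c⁻¹ • f j u)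
        - c⁻¹ • (f (j + 1) y' - c • (n - Z.x j u')) := by
      rw [hy', smul_sub c⁻¹, smul_smul, inv_mul_cancel₀ hp, one_smul, map_sub, hf, map_smul]
      simp only [Pi.smul_apply, LinearMap.smul_apply, smul_sub]
      abel
    rw [h4]
    exact Submodule.sub_mem _ (Submodule.sub_mem _ ⟨_, rfl⟩ ⟨_, rfl⟩)
      (Submodule.smul_mem _ _ h3)

/-! ### Extensions of simple representations -/

/-- The projection from the socle of an extension. -/
def kerFst (X Z : QRep F r) (η : E X Z) (i : ZMod r) :
    LinearMap.ker ((ext X Z η).x i) →ₗ[F] LinearMap.ker (X.x i) where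
  toFun a := ⟨a.1.1, congrArg Prod.fst a.2⟩
  map_add' _ _ := rfl
  map_smul' _ _ := rfl

theorem finrank_ker_ext (X Z : QRep F r) (η : E X Z) (i : ZMod r) :
    Module.finrank F (LinearMap.ker ((ext X Z η).x i)) =
      Module.finrank F (LinearMap.range (kerFst X Z η i)) +
        Module.finrank F (LinearMap.ker (Z.x i)) := by
  rw [← LinearMap.finrank_range_add_finrank_ker (kerFst X Z η i)]
  congr 1
  have h1 : ∀ a : LinearMap.ker (kerFst X Z η i), a.1.1.1 = 0 := fun a =>
    congrArg Subtype.val (LinearMap.mem_ker.1 a.2)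
  refine LinearEquiv.finrank_eq
    { toFun := fun a => ⟨a.1.1.2, ?_⟩
      invFun := fun b => ⟨⟨(0, b.1), ?_⟩, ?_⟩
      map_add' := fun _ _ => rfl
      map_smul' := fun _ _ => rfl
      left_inv := fun a => ?_
      right_inv := fun _ => rfl }
  · have h2 := congrArg Prod.snd a.1.2
    have h3 : η i a.1.1.1 + Z.x i a.1.1.2 = 0 := h2
    rwa [h1, map_zero, zero_add] at h3
  · have := b.2
    rw [LinearMap.mem_ker] at this ⊢
    rw [ext_x, map_zero, map_zero, zero_add, this]
    rfl
  · rfl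
  · exact Subtype.ext (Subtype.ext (Prod.ext (h1 a).symm rfl))

theorem finrank_ker_ext_le (X Z : QRep F r) (η : E X Z) (i : ZMod r) :
    Module.finrank F (LinearMap.ker ((ext X Z η).x i)) ≤
      Module.finrank F (LinearMap.ker (X.x i)) + Module.finrank F (LinearMap.ker (Z.x i)) := by
  rw [finrank_ker_ext]
  exact Nat.add_le_add_right (Submodule.finrank_le _) _

theorem finrank_ker_ext_of_forall {X Z : QRep F r} {η : E X Z} {i : ZMod r}
    (h : ∀ a, X.x i a = 0 → η i a ∈ LinearMap.range (Z.x i) → a = 0) :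
    Module.finrank F (LinearMap.ker ((ext X Z η).x i)) =
      Module.finrank F (LinearMap.ker (Z.x i)) := by
  have : LinearMap.range (kerFst X Z η i) = ⊥ := by
    rw [LinearMap.range_eq_bot]
    refine LinearMap.ext fun a => Subtype.ext ?_
    have h2 : η i a.1.1 + Z.x i a.1.2 = 0 := congrArg Prod.snd a.2
    exact h _ (congrArg Prod.fst a.2) ⟨-a.1.2, by rw [map_neg, eq_comm, eq_neg_iff_add_eq_zero]; exact h2⟩
  rw [finrank_ker_ext, this, finrank_bot, zero_add]

theorem lt_finrank_ker_ext {X Z : QRep F r} {η : E X Z} {i : ZMod r} {a : X.V i}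
    (ha : a ≠ 0) (hx : X.x i a = 0) (h : η i a ∈ LinearMap.range (Z.x i)) :
    Module.finrank F (LinearMap.ker (Z.x i)) <
      Module.finrank F (LinearMap.ker ((ext X Z η).x i)) := by
  obtain ⟨b, hb⟩ := h
  have : LinearMap.range (kerFst X Z η i) ≠ ⊥ := fun h0 => by
    rw [LinearMap.range_eq_bot] at h0
    have h1 := LinearMap.congr_fun h0 ⟨(a, -b), by
      rw [LinearMap.mem_ker, ext_x, hx, map_neg, hb, add_neg_cancel]; rfl⟩
    exact ha (congrArg Subtype.val h1)
  have h2 := Submodule.one_le_finrank_iff.2 this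
  rw [finrank_ker_ext]
  omega

section simple

variable {S : QRep F r} {j : ZMod r} {s : S.V j}

theorem Uni.simple_x (U : Uni S 0 j s) (i : ZMod r) (a : S.V i) : S.x i a = 0 := by
  have h := U.pow
  rw [zero_add, pow_one] at h
  rw [← S.sg_same i a, ← T_apply_succ, h]
  rfl

theorem Uni.simple_eq_zero (U : Uni S 0 j s) {i : ZMod r} (hi : i ≠ j) (a : S.V i) : a = 0 := by
  obtain ⟨c, hc⟩ := U.exists_coeff (S.sg i a)
  have := congrFun hc i
  simpa [S.sg_ne hi] using this

theorem Uni.simple_eq_smul (U : Uni S 0 j s) (a : S.V j) : ∃ c : F, a = c • s := by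
  obtain ⟨c, hc⟩ := U.exists_coeff (S.sg j a)
  have := congrFun hc j
  exact ⟨c 0, by simpa using this⟩

theorem Uni.simple_ne_zero (U : Uni S 0 j s) : s ≠ 0 := by
  have := U.ne
  rintro rfl
  simp at this

theorem Uni.simple_dim (U : Uni S 0 j s) : S.dim j = 1 := by
  have h2 := finrank_eq_one_iff_of_nonzero' (K := F) s U.simple_ne_zero
  exact h2.2 fun a => (U.simple_eq_smul a).imp fun c hc => hc.symm

theorem Uni.simple_dim_ne (U : Uni S 0 j s) {i : ZMod r} (hi : i ≠ j) : S.dim i = 0 := by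
  have : Subsingleton (S.V i) := ⟨fun a b => by
    rw [U.simple_eq_zero hi a, U.simple_eq_zero hi b]⟩
  exact Module.finrank_zero_of_subsingleton

theorem Uni.simple_exists_dual (U : Uni S 0 j s) : ∃ p : S.V j →ₗ[F] F, p s = 1 :=
  Module.Projective.exists_dual_eq_one F U.simple_ne_zero

/-- The family of maps out of a simple representation with prescribed value. -/
noncomputable def simpleMap (p : S.V j →ₗ[F] F) (B : ZMod r → Type) [∀ i, AddCommGroup (B i)]
    [∀ i, Module F (B i)] (u : B j) : ∀ i, S.V i →ₗ[F] B i :=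
  Pi.single (M := fun i => S.V i →ₗ[F] B i) j (p.smulRight u)

theorem simpleMap_apply {p : S.V j →ₗ[F] F} (hp : p s = 1) (B : ZMod r → Type)
    [∀ i, AddCommGroup (B i)] [∀ i, Module F (B i)] (u : B j) : simpleMap p B u j s = u := by
  rw [simpleMap, Pi.single_eq_same, LinearMap.smulRight_apply, hp, one_smul]

theorem Uni.simple_hom_ext (U : Uni S 0 j s) {B : ZMod r → Type} [∀ i, AddCommGroup (B i)]
    [∀ i, Module F (B i)] {f g : ∀ i, S.V i →ₗ[F] B i} (h : f j s = g j s) : f = g := by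
  funext i
  refine LinearMap.ext fun a => ?_
  by_cases hi : i = j
  · subst hi
    obtain ⟨c, rfl⟩ := U.simple_eq_smul a
    rw [map_smul, map_smul, h]
  · rw [U.simple_eq_zero hi a, map_zero, map_zero]

/-- The obstruction for extending an endomorphism of `Z` to an extension of a simple
representation by `Z`. -/
def endObs (Z : QRep F r) (j : ZMod r) (y : Z.V (j + 1)) :
    (F × hom Z Z × Z.V j) →ₗ[F] Z.V (j + 1) where
  toFun t := t.2.1.1 (j + 1) y - t.1 • y - Z.x j t.2.2
  map_add' t t' := by simp [add_smul]; abel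
  map_smul' c t := by simp [mul_smul, smul_sub]

theorem Uni.simple_e_ext (U : Uni S 0 j s) {Z : QRep F r} (η : E S Z)
    (hZ : ∀ i, i + 1 = j → Function.Surjective (Z.x i)) :
    (ext S Z η).e + Module.finrank F (LinearMap.range (endObs Z j (η j s))) =
      Z.e + 1 + Z.dim j := by
  obtain ⟨p, hp⟩ := U.simple_exists_dual
  have hps : ∀ a, p a • s = a := fun a => by
    obtain ⟨c, rfl⟩ := U.simple_eq_smul a
    rw [map_smul, hp, smul_eq_mul, mul_one]
  have hinr : ∀ f ∈ hom (ext S Z η) (ext S Z η), ∀ i b, (f i (0, b)).1 = 0 := by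
    intro f hf i b
    by_cases hi : i = j
    · obtain ⟨k, rfl⟩ : ∃ k, i = k + 1 := ⟨i - 1, by ring⟩
      obtain ⟨c, rfl⟩ := hZ k hi b
      have := congrArg Prod.fst (hf k (0, c))
      have h2 : (ext S Z η).x k (0, c) = (0, Z.x k c) := by
        rw [ext_x, map_zero, map_zero, zero_add]
      rw [h2] at this
      rw [this]
      exact U.simple_x _ _
    · exact U.simple_eq_zero hi _
  let Φ : hom (ext S Z η) (ext S Z η) →ₗ[F] F × hom Z Z × Z.V j :=
    { toFun := fun f => (p (f.1 j (s, 0)).1,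
        ⟨fun i => (LinearMap.snd F _ _).comp ((f.1 i).comp (LinearMap.inr F (S.V i) (Z.V i))),
          fun i b => by
            have := congrArg Prod.snd (f.2 i (0, b))
            have h2 : (ext S Z η).x i (0, b) = (0, Z.x i b) := by
              rw [ext_x, map_zero, map_zero, zero_add]
            have h3 : ((ext S Z η).x i (f.1 i (0, b))).2 = 
              η i (f.1 i (0, b)).1 + Z.x i (f.1 i (0, b)).2 := rfl
            rw [h2, h3, hinr f.1 f.2, map_zero, zero_add] at this
            exact this⟩, (f.1 j (s, 0)).2)
      map_add' := fun f f' => by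
        refine Prod.ext ?_ (Prod.ext ?_ ?_)
        · exact map_add p _ _
        · rfl
        · rfl
      map_smul' := fun c f => by
        refine Prod.ext ?_ (Prod.ext ?_ ?_)
        · exact map_smul p _ _
        · rfl
        · rfl }
  have hdec : ∀ (i : ZMod r) (a : S.V i) (b : Z.V i), ((a, b) : S.V i × Z.V i) = (a, 0) + (0, b) :=
    fun i a b => Prod.ext (add_zero a).symm (zero_add b).symm
  have hΦ : Function.Injective Φ := by
    intro f f' hff
    have h1 : p (f.1 j (s, 0)).1 = p (f'.1 j (s, 0)).1 := congrArg Prod.fst hff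
    have h2 : ∀ i b, (f.1 i (0, b)).2 = (f'.1 i (0, b)).2 := fun i b =>
      congrArg (fun t => t.2.1.1 i b) hff
    have h3 : (f.1 j (s, 0)).2 = (f'.1 j (s, 0)).2 := congrArg (fun t => t.2.2) hff
    have h4 : (fun i => (f.1 i).comp (LinearMap.inl F (S.V i) (Z.V i))) =
        fun i => (f'.1 i).comp (LinearMap.inl F (S.V i) (Z.V i)) := by
      refine U.simple_hom_ext (B := fun i => S.V i × Z.V i) (Prod.ext ?_ h3)
      change (f.1 j (s, 0)).1 = (f'.1 j (s, 0)).1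
      rw [← hps (f.1 j (s, 0)).1, h1, hps]
    refine Subtype.ext (funext fun i => LinearMap.ext fun ⟨a, b⟩ => ?_)
    rw [hdec, map_add, map_add]
    congr 1
    · exact LinearMap.congr_fun (congrFun h4 i) a
    · exact Prod.ext (by rw [hinr _ f.2, hinr _ f'.2]) (h2 i b)
  have hran : LinearMap.range Φ = LinearMap.ker (endObs Z j (η j s)) := by
    ext ⟨c, f, u⟩
    constructor
    · rintro ⟨f', hf'⟩
      rw [← hf', LinearMap.mem_ker]
      have h1 := congrArg Prod.snd (f'.2 j (s, 0))
      have h2 : (ext S Z η).x j (s, 0) = (0, η j s) := by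
        rw [ext_x, U.simple_x, map_zero, add_zero]
      have h3 : ((ext S Z η).x j (f'.1 j (s, 0))).2 = 
          η j (f'.1 j (s, 0)).1 + Z.x j (f'.1 j (s, 0)).2 := rfl
      rw [h2, h3, ← hps (f'.1 j (s, 0)).1, map_smul] at h1
      change (f'.1 (j + 1) (0, η j s)).2 - p (f'.1 j (s, 0)).1 • η j s
        - Z.x j (f'.1 j (s, 0)).2 = 0
      rw [h1, add_sub_cancel_left, sub_self]
    · intro hk
      have hk : f.1 (j + 1) (η j s) - c • η j s - Z.x j u = 0 := hk
      let k := simpleMap p Z.V u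
      have hk' : (fun i => (f.1 (i + 1)).comp (η i)) = fun i => c • η i + (Z.x i).comp (k i) := by
        refine U.simple_hom_ext (B := fun i => Z.V (i + 1)) ?_
        change f.1 (j + 1) (η j s) = c • η j s + Z.x j (k j s)
        rw [simpleMap_apply hp, ← sub_eq_zero, ← sub_sub, hk]
      refine ⟨⟨fun i => (c • LinearMap.fst F _ _).prod ((k i).comp (LinearMap.fst F _ _) +
        (f.1 i).comp (LinearMap.snd F _ _)), fun i a => ?_⟩, ?_⟩
      · obtain ⟨a, b⟩ := a
        have h1 : f.1 (i + 1) (η i a) = c • η i a + Z.x i (k i a) :=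
          LinearMap.congr_fun (congrFun hk' i) a
        refine Prod.ext ?_ ?_
        · change c • S.x i a = S.x i (c • a)
          rw [map_smul]
        · change k (i + 1) (S.x i a) + f.1 (i + 1) (η i a + Z.x i b) =
            η i (c • a) + Z.x i (k i a + f.1 i b)
          rw [U.simple_x, map_zero, zero_add, map_add, map_add, f.2, h1, map_smul, add_assoc]
      · refine Prod.ext ?_ (Prod.ext ?_ ?_)
        · change p (c • s) = c
          rw [map_smul, hp, smul_eq_mul, mul_one]
        · refine Subtype.ext (funext fun i => LinearMap.ext fun b => ?_)
          change k i 0 + f.1 i b = f.1 i b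
          rw [map_zero, zero_add]
        · change k j s + f.1 j 0 = u
          rw [map_zero, add_zero, simpleMap_apply hp]
  have h1 := LinearMap.finrank_range_add_finrank_ker (endObs Z j (η j s))
  rw [← hran, LinearMap.finrank_range_of_inj hΦ, Module.finrank_prod, Module.finrank_prod,
    Module.finrank_self] at h1
  have h2 : Z.e = Module.finrank F (hom Z Z) := rfl
  have h3 : Z.dim j = Module.finrank F (Z.V j) := rfl
  have h4 : (ext S Z η).e = Module.finrank F (hom (ext S Z η) (ext S Z η)) := rfl
  omega

end simple

open scoped Classical in
theorem sum_mem_submodule {V : Type*} [AddCommGroup V] [Module F V] [Module.Finite F V] [Fintype V]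
    (P : Submodule F V) : ∑ y : V, (if y ∈ P then (1 : ℂ) else 0) = q F ^ Module.finrank F P := by
  rw [Finset.sum_boole, ← card_eq_q_pow P, Fintype.card_subtype]

theorem Uni.nil {A : QRep F r} {h : ℕ} {j : ZMod r} {z : A.V j} (U : Uni A h j z) : A.Nil :=
  ⟨h + 1, U.pow⟩

theorem const_ext_iff {X Y : QRep F r} {η η' : E X Y} :
    (ext X Y η).Const ↔ (ext X Y η').Const := by
  simp only [Const, dim_ext]

theorem rs_g_eq_zero {X Y : QRep F r} (h : ¬ ((ext X Y 0).Const ∧ Y.Sqf)) : Rs g X Y = 0 :=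
  Finset.sum_eq_zero fun _ _ => g_eq_zero fun h' => h ⟨const_ext_iff.1 h'.1, sqf_of_ext h'.2⟩

open scoped Classical in
theorem Uni.rs_g_simple (hr : 1 < r) {S : QRep F r} {j : ZMod r} {s : S.V j} (U : Uni S 0 j s)
    {Z : QRep F r} (hZ : Z.Nil) : Rs g S Z = 0 := by
  by_cases hCS : (ext S Z 0).Const ∧ Z.Sqf
  swap
  · exact rs_g_eq_zero hCS
  obtain ⟨⟨n, hn⟩, hS⟩ := hCS
  simp only [dim_ext, Pi.add_apply] at hn
  have : Fact (1 < r) := ⟨hr⟩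
  have hj1 : j + 1 ≠ j := by simp
  have hdj : Z.dim j + 1 = n := by rw [← hn j, U.simple_dim, add_comm]
  have hdi : ∀ i, i ≠ j → Z.dim i = n := fun i hi => by
    rw [← hn i, U.simple_dim_ne hi, zero_add]
  have hsurj : ∀ i, i + 1 = j → Function.Surjective (Z.x i) := by
    intro i hi
    have hi' : i ≠ j := by rintro rfl; exact hj1 hi
    have h1 := LinearMap.finrank_range_add_finrank_ker (Z.x i)
    have h2 := hS i
    have h3 : Module.finrank F (Z.V i) = n := hdi i hi'
    have h4 : Module.finrank F (Z.V (i + 1)) + 1 = n := by rw [hi]; exact hdj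
    rw [← LinearMap.range_eq_top]
    refine Submodule.eq_top_of_finrank_eq (le_antisymm (Submodule.finrank_le _) ?_)
    omega
  set R := LinearMap.range (Z.x j) with hR
  set κ := Module.finrank F (LinearMap.ker (Z.x j)) with hκ
  have hκ1 : κ ≤ 1 := hS j
  have hRκ : Module.finrank F R + κ + 1 = n := by
    rw [← hdj, hR, hκ, LinearMap.finrank_range_add_finrank_ker]; rfl
  have hRtop : R ≠ ⊤ := fun h => by
    have h1 : Module.finrank F R = n := by rw [h, finrank_top]; exact hdi _ hj1
    omega
  obtain ⟨P, hRP, hPn, hPst, hPtr⟩ := exists_stable_hyperplane hZ hS j hRtop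
  rw [hdi _ hj1] at hPn
  set C : ℂ := (-q F) ^ Z.e * (1 - 1 / q F) ^ Z.socLen with hC
  have hval : ∀ η : E S Z, g (ext S Z η) = C - (q F + 1) * C * (if η j s ∈ P then 1 else 0) +
      q F ^ κ * C * (if η j s ∈ R then 1 else 0) := by
    intro η
    have he := U.simple_e_ext η hsurj
    set y := η j s with hy
    have hconst : (ext S Z η).Const := ⟨n, fun i => by rw [dim_ext]; exact hn i⟩
    have hnil : (ext S Z η).Nil := U.nil.ext hZ η
    have hker : ∀ i, i ≠ j → Module.finrank F (LinearMap.ker ((ext S Z η).x i)) =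
        Module.finrank F (LinearMap.ker (Z.x i)) := fun i hi =>
      finrank_ker_ext_of_forall fun a _ _ => U.simple_eq_zero hi a
    have hRle : R ≤ LinearMap.range (endObs Z j y) := by
      rintro _ ⟨u, rfl⟩
      exact ⟨(0, 0, -u), by simp [endObs]⟩
    have hq : q F ≠ 0 := q_ne_zero
    by_cases hyR : y ∈ R
    · have hyP := hRP hyR
      have hlt := lt_finrank_ker_ext U.simple_ne_zero (U.simple_x j s) hyR
      by_cases hκ0 : κ = 0
      · have hE : LinearMap.range (endObs Z j y) = R := by
          refine le_antisymm ?_ hRle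
          rintro _ ⟨⟨c, f, u⟩, rfl⟩
          obtain ⟨b, hb⟩ := hyR
          refine Submodule.sub_mem _ (Submodule.sub_mem _ ?_ (Submodule.smul_mem _ _ ⟨b, hb⟩))
            ⟨u, rfl⟩
          rw [← hb]
          change f.1 (j + 1) (Z.x j b) ∈ R
          rw [f.2]
          exact ⟨_, rfl⟩
        rw [hE] at he
        have hkj : Module.finrank F (LinearMap.ker ((ext S Z η).x j)) = 1 := by
          have h1 := finrank_ker_ext_le S Z η j
          have h2 : Module.finrank F (LinearMap.ker (S.x j)) ≤ 1 :=
            (Submodule.finrank_le _).trans U.simple_dim.le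
          omega
        have hsq : (ext S Z η).Sqf := fun i => by
          by_cases hi : i = j
          · rw [hi, hkj]
          · rw [hker i hi]; exact hS i
        have hsoc : (ext S Z η).socLen = Z.socLen + 1 := by
          unfold socLen
          rw [← Finset.add_sum_erase _ _ (Finset.mem_univ j),
            ← Finset.add_sum_erase _ (fun i => Module.finrank F (LinearMap.ker (Z.x i)))
              (Finset.mem_univ j), hkj, ← hκ, hκ0,
            Finset.sum_congr rfl fun i hi => hker i (Finset.ne_of_mem_erase hi)]
          ring
        have he' : (ext S Z η).e = Z.e + 1 := by omega
        rw [g_eq hnil hconst hsq, he', hsoc, if_pos hyP, if_pos hyR, hκ0, hC, pow_succ, pow_succ]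
        field_simp
        ring
      · have hκ1' : κ = 1 := by omega
        rw [g_eq_zero fun h => by have := h.2 j; omega, if_pos hyP, if_pos hyR, hκ1']
        ring
    · have hkj := finrank_ker_ext_of_forall (X := S) (Z := Z) (η := η) (i := j) fun a _ ha => by
        obtain ⟨c, rfl⟩ := U.simple_eq_smul a
        by_contra hca
        have hc : c ≠ 0 := by rintro rfl; exact hca (zero_smul _ _)
        rw [map_smul] at ha
        exact hyR ((Submodule.smul_mem_iff _ hc).1 ha)
      have hker' : ∀ i, Module.finrank F (LinearMap.ker ((ext S Z η).x i)) =
          Module.finrank F (LinearMap.ker (Z.x i)) := fun i => by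
        by_cases hi : i = j
        · rw [hi, hkj]
        · exact hker i hi
      have hsq : (ext S Z η).Sqf := fun i => by rw [hker']; exact hS i
      have hsoc : (ext S Z η).socLen = Z.socLen := by
        unfold socLen
        simp only [hker']
      by_cases hyP : y ∈ P
      · have hE : LinearMap.range (endObs Z j y) ≤ P := by
          rintro _ ⟨⟨c, f, u⟩, rfl⟩
          exact Submodule.sub_mem _ (Submodule.sub_mem _ (hPst _ f.2 _ hyP)
            (Submodule.smul_mem _ _ hyP)) (hRP ⟨u, rfl⟩)
        have hlt : Module.finrank F R < Module.finrank F (LinearMap.range (endObs Z j y)) := by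
          refine Submodule.finrank_lt_finrank_of_lt (lt_of_le_of_ne hRle fun h => hyR ?_)
          rw [h]
          exact ⟨(-1, 0, 0), by simp [endObs]⟩
        have hle := Submodule.finrank_mono hE
        have he' : (ext S Z η).e = Z.e + 1 := by omega
        rw [g_eq hnil hconst hsq, he', hsoc, if_pos hyP, if_neg hyR, hC, pow_succ]
        ring
      · have hE : LinearMap.range (endObs Z j y) = ⊤ := by
          rw [eq_top_iff]
          intro m _
          obtain ⟨f, hf, u, hu⟩ := hPtr y hyP m
          exact ⟨(0, ⟨f, hf⟩, -u), by simp [endObs, hu]⟩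
        rw [hE, finrank_top] at he
        have h3 : Module.finrank F (Z.V (j + 1)) = n := hdi _ hj1
        have he' : (ext S Z η).e = Z.e := by omega
        rw [g_eq hnil hconst hsq, he', hsoc, if_neg hyP, if_neg hyR, hC]
        ring
  have : Fintype (Z.V (j + 1)) := Fintype.ofFinite _
  obtain ⟨p, hp⟩ := U.simple_exists_dual
  let φ : E S Z →+ Z.V (j + 1) :=
    { toFun := fun η => η j s, map_zero' := rfl, map_add' := fun _ _ => rfl }
  obtain ⟨K, hK, -⟩ := exists_fiber_card φ fun u =>
    ⟨simpleMap p (fun i => Z.V (i + 1)) u, simpleMap_apply hp (fun i => Z.V (i + 1)) u⟩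
  unfold Rs
  simp only [hval]
  refine (hK fun y => C - (q F + 1) * C * (if y ∈ P then 1 else 0) +
      q F ^ κ * C * (if y ∈ R then 1 else 0)).trans ?_
  rw [Finset.sum_add_distrib, Finset.sum_sub_distrib, ← Finset.mul_sum _ _ ((q F + 1) * C),
    ← Finset.mul_sum _ _ (q F ^ κ * C), sum_mem_submodule, sum_mem_submodule, Finset.sum_const, Finset.card_univ, nsmul_eq_mul,
    card_eq_q_pow (F := F)]
  have h3 : Module.finrank F (Z.V (j + 1)) = Module.finrank F R + κ + 1 := by
    rw [hRκ]; exact hdi _ hj1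
  have h4 : Module.finrank F P = Module.finrank F R + κ := by omega
  rw [h3, h4]
  ring

/-! ### Uniserial representations -/

theorem tdim_eq_sum (A : QRep F r) : A.tdim = ∑ i, A.dim i := rfl

theorem Uni.exists_ker {A : QRep F r} {h : ℕ} {j : ZMod r} {z : A.V j} (U : Uni A h j z)
    {i : ZMod r} {a : A.V i} (ha : A.x i a = 0) :
    ∃ c : F, A.sg i a = c • (A.T ^ h) (A.sg j z) := by
  obtain ⟨c, hc⟩ := U.exists_coeff (A.sg i a)
  have hT : A.T (A.sg i a) = 0 := by rw [T_single, ha, map_zero]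
  by_cases hk : ∃ k < h, c k ≠ 0
  · exfalso
    classical
    obtain ⟨hk1, hk2⟩ := Nat.find_spec hk
    set m := Nat.find hk
    have h1 : (A.T ^ (h - m)) (A.sg i a) = 0 := by
      obtain ⟨l, hl⟩ : ∃ l, h - m = l + 1 := ⟨h - m - 1, by omega⟩
      rw [hl, ← pow_T_T, hT, map_zero]
    have h2 : (A.T ^ (h - m)) (A.sg i a) = c m • (A.T ^ h) (A.sg j z) := by
      rw [hc, map_sum, Finset.sum_eq_single m]
      · rw [map_smul, ← pow_T_add, Nat.sub_add_cancel hk1.le]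
      · intro k hk hkm
        rw [map_smul, ← pow_T_add]
        rcases lt_or_gt_of_ne hkm with hlt | hgt
        · have := Nat.find_min _ hlt
          have hc0 : c k = 0 := by
            by_contra h0
            exact this ⟨by omega, h0⟩
          rw [hc0, zero_smul]
        · obtain ⟨l, hl⟩ : ∃ l, h - m + k = l + (h + 1) := ⟨h - m + k - (h + 1), by omega⟩
          rw [hl, pow_T_add, U.pow]
          simp
      · intro hm
        exact absurd (Finset.mem_range.2 (by omega)) hm
    rw [h1] at h2
    exact (smul_ne_zero hk2 U.ne) h2.symm
  · push Not at hk
    refine ⟨c h, ?_⟩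
    rw [hc, Finset.sum_range_succ, Finset.sum_eq_zero, zero_add]
    intro k hk'
    rw [hk k (Finset.mem_range.1 hk'), zero_smul]

theorem Uni.eq_zero_of_ker {A : QRep F r} {h : ℕ} {j : ZMod r} {z : A.V j} (U : Uni A h j z)
    {i : ZMod r} (hi : i ≠ j + h) {a : A.V i} (ha : A.x i a = 0) : a = 0 := by
  obtain ⟨c, hc⟩ := U.exists_ker ha
  have := congrFun hc i
  rw [sg_same, pow_T_sg] at this
  rw [this, Pi.smul_apply, A.sg_ne hi, smul_zero]

theorem Uni.surjective {A : QRep F r} {h : ℕ} {j : ZMod r} {z : A.V j} (U : Uni A h j z)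
    {i : ZMod r} (hi : i + 1 ≠ j) : Function.Surjective (A.x i) := by
  intro b
  obtain ⟨c, hc⟩ := U.exists_coeff (A.sg (i + 1) b)
  have := congrFun hc (i + 1)
  rw [sg_same, Finset.sum_range_succ', Pi.add_apply, Pi.smul_apply, pow_zero,
    Module.End.one_apply, A.sg_ne hi, smul_zero, add_zero, Finset.sum_apply] at this
  rw [← LinearMap.mem_range, this]
  refine Submodule.sum_mem _ fun k _ => ?_
  rw [Pi.smul_apply, ← T_pow_T, T_apply_succ]
  exact Submodule.smul_mem _ _ ⟨_, rfl⟩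

theorem Uni.exists_add_smul {A : QRep F r} {h : ℕ} {j : ZMod r} {z : A.V (j + 1)}
    (U : Uni A h (j + 1) z) (b : A.V (j + 1)) : ∃ (c : F) (u : A.V j), b = A.x j u + c • z := by
  obtain ⟨c, hc⟩ := U.exists_coeff (A.sg (j + 1) b)
  have := congrFun hc (j + 1)
  rw [sg_same, Finset.sum_range_succ', Pi.add_apply, Pi.smul_apply, pow_zero,
    Module.End.one_apply, sg_same, Finset.sum_apply] at this
  have h2 : ∑ k ∈ Finset.range h, (c (k + 1) • (A.T ^ (k + 1)) (A.sg (j + 1) z)) (j + 1) ∈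
      LinearMap.range (A.x j) := by
    refine Submodule.sum_mem _ fun k _ => ?_
    rw [Pi.smul_apply, ← T_pow_T, T_apply_succ]
    exact Submodule.smul_mem _ _ ⟨_, rfl⟩
  obtain ⟨u, hu⟩ := h2
  exact ⟨c 0, u, by rw [hu, ← this]⟩

theorem pow_T_x_eq_zero {A : QRep F r} {h : ℕ} (hA : A.T ^ (h + 1) = 0) (i : ZMod r) (a : A.V i) :
    (A.T ^ h) (A.sg (i + 1) (A.x i a)) = 0 := by
  rw [← T_single, pow_T_T, hA]
  rfl

theorem exists_simple (F : Type) [Field F] [Fintype F] (j : ZMod r) :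
    ∃ (S : QRep F r) (s : S.V j), Uni S 0 j s := by
  classical
  let S : QRep F r :=
    { V := fun i => (if i = j then ⊤ else ⊥ : Submodule F F)
      x := fun i => 0 }
  have hS : ∀ i, S.dim i = if i = j then 1 else 0 := fun i => by
    change Module.finrank F (if i = j then ⊤ else ⊥ : Submodule F F) = _
    by_cases hi : i = j
    · rw [if_pos hi, if_pos hi, finrank_top, Module.finrank_self]
    · rw [if_neg hi, if_neg hi, finrank_bot]
  refine ⟨S, ⟨1, by simp⟩, ⟨?_, ?_, ?_⟩⟩
  · rw [zero_add, pow_one]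
    refine LinearMap.ext fun w => tot_ext fun i => ?_
    rw [T_apply_succ]
    rfl
  · rw [tdim_eq_sum]
    simp [hS]
  · intro h0
    rw [pow_zero, Module.End.one_apply] at h0
    have := congrFun h0 j
    rw [sg_same] at this
    exact one_ne_zero (congrArg Subtype.val this)

theorem pow_T_inr (X Y : QRep F r) (η : E X Y) (k : ℕ) (i : ZMod r) (b : Y.V i) :
    ((ext X Y η).T ^ k) ((ext X Y η).sg i (0, b)) =
      tmap (A := Y) (B := ext X Y η) (fun i => LinearMap.inr F (X.V i) (Y.V i))
        ((Y.T ^ k) (Y.sg i b)) := by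
  rw [tmap_pow_T (inr_mem_hom X Y η), tmap_sg]
  rfl

theorem T_inl_of_x_eq_zero {X Y : QRep F r} {η : E X Y} {i : ZMod r} {a : X.V i} (b : Y.V i)
    (ha : X.x i a = 0) : (ext X Y η).T ((ext X Y η).sg i (a, b)) =
      (ext X Y η).sg (i + 1) (0, η i a + Y.x i b) := by
  rw [T_single, ext_x, ha]

theorem tmap_inr_injective (X Y : QRep F r) (η : E X Y) : Function.Injective
    (tmap (A := Y) (B := ext X Y η) (fun i => LinearMap.inr F (X.V i) (Y.V i))) :=
  tmap_injective fun _ => LinearMap.inr_injective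

theorem pow_T_ext_eq_zero {X Y : QRep F r} {k l : ℕ} (hX : X.T ^ k = 0) (hY : Y.T ^ l = 0)
    (η : E X Y) : (ext X Y η).T ^ (l + k) = 0 := by
  refine LinearMap.ext fun w => ?_
  have h1 : ∀ i, ((((ext X Y η).T ^ k) w) i).1 = 0 := fun i => by
    have := tmap_pow_T (fst_mem_hom X Y η) k w
    rw [hX] at this
    exact congrFun this i
  have h2 : ((ext X Y η).T ^ k) w =
      tmap (A := Y) (B := ext X Y η) (fun i => LinearMap.inr F (X.V i) (Y.V i))
        (fun i => ((((ext X Y η).T ^ k) w) i).2) := by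
    funext i
    exact Prod.ext (h1 i) rfl
  rw [pow_T_add, h2, ← tmap_pow_T (inr_mem_hom X Y η), hY, LinearMap.zero_apply, map_zero]
  rfl

/-- An extension of a simple by a uniserial representation splits or is uniserial. -/
theorem Uni.ext_simple {S : QRep F r} {j : ZMod r} {s : S.V j} (US : Uni S 0 j s) {A : QRep F r}
    {h : ℕ} {z : A.V (j + 1)} (UA : Uni A h (j + 1) z) (η : E S A) :
    Nonempty (Iso (ext S A η) (ext S A 0)) ∨ Uni (ext S A η) (h + 1) j (s, 0) := by
  obtain ⟨c, u, hc⟩ := UA.exists_add_smul (η j s)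
  by_cases hc0 : c = 0
  · left
    obtain ⟨p, hp⟩ := US.simple_exists_dual
    refine ⟨extShear η 0 (simpleMap p A.V u) ?_⟩
    intro i a
    have := US.simple_hom_ext (B := fun i => A.V (i + 1)) (f := fun i => (A.x i).comp (simpleMap p A.V u i)) (g := η) (by
      rw [LinearMap.comp_apply, simpleMap_apply hp, hc, hc0, zero_smul, add_zero])
    rw [US.simple_x, map_zero, add_zero, Pi.zero_apply, LinearMap.zero_apply, sub_zero, ← this]
    rfl
  · right
    refine ⟨?_, ?_, ?_⟩
    · exact pow_T_ext_eq_zero US.pow UA.pow η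
    · rw [tdim_ext, US.tdim_eq, UA.tdim_eq]
      omega
    · rw [← pow_T_T, T_inl_of_x_eq_zero 0 (US.simple_x _ _), pow_T_inr, map_zero, add_zero, hc,
        map_add, map_add, pow_T_x_eq_zero UA.pow, zero_add, map_smul, map_smul]
      intro h0
      refine smul_ne_zero hc0 UA.ne (tmap_inr_injective S A η ?_)
      rw [h0, map_zero]

theorem Uni.exists_nonsplit {S : QRep F r} {j : ZMod r} {s : S.V j} (US : Uni S 0 j s)
    {A : QRep F r} {h : ℕ} {z : A.V (j + 1)} (UA : Uni A h (j + 1) z) :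
    ∃ η, Uni (ext S A η) (h + 1) j (s, 0) := by
  obtain ⟨p, hp⟩ := US.simple_exists_dual
  refine ⟨simpleMap p (fun i => A.V (i + 1)) z, ?_, ?_, ?_⟩
  · exact pow_T_ext_eq_zero US.pow UA.pow _
  · rw [tdim_ext, US.tdim_eq, UA.tdim_eq]
    omega
  · rw [← pow_T_T, T_inl_of_x_eq_zero 0 (US.simple_x _ _), pow_T_inr, map_zero, add_zero,
      simpleMap_apply hp (fun i => A.V (i + 1))]
    intro h0
    refine UA.ne (tmap_inr_injective S A (simpleMap p (fun i => A.V (i + 1)) z) ?_)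
    rw [h0, map_zero]

theorem exists_uni (F : Type) [Field F] [Fintype F] (h : ℕ) (j : ZMod r) :
    ∃ (A : QRep F r) (z : A.V j), Uni A h j z := by
  induction h generalizing j with
  | zero => exact exists_simple F j
  | succ h ih =>
    obtain ⟨S, s, US⟩ := exists_simple F j
    obtain ⟨A, z, UA⟩ := ih (j + 1)
    obtain ⟨η, hη⟩ := US.exists_nonsplit UA
    exact ⟨_, _, hη⟩

/-- An extension of a uniserial by a simple representation splits or is uniserial. -/
theorem Uni.ext_by_simple {S : QRep F r} {j k : ZMod r} {s : S.V j} (US : Uni S 0 j s)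
    {A : QRep F r} {h : ℕ} {z : A.V k} (UA : Uni A h k z) (η : E A S) :
    Nonempty (Iso (ext A S η) (ext A S 0)) ∨
      (Uni (ext A S η) (h + 1) k (z, 0) ∧ j = k + (h + 1 : ℕ)) := by
  have hpow : (ext A S η).T ^ (h + 1 + 1) = 0 := by
    have := pow_T_ext_eq_zero UA.pow US.pow η
    rwa [zero_add, add_comm] at this
  by_cases h0 : ((ext A S η).T ^ (h + 1)) ((ext A S η).sg k (z, 0)) = 0
  · left
    obtain ⟨f, hf, hfz⟩ := UA.exists_hom (N := ext A S η) (z, 0) h0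
    have h1 : (fun i => (LinearMap.fst F (A.V i) (S.V i)).comp (f i)) =
        fun i => LinearMap.id := by
      refine UA.hom_ext (N := A) ?_ ?_ ?_
      · intro i a
        change (f (i + 1) (A.x i a)).1 = A.x i (f i a).1
        rw [hf]
        rfl
      · intro i a
        rfl
      · change (f k z).1 = z
        rw [hfz]
    refine ⟨extShear η 0 (fun i => -(LinearMap.snd F (A.V i) (S.V i)).comp (f i)) ?_⟩
    intro i a
    have h2 : (f (i + 1) (A.x i a)).2 = η i (f i a).1 + S.x i (f i a).2 := by
      rw [hf]
      rfl
    have h3 : (f i a).1 = a := LinearMap.congr_fun (congrFun h1 i) a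
    rw [h3] at h2
    change S.x i (-(f i a).2) = η i a - 0 + -(f (i + 1) (A.x i a)).2
    rw [h2, map_neg]
    abel
  · right
    refine ⟨⟨hpow, ?_, h0⟩, ?_⟩
    · rw [tdim_ext, US.tdim_eq, UA.tdim_eq]
    · by_contra hne
      apply h0
      rw [pow_T_sg]
      have h1 : ((((ext A S η).T ^ (h + 1)) ((ext A S η).sg k (z, 0)))
          (k + ((h + 1 : ℕ) : ZMod r))).1 = 0 := by
        have := congrFun (tmap_pow_T (fst_mem_hom A S η) (h + 1) ((ext A S η).sg k (z, 0)))
          (k + ((h + 1 : ℕ) : ZMod r))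
        rw [UA.pow] at this
        exact this
      have h2 : ((((ext A S η).T ^ (h + 1)) ((ext A S η).sg k (z, 0)))
          (k + ((h + 1 : ℕ) : ZMod r))) = 0 :=
        Prod.ext h1 (US.simple_eq_zero (Ne.symm hne) _)
      rw [h2, map_zero]

theorem finrank_E (X Y : QRep F r) : Module.finrank F (E X Y) = ∑ i, X.dim i * Y.dim (i + 1) := by
  rw [Module.finrank_pi_fintype]
  exact Finset.sum_congr rfl fun i _ => Module.finrank_linearMap _ _ _ _

theorem card_E (X Y : QRep F r) :
    (Fintype.card (E X Y) : ℂ) = q F ^ ∑ i, X.dim i * Y.dim (i + 1) := by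
  rw [card_eq_q_pow (F := F) (E X Y), finrank_E]

section fullCircle

variable {X : QRep F r} {h : ℕ} {j : ZMod r} {z : X.V (j + 1)}

theorem Uni.const_of_add_eq (U : Uni X h (j + 1) z) (hh : j + 1 + h = j) : X.Const := by
  have h1 : ∀ i, i ≠ j → X.dim (i + 1) = X.dim i := fun i hi => by
    refine (LinearEquiv.finrank_eq (LinearEquiv.ofBijective (X.x i) ⟨?_, U.surjective ?_⟩)).symm
    · rw [injective_iff_map_eq_zero]
      intro a ha
      exact U.eq_zero_of_ker (by rwa [hh]) ha
    · intro h0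
      exact hi (add_right_cancel h0)
  have h2 : ∀ k : ℕ, k < r → X.dim (j + 1 + k) = X.dim (j + 1) := by
    intro k
    induction k with
    | zero => intro _; rw [Nat.cast_zero, add_zero]
    | succ k ih =>
      intro hk
      rw [← ih (by omega), Nat.cast_succ, ← add_assoc]
      refine h1 _ fun h0 => ?_
      have h3 : ((k + 1 : ℕ) : ZMod r) = 0 := by
        rw [add_assoc, add_eq_left] at h0
        rw [Nat.cast_succ, add_comm, h0]
      rw [ZMod.natCast_eq_zero_iff] at h3
      exact absurd (Nat.le_of_dvd (by omega) h3) (by omega)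
  refine ⟨X.dim (j + 1), fun i => ?_⟩
  rw [← h2 (i - (j + 1)).val (ZMod.val_lt _), ZMod.natCast_zmod_val]
  congr 1
  ring

/-- The generator of the socle. -/
theorem Uni.exists_socle (U : Uni X h (j + 1) z) (hh : j + 1 + h = j) :
    ∃ t : X.V j, t ≠ 0 ∧ X.x j t = 0 ∧ (X.T ^ h) (X.sg (j + 1) z) = X.sg j t ∧
      ∀ a : X.V j, X.x j a = 0 → ∃ c : F, a = c • t := by
  have h1 : (X.T ^ h) (X.sg (j + 1) z) = X.sg j (((X.T ^ h) (X.sg (j + 1) z)) j) := by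
    have := (hg_sg (j + 1) z).pow_T h
    rw [hh] at this
    exact this.eq_sg
  refine ⟨((X.T ^ h) (X.sg (j + 1) z)) j, fun h0 => ?_, ?_, h1, ?_⟩
  · rw [h0, map_zero] at h1
    exact U.ne h1
  · rw [← T_apply_succ, T_pow_T, U.pow]
    rfl
  · intro a ha
    obtain ⟨c, hc⟩ := U.exists_ker ha
    have := congrFun hc j
    rw [sg_same] at this
    exact ⟨c, this⟩

theorem Uni.finrank_ker (U : Uni X h (j + 1) z) (hh : j + 1 + h = j) (i : ZMod r) :
    Module.finrank F (LinearMap.ker (X.x i)) = if i = j then 1 else 0 := by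
  obtain ⟨t, ht0, hxt, -, ht⟩ := U.exists_socle hh
  by_cases hi : i = j
  · subst hi
    rw [if_pos rfl]
    refine (finrank_eq_one_iff_of_nonzero' (K := F) (⟨t, hxt⟩ : LinearMap.ker (X.x i))
      fun h0 => ht0 (congrArg Subtype.val h0)).2 fun a => ?_
    obtain ⟨c, hc⟩ := ht a.1 a.2
    exact ⟨c, Subtype.ext hc.symm⟩
  · rw [if_neg hi, Submodule.finrank_eq_zero, LinearMap.ker_eq_bot']
    intro a ha
    exact U.eq_zero_of_ker (by rwa [hh]) ha

theorem Uni.g_eq_of_add_eq (U : Uni X h (j + 1) z) (hh : j + 1 + h = j) :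
    X.g = (-q F) ^ X.dim (j + 1) * (1 - 1 / q F) := by
  rw [g_eq U.nil (U.const_of_add_eq hh) fun i => by rw [U.finrank_ker hh]; split_ifs <;> simp]
  have h1 : X.e = X.dim (j + 1) := U.finrank_hom_left U.pow
  have h2 : X.socLen = 1 := by
    unfold socLen
    simp [U.finrank_ker hh]
  rw [h1, h2, pow_one]

end fullCircle

theorem isCompl_of_disjoint {M : QRep F r} {B W : Sb M} (hd : ∀ i, Disjoint (B.U i) (W.U i))
    (ht : M.tdim ≤ (M.sub B).tdim + (M.sub W).tdim) (i : ZMod r) : IsCompl (B.U i) (W.U i) := by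
  have h1 : ∀ i, (M.sub B).dim i + (M.sub W).dim i ≤ M.dim i := fun i => by
    have h2 := Submodule.finrank_sup_add_finrank_inf_eq (B.U i) (W.U i)
    rw [(hd i).eq_bot, finrank_bot, add_zero] at h2
    exact h2.symm.le.trans (Submodule.finrank_le _)
  have h2 : (M.sub B).dim i + (M.sub W).dim i = M.dim i := by
    refine le_antisymm (h1 i) ?_
    by_contra hlt
    have : ∑ i, ((M.sub B).dim i + (M.sub W).dim i) < ∑ i, M.dim i :=
      Finset.sum_lt_sum (fun i _ => h1 i) ⟨i, Finset.mem_univ i, by omega⟩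
    rw [Finset.sum_add_distrib, ← tdim_eq_sum, ← tdim_eq_sum, ← tdim_eq_sum] at this
    omega
  refine ⟨hd i, codisjoint_iff.2 (Submodule.eq_top_of_finrank_eq ?_)⟩
  have h3 := Submodule.finrank_sup_add_finrank_inf_eq (B.U i) (W.U i)
  rw [(hd i).eq_bot, finrank_bot, add_zero] at h3
  rw [h3]
  exact h2

/-- The isomorphism of the source of an injective homomorphism with its image. -/
noncomputable def rangeIso {A B : QRep F r} {f : ∀ i, A.V i →ₗ[F] B.V i} (hf : f ∈ hom A B)
    (hi : ∀ i, Function.Injective (f i)) : Iso A (B.sub (rangeSb hf)) where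
  toFun i := LinearEquiv.ofInjective (f i) (hi i)
  comm i a := Subtype.ext (hf i a)

/-- Prolonging a chain. -/
theorem Uni.exists_pow_T_eq {X : QRep F r} {h : ℕ} {j : ZMod r} {z : X.V (j + 1)}
    {Y : QRep F r} {h' : ℕ} {y₀ : Y.V (j + 1)}
    (hY : Y.T ^ (h' + 1) = 0) (η : E X Y)
    (hR : ∀ y, ∃ (c : F) (u : Y.V j), y = Y.x j u + c • y₀)
    {t : X.V j} (hxt : X.x j t = 0) (ht : (X.T ^ h) (X.sg (j + 1) z) = X.sg j t)
    (hη : η j t ∉ LinearMap.range (Y.x j)) :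
    ∃ c : F, c ≠ 0 ∧ ((ext X Y η).T ^ (h' + 1 + h)) ((ext X Y η).sg (j + 1) (z, 0)) =
      c • tmap (A := Y) (B := ext X Y η) (fun i => LinearMap.inr F (X.V i) (Y.V i))
        ((Y.T ^ h') (Y.sg (j + 1) y₀)) := by
  have hfst := tmap_pow_T (fst_mem_hom X Y η) h ((ext X Y η).sg (j + 1) (z, 0))
  rw [tmap_sg] at hfst
  change _ = (X.T ^ h) (X.sg (j + 1) z) at hfst
  rw [ht] at hfst
  by_cases htz : t = 0
  · exact absurd (by rw [htz, map_zero]; exact Submodule.zero_mem _) hη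
  have hjh : j = j + 1 + (h : ZMod r) := by
    by_contra hne
    have h1 := (hg_sg (j + 1) z).pow_T (A := X) h j hne
    rw [ht, sg_same] at h1
    exact htz h1
  have hhg : Hg j (((ext X Y η).T ^ h) ((ext X Y η).sg (j + 1) (z, 0))) := by
    have := (hg_sg (A := ext X Y η) (j + 1) (z, 0)).pow_T h
    rwa [← hjh] at this
  obtain ⟨b, hb⟩ : ∃ b : Y.V j, ((ext X Y η).T ^ h) ((ext X Y η).sg (j + 1) (z, 0)) =
      (ext X Y η).sg j (t, b) := by
    refine ⟨(((ext X Y η).T ^ h) ((ext X Y η).sg (j + 1) (z, 0)) j).2, hhg.eq_sg.trans ?_⟩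
    congr 1
    refine Prod.ext ?_ rfl
    have := congrFun hfst j
    rwa [sg_same] at this
  obtain ⟨c, u, hc⟩ := hR (η j t + Y.x j b)
  refine ⟨c, fun hc0 => hη ⟨u - b, ?_⟩, ?_⟩
  · rw [hc0, zero_smul, add_zero] at hc
    rw [map_sub, ← hc, add_sub_cancel_right]
  · rw [pow_T_add, hb, ← pow_T_T, T_inl_of_x_eq_zero b hxt, pow_T_inr, hc, map_add, map_add,
      pow_T_x_eq_zero hY, zero_add, map_smul, map_smul, map_smul]

theorem pow_T_ext_zero {A N : QRep F r} {k : ℕ} (hA : A.T ^ k = 0) (hN : N.T ^ k = 0) :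
    (ext A N 0).T ^ k = 0 := by
  have hsnd : (fun i => LinearMap.snd F (A.V i) (N.V i)) ∈ hom (ext A N 0) N := by
    rintro i ⟨a, n⟩
    simp
  refine LinearMap.ext fun w => funext fun i => Prod.ext ?_ ?_
  · have := tmap_pow_T (fst_mem_hom A N 0) k w
    rw [hA] at this
    exact congrFun this i
  · have := tmap_pow_T hsnd k w
    rw [hN] at this
    exact congrFun this i

theorem inl_mem_hom (A N : QRep F r) :
    (fun i => LinearMap.inl F (A.V i) (N.V i)) ∈ hom A (ext A N 0) := by
  intro i a
  simp

theorem tmap_inl_ne_inr {A N : QRep F r} {w : A.Tot} (hw : w ≠ 0) (w' : N.Tot) :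
    tmap (A := A) (B := ext A N 0) (fun i => LinearMap.inl F (A.V i) (N.V i)) w ≠
      tmap (A := N) (B := ext A N 0) (fun i => LinearMap.inr F (A.V i) (N.V i)) w' := fun h =>
  hw (funext fun i => congrArg Prod.fst (congrFun h i))

/-- Prolonging the longest summand. -/
theorem Uni.e_ext_of_notMem {X : QRep F r} {h : ℕ} {j : ZMod r} {z : X.V (j + 1)}
    (U : Uni X h (j + 1) z) (hh : j + 1 + h = j) {A N : QRep F r} {h' : ℕ} {z₀ : A.V (j + 1)}
    (UA : Uni A h' (j + 1) z₀) (hN : N.T ^ (h' + 1) = 0) (η : E X (ext A N 0))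
    (hR : ∀ y, ∃ (c : F) (u : (ext A N 0).V j), y = (ext A N 0).x j u + c • (z₀, 0))
    {t : X.V j} (hxt : X.x j t = 0) (ht : (X.T ^ h) (X.sg (j + 1) z) = X.sg j t)
    (hη : η j t ∉ LinearMap.range ((ext A N 0).x j)) :
    (ext X (ext A N 0) η).e = (ext A N 0).e + X.dim (j + 1) := by
  have hYpow : (ext A N 0).T ^ (h' + 1) = 0 := pow_T_ext_zero UA.pow hN
  have hz₀ : ((ext A N 0).T ^ h') ((ext A N 0).sg (j + 1) (z₀, 0)) =
      tmap (A := A) (B := ext A N 0) (fun i => LinearMap.inl F (A.V i) (N.V i))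
        ((A.T ^ h') (A.sg (j + 1) z₀)) := by
    rw [tmap_pow_T (inl_mem_hom A N), tmap_sg]
    rfl
  have hMpow : (ext X (ext A N 0) η).T ^ (h' + 1 + h + 1) = 0 := by
    have := pow_T_ext_eq_zero U.pow hYpow η
    rwa [← add_assoc] at this
  obtain ⟨c, hc0, hc⟩ := Uni.exists_pow_T_eq (z := z) hYpow η hR hxt ht hη
  rw [hz₀] at hc
  have hne : ((ext X (ext A N 0) η).T ^ (h' + 1 + h))
      ((ext X (ext A N 0) η).sg (j + 1) (z, 0)) ≠ 0 := by
    rw [hc]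
    refine smul_ne_zero hc0 fun h0 => UA.ne (tmap_injective (A := A) (B := ext A N 0)
      (f := fun i => LinearMap.inl F (A.V i) (N.V i)) (fun i => LinearMap.inl_injective)
      (tmap_inr_injective X (ext A N 0) η ?_))
    rw [h0, map_zero, map_zero]
  obtain ⟨B, -, z', -, UB, hB⟩ := exists_uni_summand _ (h' + 1 + h) (j + 1) (z, 0) hMpow hne
  have hf : (fun i => (LinearMap.inr F (X.V i) (A.V i × N.V i)).comp
      (LinearMap.inr F (A.V i) (N.V i))) ∈ hom N (ext X (ext A N 0) η) := by
    intro i a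
    change ((0 : X.V (i + 1)), ((0 : A.V (i + 1)), N.x i a)) =
      (ext X (ext A N 0) η).x i (0, (0, a))
    simp
  have hfi : ∀ i, Function.Injective
      ((LinearMap.inr F (X.V i) (A.V i × N.V i)).comp (LinearMap.inr F (A.V i) (N.V i))) :=
    fun i => LinearMap.inr_injective.comp LinearMap.inr_injective
  have hdisj : ∀ i, Disjoint (B.U i) ((rangeSb hf).U i) := by
    intro i
    rw [Submodule.disjoint_def]
    rintro _ ha ⟨n, rfl⟩
    by_contra hne'
    obtain ⟨d, hd⟩ := hB i _ ha
    have hdne : ∃ k ≤ h' + 1 + h, d k ≠ 0 := by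
      by_contra hcon
      push Not at hcon
      rw [Finset.sum_eq_zero] at hd
      · have := congrFun hd i
        rw [sg_same] at this
        exact hne' this
      · intro k hk
        rw [hcon k (by have := Finset.mem_range.1 hk; omega), zero_smul]
    obtain ⟨k, hk, hdk, hlow⟩ := exists_lowest _ _ (h' + 1 + h)
      (by rw [hMpow]; rfl) d hdne
    rw [← hd, ← tmap_sg (A := N) (B := ext X (ext A N 0) η) (fun i =>
      (LinearMap.inr F (X.V i) (A.V i × N.V i)).comp (LinearMap.inr F (A.V i) (N.V i))),
      ← tmap_pow_T hf, hc, smul_smul, ← map_smul, ← map_smul] at hlow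
    refine tmap_inl_ne_inr (A := A) (N := N) (smul_ne_zero (mul_ne_zero hdk hc0) UA.ne) _
      (tmap_inr_injective X (ext A N 0) η hlow.symm)
  have φ : Iso N ((ext X (ext A N 0) η).sub (rangeSb hf)) := rangeIso hf hfi
  have hcompl := isCompl_of_disjoint (B := B) (W := rangeSb hf) hdisj (by
    rw [tdim_ext, tdim_ext, U.tdim_eq, UA.tdim_eq, UB.tdim_eq, ← φ.tdim_eq]
    omega)
  have ψ := splitIso B (rangeSb hf) hcompl
  have hNpow : ((ext X (ext A N 0) η).sub (rangeSb hf)).T ^ (h' + 1 + h + 1) = 0 := by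
    refine pow_T_eq_zero_of_injective φ.symm.mem_hom (fun i => (φ.symm.toFun i).injective) ?_
    rw [show h' + 1 + h + 1 = (h + 1) + (h' + 1) by ring, pow_add, hN, mul_zero]
  have h1 := e_ext_zero ((ext X (ext A N 0) η).sub B) ((ext X (ext A N 0) η).sub (rangeSb hf))
  have h4 : Module.finrank F (hom ((ext X (ext A N 0) η).sub (rangeSb hf))
      ((ext X (ext A N 0) η).sub (rangeSb hf))) = Module.finrank F (hom N N) := φ.e_eq.symm
  rw [ψ.e_eq, UB.finrank_hom_left UB.pow, UB.finrank_hom_left hNpow, UB.finrank_hom_right hNpow,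
    h4] at h1
  have h2 := e_ext_zero A N
  rw [UA.finrank_hom_left UA.pow, UA.finrank_hom_left hN, UA.finrank_hom_right hN] at h2
  have h3 : ((ext X (ext A N 0) η).sub (rangeSb hf)).dim = N.dim := φ.dim_eq.symm
  have h5 : ((ext X (ext A N 0) η).sub B).dim (j + 1) + N.dim (j + 1) =
      X.dim (j + 1) + (A.dim (j + 1) + N.dim (j + 1)) := by
    have := congrFun ψ.dim_eq (j + 1)
    rw [dim_ext, h3, dim_ext, dim_ext] at this
    exact this
  have h6 : j + 1 + ((h' + 1 + h : ℕ) : ZMod r) = j + 1 + (h' : ZMod r) := by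
    push_cast
    linear_combination hh
  rw [h3, h6] at h1
  omega

theorem Uni.inl_notMem_range {j : ZMod r} {A N : QRep F r} {h : ℕ} {z : A.V (j + 1)}
    (UA : Uni A h (j + 1) z) (hN : N.T ^ (h + 1) = 0) :
    ((z, 0) : A.V (j + 1) × N.V (j + 1)) ∉ LinearMap.range ((ext A N 0).x j) := by
  rintro ⟨u, hu⟩
  have h1 := pow_T_x_eq_zero (pow_T_ext_zero UA.pow hN) j u
  rw [hu] at h1
  refine UA.ne ?_
  have h2 := tmap_pow_T (fst_mem_hom A N 0) h ((ext A N 0).sg (j + 1) (z, 0))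
  rw [h1, map_zero, tmap_sg] at h2
  exact h2.symm

theorem exists_add_smul_of_finrank {V W : Type*} [AddCommGroup V] [Module F V] [AddCommGroup W]
    [Module F W] [Module.Finite F W] {f : V →ₗ[F] W} {y₀ : W} (h0 : y₀ ∉ LinearMap.range f)
    (hf : Module.finrank F W ≤ Module.finrank F (LinearMap.range f) + 1) (y : W) :
    ∃ (c : F) (u : V), y = f u + c • y₀ := by
  have h1 : LinearMap.range f ⊔ Submodule.span F {y₀} = ⊤ := by
    refine Submodule.eq_top_of_finrank_eq (le_antisymm (Submodule.finrank_le _) ?_)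
    have : LinearMap.range f < LinearMap.range f ⊔ Submodule.span F {y₀} := by
      refine lt_of_le_of_ne le_sup_left fun h => h0 ?_
      rw [h]
      exact Submodule.mem_sup_right (Submodule.mem_span_singleton_self y₀)
    exact hf.trans (Submodule.finrank_lt_finrank_of_lt this)
  have h2 : y ∈ LinearMap.range f ⊔ Submodule.span F {y₀} := h1 ▸ Submodule.mem_top
  obtain ⟨_, ⟨u, rfl⟩, w, hw, rfl⟩ := Submodule.mem_sup.1 h2
  obtain ⟨c, rfl⟩ := Submodule.mem_span_singleton.1 hw
  exact ⟨c, u, rfl⟩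

theorem Const.ext_iff {X Y : QRep F r} {η : E X Y} (hX : X.Const) :
    (ext X Y η).Const ↔ Y.Const := by
  obtain ⟨m, hm⟩ := hX
  simp only [Const, dim_ext, Pi.add_apply, hm]
  exact ⟨fun ⟨n, hn⟩ => ⟨n - m, fun i => by have := hn i; omega⟩,
    fun ⟨n, hn⟩ => ⟨m + n, fun i => by rw [hn]⟩⟩

open scoped Classical in
theorem Uni.rs_g_of_add_eq {X : QRep F r} {h : ℕ} {j : ZMod r} {z : X.V (j + 1)}
    (U : Uni X h (j + 1) z) (hh : j + 1 + h = j) {A N : QRep F r} {h' : ℕ} {z₀ : A.V (j + 1)}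
    (UA : Uni A h' (j + 1) z₀) (hN : N.T ^ (h' + 1) = 0) :
    Rs g X (ext A N 0) = q F ^ G X (ext A N 0) * X.g * (ext A N 0).g := by
  have hXc := U.const_of_add_eq hh
  by_cases hY : (ext A N 0).Const ∧ (ext A N 0).Sqf
  swap
  · rw [rs_g_eq_zero (by rwa [hXc.ext_iff]), g_eq_zero hY, mul_zero]
  obtain ⟨⟨m, hm⟩, hs⟩ := hY
  have hYn : (ext A N 0).Nil := ⟨h' + 1, pow_T_ext_zero UA.pow hN⟩
  obtain ⟨t, ht0, hxt, ht, htk⟩ := U.exists_socle hh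
  have hz := UA.inl_notMem_range hN
  have hrk := LinearMap.finrank_range_add_finrank_ker ((ext A N 0).x j)
  have hlt : Module.finrank F (LinearMap.range ((ext A N 0).x j)) <
      Module.finrank F ((ext A N 0).V (j + 1)) :=
    Submodule.finrank_lt fun h => hz (by rw [h]; exact Submodule.mem_top)
  have hm1 : Module.finrank F ((ext A N 0).V j) = m := hm j
  have hm2 : Module.finrank F ((ext A N 0).V (j + 1)) = m := hm (j + 1)
  have hkr := hs j
  rw [hm1] at hrk
  rw [hm2] at hlt
  have hle : m ≤ Module.finrank F (LinearMap.range ((ext A N 0).x j)) + 1 := by omega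
  have hR := exists_add_smul_of_finrank hz (hm2.le.trans hle)
  have hg : ∀ η : E X (ext A N 0), (ext X (ext A N 0) η).g =
      ((-q F) ^ X.dim (j + 1) * (ext A N 0).g) *
        (1 - if η j t ∈ LinearMap.range ((ext A N 0).x j) then 1 else 0) := by
    intro η
    by_cases hη : η j t ∈ LinearMap.range ((ext A N 0).x j)
    · rw [if_pos hη, sub_self, mul_zero, g_eq_zero]
      rintro ⟨-, h2⟩
      have h3 := lt_finrank_ker_ext ht0 hxt hη
      have h4 := h2 j
      omega
    · rw [if_neg hη, sub_zero, mul_one]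
      have hker : ∀ i, Module.finrank F (LinearMap.ker ((ext X (ext A N 0) η).x i)) =
          Module.finrank F (LinearMap.ker ((ext A N 0).x i)) := by
        intro i
        refine finrank_ker_ext_of_forall fun a ha ha' => ?_
        by_cases hi : i = j
        · subst hi
          obtain ⟨c, rfl⟩ := htk a ha
          by_cases hc : c = 0
          · rw [hc, zero_smul]
          · rw [map_smul] at ha'
            exact absurd ((Submodule.smul_mem_iff _ hc).1 ha') hη
        · exact U.eq_zero_of_ker (by rwa [hh]) ha
      rw [g_eq (U.nil.ext hYn η) (hXc.ext_iff.2 ⟨m, hm⟩) fun i => by rw [hker]; exact hs i,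
        g_eq hYn ⟨m, hm⟩ hs, U.e_ext_of_notMem hh UA hN η hR hxt ht hη, pow_add]
      have : (ext X (ext A N 0) η).socLen = (ext A N 0).socLen :=
        Finset.sum_congr rfl fun i _ => hker i
      rw [this]
      ring
  let φ : E X (ext A N 0) →+ (ext A N 0).V (j + 1) :=
    { toFun := fun η => η j t, map_zero' := rfl, map_add' := fun _ _ => rfl }
  have hφ : Function.Surjective φ := by
    intro y
    obtain ⟨p, hp, -⟩ := Submodule.exists_le_ker_of_notMem
      (p := (⊥ : Submodule F (X.V j))) (fun h0 => ht0 ((Submodule.mem_bot F).1 h0))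
    refine ⟨Pi.single j (((p t)⁻¹ • p).smulRight y), ?_⟩
    change (Pi.single j (((p t)⁻¹ • p).smulRight y) : E X (ext A N 0)) j t = y
    rw [Pi.single_eq_same]
    simp [inv_mul_cancel₀ hp]
  have : Fintype ((ext A N 0).V (j + 1)) := Fintype.ofFinite _
  obtain ⟨K, hK, hK'⟩ := exists_fiber_card φ hφ
  have hcard : (Fintype.card ((ext A N 0).V (j + 1)) : ℂ) = q F ^ m := by
    rw [card_eq_q_pow (F := F), hm2]
  have hG : ∑ i, X.dim i * (ext A N 0).dim (i + 1) = G X (ext A N 0) :=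
    Finset.sum_congr rfl fun i _ => by rw [hm, hm]
  rw [card_E, hG, hcard] at hK'
  rw [Rs, Finset.sum_congr rfl fun η _ => hg η, ← Finset.mul_sum]
  refine (congrArg (((-q F) ^ X.dim (j + 1) * (ext A N 0).g) * ·)
    (hK fun y => 1 - if y ∈ LinearMap.range ((ext A N 0).x j) then 1 else 0)).trans ?_
  rw [Finset.sum_sub_distrib, sum_mem_submodule, U.g_eq_of_add_eq hh, ← hK', Finset.sum_const,
    Finset.card_univ, nsmul_eq_mul, hcard,
    show m = Module.finrank F (LinearMap.range ((ext A N 0).x j)) + 1 by omega, pow_succ]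
  have := q_ne_zero (F := F)
  field_simp

theorem eq_zero_of_sum_eq_zero {ι : Type*} [Fintype ι] {f : ι → ℂ} {a : ℂ}
    (h : ∀ i, f i = 0 ∨ f i = a) (h0 : ∃ i, f i = a) (hs : ∑ i, f i = 0) : a = 0 := by
  classical
  by_contra ha
  have h1 : ∀ i, f i = if f i = a then a else 0 := fun i => by
    split_ifs with h2
    · exact h2
    · exact (h i).resolve_right h2
  rw [Finset.sum_congr rfl fun i _ => h1 i, ← Finset.sum_filter, Finset.sum_const,
    nsmul_eq_mul, mul_eq_zero, Nat.cast_eq_zero, Finset.card_eq_zero] at hs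
  obtain ⟨i, hi⟩ := h0
  exact Finset.notMem_empty i ((hs.resolve_right ha) ▸ Finset.mem_filter.2 ⟨Finset.mem_univ i, hi⟩)

theorem dim_eq_zero {A : QRep F r} (h : A.tdim = 0) (i : ZMod r) : A.dim i = 0 :=
  Finset.sum_eq_zero_iff.1 h i (Finset.mem_univ i)

theorem subsingleton_of_tdim {A : QRep F r} (h : A.tdim = 0) (i : ZMod r) :
    Subsingleton (A.V i) := Module.finrank_zero_iff.1 (dim_eq_zero h i)

/-- Extensions by the zero object. -/
noncomputable def extZeroRight {A N : QRep F r} (h : N.tdim = 0) (η : E A N) :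
    Iso (ext A N η) A :=
  isoOfBijective (A := ext A N η) _ (fst_mem_hom A N η) fun i => ⟨fun _ _ hab =>
    have := subsingleton_of_tdim h i
    Prod.ext hab (Subsingleton.elim _ _), fun a => ⟨(a, 0), rfl⟩⟩

/-- Extensions of the zero object. -/
noncomputable def extZeroLeft {A N : QRep F r} (h : A.tdim = 0) (η : E A N) :
    Iso N (ext A N η) :=
  isoOfBijective (B := ext A N η) _ (inr_mem_hom A N η) fun i => ⟨LinearMap.inr_injective, fun b =>
    have := subsingleton_of_tdim h i
    ⟨b.2, Prod.ext (Subsingleton.elim _ _) rfl⟩⟩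

/-- The symmetry of direct sums. -/
def extZeroComm (A N : QRep F r) : Iso (ext A N 0) (ext N A 0) where
  toFun i := LinearEquiv.prodComm F _ _
  comm i a := by
    obtain ⟨a, b⟩ := a
    simp

theorem g_eq_one {A : QRep F r} (h : A.tdim = 0) : A.g = 1 := by
  have hs := subsingleton_of_tdim h
  have hn : A.Nil := ⟨0, LinearMap.ext fun w => Subsingleton.elim _ _⟩
  have hk : ∀ i, Module.finrank F (LinearMap.ker (A.x i)) = 0 := fun i =>
    Module.finrank_zero_of_subsingleton
  rw [g_eq hn ⟨0, dim_eq_zero h⟩ fun i => by rw [hk]; exact Nat.zero_le _]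
  have h1 : A.e = 0 := Module.finrank_zero_of_subsingleton
  have h2 : A.socLen = 0 := Finset.sum_eq_zero fun i _ => hk i
  rw [h1, h2, pow_zero, pow_zero, one_mul]

theorem G_eq_zero_left {X Y : QRep F r} (h : X.tdim = 0) : G X Y = 0 :=
  Finset.sum_eq_zero fun i _ => by rw [dim_eq_zero h, zero_mul]

theorem G_eq_zero_right {X Y : QRep F r} (h : Y.tdim = 0) : G X Y = 0 :=
  Finset.sum_eq_zero fun i _ => by rw [dim_eq_zero h, mul_zero]

theorem ClassFun.rs_zero_left {f : QRep F r → ℂ} (hf : ClassFun f) {X Y : QRep F r}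
    (h : X.tdim = 0) : Rs f X Y = f Y := by
  have hs := subsingleton_of_tdim h
  have : Unique (E X Y) := ⟨⟨0⟩, fun η => funext fun i => LinearMap.ext fun a => by
    rw [Subsingleton.elim a 0, map_zero, map_zero]⟩
  rw [Rs, Fintype.sum_unique]
  exact (hf _ _ (extZeroLeft h _)).symm

theorem ClassFun.rs_zero_right {f : QRep F r → ℂ} (hf : ClassFun f) {X Y : QRep F r}
    (h : Y.tdim = 0) : Rs f X Y = f X := by
  have hs := subsingleton_of_tdim h
  have : Unique (E X Y) := ⟨⟨0⟩, fun η => funext fun i => LinearMap.ext fun a =>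
    Subsingleton.elim _ _⟩
  rw [Rs, Fintype.sum_unique]
  exact hf _ _ (extZeroRight h _)

theorem Nil.of_pow {A : QRep F r} {k : ℕ} (h : A.T ^ k = 0) : A.Nil := ⟨k, h⟩

/-- A class function which sums to zero over all extensions and vanishes on uniserial
representations vanishes. -/
theorem ClassFun.eq_zero_of_uni {D : QRep F r → ℂ} (hD : ClassFun D) {n : ℕ} (hn : n ≠ 0)
    (hs : ∀ X₁ X₂ : QRep F r, X₁.Nil → X₂.Nil → X₁.tdim ≠ 0 → X₂.tdim ≠ 0 →
      X₁.tdim + X₂.tdim = n → Rs D X₁ X₂ = 0)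
    (hu : ∀ (A : QRep F r) (h : ℕ) (j : ZMod r) (z : A.V j), Uni A h j z → h + 1 = n → D A = 0)
    {X : QRep F r} (hX : X.Nil) (hXn : X.tdim = n) : D X = 0 := by
  generalize he : X.e = e
  induction e using Nat.strong_induction_on generalizing X with
  | _ e ih =>
    obtain ⟨A, N, h, j, z, UA, hN, ⟨φ⟩⟩ := exists_uni_decomp hX (by omega)
    have ht := φ.tdim_eq
    rw [tdim_ext, UA.tdim_eq] at ht
    by_cases hN0 : N.tdim = 0
    · rw [← hD _ _ φ, hD _ _ (extZeroRight hN0 0)]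
      exact hu A h j z UA (by omega)
    · refine eq_zero_of_sum_eq_zero (f := fun η => D (ext A N η)) (fun η => ?_) ⟨0, hD _ _ φ⟩
        (hs A N UA.nil (Nil.of_pow hN) (by rw [UA.tdim_eq]; omega) hN0
          (by rw [UA.tdim_eq]; omega))
      obtain ⟨⟨ψ⟩⟩ | hlt := ext_split_or_e_lt η
      · right
        exact hD _ _ (ψ.trans φ)
      · left
        refine ih _ ?_ (UA.nil.ext (Nil.of_pow hN) η) (by rw [tdim_ext, UA.tdim_eq]; omega) rfl
        rwa [φ.e_eq, he] at hlt

section chain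

variable {D : QRep F r → ℂ} {h : ℕ}

theorem ClassFun.uni_eq_zero_of_split (hD : ClassFun D)
    (hs : ∀ X₁ X₂ : QRep F r, X₁.Nil → X₂.Nil → X₁.tdim ≠ 0 → X₂.tdim ≠ 0 →
      X₁.tdim + X₂.tdim = h + 2 → Rs D X₁ X₂ = 0)
    {S A B : QRep F r} {j : ZMod r} {s : S.V j} {z : A.V (j + 1)} {z' : B.V j}
    (US : Uni S 0 j s) (UA : Uni A h (j + 1) z) (UB : Uni B (h + 1) j z')
    (h0 : D (ext S A 0) = 0) : D B = 0 := by
  refine eq_zero_of_sum_eq_zero (f := fun η => D (ext S A η)) (fun η => ?_) ?_ (hs S A US.nil UA.nil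
    (by rw [US.tdim_eq]; omega) (by rw [UA.tdim_eq]; omega)
    (by rw [US.tdim_eq, UA.tdim_eq]; omega))
  · obtain ⟨⟨ψ⟩⟩ | hη := US.ext_simple UA η
    · left
      rw [hD _ _ ψ, h0]
    · right
      obtain ⟨ψ⟩ := hη.nonempty_iso UB
      exact hD _ _ ψ
  · obtain ⟨η, hη⟩ := US.exists_nonsplit UA
    obtain ⟨ψ⟩ := hη.nonempty_iso UB
    exact ⟨η, hD _ _ ψ⟩

theorem ClassFun.split_eq_zero (hD : ClassFun D)
    (hs : ∀ X₁ X₂ : QRep F r, X₁.Nil → X₂.Nil → X₁.tdim ≠ 0 → X₂.tdim ≠ 0 →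
      X₁.tdim + X₂.tdim = h + 2 → Rs D X₁ X₂ = 0)
    {S A : QRep F r} {j : ZMod r} {s : S.V j} {z : A.V (j + 1)}
    (US : Uni S 0 j s) (UA : Uni A h (j + 1) z)
    (h0 : j = j + 1 + (h + 1 : ℕ) →
      ∀ (B : QRep F r) (z : B.V (j + 1)), Uni B (h + 1) (j + 1) z → D B = 0) :
    D (ext S A 0) = 0 := by
  rw [hD _ _ (extZeroComm S A)]
  refine eq_zero_of_sum_eq_zero (f := fun η => D (ext A S η)) (fun η => ?_) ⟨0, rfl⟩ (hs A S UA.nil US.nil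
    (by rw [UA.tdim_eq]; omega) (by rw [US.tdim_eq]; omega)
    (by rw [US.tdim_eq, UA.tdim_eq]))
  obtain ⟨⟨ψ⟩⟩ | ⟨hη, hj⟩ := US.ext_by_simple UA η
  · right
    exact hD _ _ ψ
  · left
    exact h0 hj _ _ hη

theorem ClassFun.uni_eq_zero (hD : ClassFun D)
    (hs : ∀ X₁ X₂ : QRep F r, X₁.Nil → X₂.Nil → X₁.tdim ≠ 0 → X₂.tdim ≠ 0 →
      X₁.tdim + X₂.tdim = h + 2 → Rs D X₁ X₂ = 0) {j₀ : ZMod r}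
    (h0 : j₀ + (h + 2 : ℕ) = j₀ →
      ∀ (B : QRep F r) (z : B.V j₀), Uni B (h + 1) j₀ z → D B = 0)
    {B : QRep F r} {j : ZMod r} {z : B.V j} (UB : Uni B (h + 1) j z) : D B = 0 := by
  have key : ∀ j : ZMod r, (j = j + 1 + (h + 1 : ℕ) →
      ∀ (B : QRep F r) (z : B.V (j + 1)), Uni B (h + 1) (j + 1) z → D B = 0) →
      ∀ (B : QRep F r) (z : B.V j), Uni B (h + 1) j z → D B = 0 := by
    intro j hj B z UB
    obtain ⟨S, s, US⟩ := exists_simple F j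
    obtain ⟨A, z', UA⟩ := exists_uni F h (j + 1)
    exact hD.uni_eq_zero_of_split hs US UA UB (hD.split_eq_zero hs US UA hj)
  by_cases hc : ((h + 2 : ℕ) : ZMod r) = 0
  · have h1 : ∀ k : ℕ, ∀ (B : QRep F r) (z : B.V (j₀ - k)), Uni B (h + 1) (j₀ - k) z → D B = 0 := by
      intro k
      induction k with
      | zero =>
        rw [Nat.cast_zero, sub_zero]
        exact h0 (by rw [hc, add_zero])
      | succ k ih =>
        refine key _ fun _ => ?_
        rw [show j₀ - ((k + 1 : ℕ) : ZMod r) + 1 = j₀ - k by push_cast; ring]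
        exact ih
    have h2 : j₀ - ((j₀ - j).val : ZMod r) = j := by rw [ZMod.natCast_zmod_val]; ring
    have h3 := h1 (j₀ - j).val
    rw [h2] at h3
    exact h3 B z UB
  · refine key j (fun hj => absurd ?_ hc) B z UB
    push_cast at hj ⊢
    linear_combination -hj

end chain

theorem Uni.g_simple (hr : 1 < r) {S : QRep F r} {j : ZMod r} {s : S.V j} (US : Uni S 0 j s) :
    S.g = 0 := by
  refine g_eq_zero fun ⟨⟨n, hn⟩, _⟩ => ?_
  have h1 := US.tdim_eq
  rw [tdim_eq_sum, Finset.sum_congr rfl fun i _ => hn i, Finset.sum_const, Finset.card_univ,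
    ZMod.card, smul_eq_mul] at h1
  have := Nat.eq_one_of_mul_eq_one_right h1
  omega

theorem classFun_defect (Y : QRep F r) :
    ClassFun fun A : QRep F r => Rs g A Y - q F ^ G A Y * A.g * Y.g := fun A B φ => by
  dsimp only
  rw [classFun_g.rs_congr φ (Iso.refl Y), classFun_g A B φ, G, G, φ.dim_eq]

/-- The signed automorphism count is multiplicative for the dual product. -/
theorem rs_g (hr : 1 < r) {X Y : QRep F r} (hX : X.Nil) (hY : Y.Nil) :
    Rs g X Y = q F ^ G X Y * X.g * Y.g := by
  generalize hn : X.tdim = n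
  induction n using Nat.strong_induction_on generalizing X Y with
  | _ n ih =>
    by_cases hn0 : n = 0
    · rw [hn0] at hn
      rw [classFun_g.rs_zero_left hn, G_eq_zero_left hn, g_eq_one hn, pow_zero, one_mul, one_mul]
    by_cases hY0 : Y.tdim = 0
    · rw [classFun_g.rs_zero_right hY0, G_eq_zero_right hY0, g_eq_one hY0, pow_zero, one_mul,
        mul_one]
    have hD := classFun_defect Y
    have hs : ∀ X₁ X₂ : QRep F r, X₁.Nil → X₂.Nil → X₁.tdim ≠ 0 → X₂.tdim ≠ 0 →
        X₁.tdim + X₂.tdim = n →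
        Rs (fun A : QRep F r => Rs g A Y - q F ^ G A Y * A.g * Y.g) X₁ X₂ = 0 := by
      intro X₁ X₂ h1 h2 h10 h20 h12
      have e1 : ∑ η : E X₁ X₂, Rs g (ext X₁ X₂ η) Y =
          q F ^ (G X₁ X₂ + G X₁ Y) * X₁.g * (q F ^ G X₂ Y * X₂.g * Y.g) := by
        rw [classFun_g.rs_assoc, ← ih X₂.tdim (by omega) h2 hY rfl, Rs, Finset.mul_sum]
        refine Finset.sum_congr rfl fun ξ _ => ?_
        rw [ih X₁.tdim (by omega) h1 (h2.ext hY ξ) rfl, G_ext_right]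
      have e2 : ∑ η : E X₁ X₂, q F ^ G (ext X₁ X₂ η) Y * (ext X₁ X₂ η).g * Y.g =
          q F ^ (G X₁ Y + G X₂ Y) * (q F ^ G X₁ X₂ * X₁.g * X₂.g) * Y.g := by
        rw [← ih X₁.tdim (by omega) h1 h2 rfl, Rs, Finset.mul_sum, Finset.sum_mul]
        refine Finset.sum_congr rfl fun η _ => ?_
        rw [G_ext_left]
      rw [Rs, Finset.sum_sub_distrib, e1, e2]
      ring
    refine sub_eq_zero.1 (hD.eq_zero_of_uni hn0 hs (fun A h j z UA hh => ?_) hX hn)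
    obtain _ | h := h
    · rw [UA.rs_g_simple hr hY, UA.g_simple hr, mul_zero, zero_mul, sub_zero]
    · subst hh
      obtain ⟨A', N, h', k, z', UA', hN, ⟨φ⟩⟩ := exists_uni_decomp hY hY0
      obtain ⟨k, rfl⟩ : ∃ k', k = k' + 1 := ⟨k - 1, by ring⟩
      refine hD.uni_eq_zero hs (j₀ := k + 1) (fun hk B w UB => ?_) UA
      rw [← classFun_g.rs_congr (Iso.refl B) φ, ← classFun_g _ _ φ,
        UB.rs_g_of_add_eq (add_right_cancel (b := 1) ?_) UA' hN, G, G, φ.dim_eq, sub_self]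
      push_cast at hk ⊢
      linear_combination hk

/-! ### Sums over graded subspaces -/

/-- Graded subspaces. -/
abbrev Gr (A : QRep F r) : Type := ∀ i, Submodule F (A.V i)

noncomputable instance fintype_Gr (A : QRep F r) : Fintype (Gr A) := Fintype.ofFinite _

instance finite_Sb (A : QRep F r) : Finite (Sb A) :=
  Finite.of_injective (fun W : Sb A => (W.U : Gr A)) fun _ _ h => Sb.ext h

noncomputable instance fintype_Sb (A : QRep F r) : Fintype (Sb A) := Fintype.ofFinite _

/-- Stability of a graded subspace under the structure maps. -/
def St (A : QRep F r) (U : Gr A) : Prop := ∀ i, ∀ u ∈ U i, A.x i u ∈ U (i + 1)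

open scoped Classical in
theorem sum_Sb (A : QRep F r) (f : Sb A → ℂ) :
    ∑ W : Sb A, f W = ∑ U : Gr A, if h : A.St U then f ⟨U, h⟩ else 0 := by
  rw [← Finset.sum_filter_add_sum_filter_not Finset.univ (fun U : Gr A => A.St U)]
  have h2 : ∑ U : Gr A with ¬ A.St U, (if h : A.St U then f ⟨U, h⟩ else 0) = 0 :=
    Finset.sum_eq_zero fun U hU => dif_neg (Finset.mem_filter.1 hU).2
  rw [h2, add_zero]
  refine Finset.sum_bij (fun W _ => W.U) (fun W _ => ?_) (fun W _ W' _ h => Sb.ext h)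
    (fun U hU => ⟨⟨U, (Finset.mem_filter.1 hU).2⟩, Finset.mem_univ _, rfl⟩) (fun W _ => ?_)
  · exact Finset.mem_filter.2 ⟨Finset.mem_univ _, W.st⟩
  · have h : A.St W.U := W.st
    simp only [dif_pos h]

/-- The convolution product of two functions on representations. -/
noncomputable def cv (f₁ f₂ : QRep F r → ℂ) (A : QRep F r) : ℂ :=
  ∑ W : Sb A, f₁ (A.quo W) * f₂ (A.sub W)

open scoped Classical in
/-- The summand of the convolution product attached to a graded subspace. -/
noncomputable def cvTerm (f₁ f₂ : QRep F r → ℂ) (A : QRep F r) (U : Gr A) : ℂ :=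
  if h : A.St U then f₁ (A.quo ⟨U, h⟩) * f₂ (A.sub ⟨U, h⟩) else 0

theorem cv_eq_sum (f₁ f₂ : QRep F r → ℂ) (A : QRep F r) :
    cv f₁ f₂ A = ∑ U : Gr A, cvTerm f₁ f₂ A U := by
  unfold cv cvTerm
  rw [sum_Sb]

/-- Transport of graded subspaces along an isomorphism. -/
def grMap {A B : QRep F r} (φ : Iso A B) (U : Gr A) : Gr B :=
  fun i => (U i).map (φ.toFun i).toLinearMap

theorem St.map {A B : QRep F r} (φ : Iso A B) {U : Gr A} (h : A.St U) : B.St (grMap φ U) := by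
  rintro i _ ⟨a, ha, rfl⟩
  exact ⟨A.x i a, h i a ha, φ.comm i a⟩

theorem grMap_symm {A B : QRep F r} (φ : Iso A B) (U : Gr A) : grMap φ.symm (grMap φ U) = U := by
  funext i
  ext a
  constructor
  · rintro ⟨_, ⟨b, hb, rfl⟩, rfl⟩
    simpa [Iso.symm] using hb
  · intro ha
    exact ⟨φ.toFun i a, ⟨a, ha, rfl⟩, by simp [Iso.symm]⟩

/-- An isomorphism induces isomorphisms of corresponding subrepresentations. -/
noncomputable def Iso.subMap {A B : QRep F r} (φ : Iso A B) (W : Sb A) :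
    Iso (A.sub W) (B.sub ⟨grMap φ W.U, St.map φ W.st⟩) where
  toFun i := (φ.toFun i).submoduleMap (W.U i)
  comm i a := Subtype.ext (φ.comm i a)

/-- An isomorphism induces isomorphisms of corresponding quotients. -/
noncomputable def Iso.quoMap {A B : QRep F r} (φ : Iso A B) (W : Sb A) :
    Iso (A.quo W) (B.quo ⟨grMap φ W.U, St.map φ W.st⟩) where
  toFun i := Submodule.Quotient.equiv (W.U i) _ (φ.toFun i) rfl
  comm i a := by
    obtain ⟨a, rfl⟩ := Submodule.mkQ_surjective _ a
    change Submodule.Quotient.mk (φ.toFun (i + 1) (A.x i a)) =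
      Submodule.Quotient.mk (B.x i (φ.toFun i a))
    rw [φ.comm]

theorem cvTerm_map {f₁ f₂ : QRep F r → ℂ} (h₁ : ClassFun f₁) (h₂ : ClassFun f₂)
    {A B : QRep F r} (φ : Iso A B) (U : Gr A) :
    cvTerm f₁ f₂ A U = cvTerm f₁ f₂ B (grMap φ U) := by
  unfold cvTerm
  by_cases h : A.St U
  · rw [dif_pos h, dif_pos (h.map φ), h₁ _ _ (φ.quoMap ⟨U, h⟩), h₂ _ _ (φ.subMap ⟨U, h⟩)]
  · rw [dif_neg h, dif_neg]
    intro h'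
    have := St.map φ.symm h'
    rw [grMap_symm] at this
    exact h this

theorem ClassFun.cv {f₁ f₂ : QRep F r → ℂ} (h₁ : ClassFun f₁) (h₂ : ClassFun f₂) :
    ClassFun (cv f₁ f₂) := fun A B φ => by
  rw [cv_eq_sum, cv_eq_sum]
  exact Fintype.sum_equiv ⟨grMap φ, grMap φ.symm, grMap_symm φ, grMap_symm φ.symm⟩ _ _
    fun U => cvTerm_map h₁ h₂ φ U

/-! ### Graded subspaces of a product -/

section product

variable {X Y : QRep F r}

noncomputable instance fintype_L (X Y : QRep F r) : Fintype (L X Y) := Fintype.ofFinite _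

theorem card_L (X Y : QRep F r) : (Fintype.card (L X Y) : ℂ) = q F ^ G X Y := by
  rw [card_eq_q_pow (F := F) (L X Y), Module.finrank_pi_fintype]
  congr 1
  exact Finset.sum_congr rfl fun i _ => Module.finrank_linearMap _ _ _ _

/-- The image of `U' × U''` under the shear `(a, b) ↦ (a, f a + b)`. -/
def sheared (f : L X Y) (U' : Gr X) (U'' : Gr Y) : ∀ i, Submodule F (X.V i × Y.V i) := fun i =>
  ((U' i).prod (U'' i)).map
    ((LinearMap.fst F _ _).prod ((f i).comp (LinearMap.fst F _ _) + LinearMap.snd F _ _))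

theorem mem_sheared {f : L X Y} {U' : Gr X} {U'' : Gr Y} {i : ZMod r} {p : X.V i × Y.V i} :
    p ∈ sheared f U' U'' i ↔ p.1 ∈ U' i ∧ p.2 - f i p.1 ∈ U'' i := by
  constructor
  · rintro ⟨⟨a, b⟩, ⟨ha, hb⟩, rfl⟩
    exact ⟨ha, by simpa using hb⟩
  · rintro ⟨ha, hb⟩
    exact ⟨(p.1, p.2 - f i p.1), ⟨ha, hb⟩, by ext <;> simp⟩

/-- The projection of a graded subspace of a product. -/
def grFst (W : ∀ i, Submodule F (X.V i × Y.V i)) : Gr X :=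
  fun i => (W i).map (LinearMap.fst F _ _)

/-- The intersection of a graded subspace of a product with the second factor. -/
def grSnd (W : ∀ i, Submodule F (X.V i × Y.V i)) : Gr Y :=
  fun i => (W i).comap (LinearMap.inr F _ _)

theorem grFst_sheared (f : L X Y) (U' : Gr X) (U'' : Gr Y) : grFst (sheared f U' U'') = U' := by
  funext i
  ext a
  constructor
  · rintro ⟨p, hp, rfl⟩
    exact (mem_sheared.1 hp).1
  · intro ha
    exact ⟨(a, f i a), mem_sheared.2 ⟨ha, by simp⟩, rfl⟩

theorem grSnd_sheared (f : L X Y) (U' : Gr X) (U'' : Gr Y) : grSnd (sheared f U' U'') = U'' := by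
  funext i
  ext b
  change (0, b) ∈ sheared f U' U'' i ↔ _
  rw [mem_sheared]
  simp

theorem exists_sheared (W : ∀ i, Submodule F (X.V i × Y.V i)) :
    ∃ f : L X Y, sheared f (grFst W) (grSnd W) = W := by
  have key : ∀ i, ∃ f : X.V i →ₗ[F] Y.V i, ∀ a ∈ grFst W i, (a, f a) ∈ W i := by
    intro i
    let p : W i →ₗ[F] grFst W i := (LinearMap.fst F _ _).submoduleMap (W i)
    obtain ⟨s, hs⟩ := p.exists_rightInverse_of_surjective
      (LinearMap.range_eq_top.2 (LinearMap.submoduleMap_surjective _ _))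
    obtain ⟨f, hf⟩ := LinearMap.exists_extend
      ((LinearMap.snd F (X.V i) (Y.V i)) ∘ₗ (W i).subtype ∘ₗ s)
    refine ⟨f, fun a ha => ?_⟩
    have h1 : f a = (s ⟨a, ha⟩ : X.V i × Y.V i).2 := LinearMap.congr_fun hf ⟨a, ha⟩
    have h2 : (s ⟨a, ha⟩ : X.V i × Y.V i).1 = a :=
      congrArg Subtype.val (LinearMap.congr_fun hs ⟨a, ha⟩)
    have : (a, f a) = (s ⟨a, ha⟩ : X.V i × Y.V i) := Prod.ext h2.symm h1
    rw [this]
    exact (s ⟨a, ha⟩).2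
  choose f hf using key
  refine ⟨f, funext fun i => ?_⟩
  ext ⟨a, b⟩
  rw [mem_sheared]
  have hab : (a, b) = (a, f i a) + (0, b - f i a) := by simp
  constructor
  · rintro ⟨ha, hb⟩
    rw [hab]
    exact add_mem (hf i a ha) hb
  · intro h
    have ha : a ∈ grFst W i := ⟨(a, b), h, rfl⟩
    refine ⟨ha, ?_⟩
    change (0, b - f i a) ∈ W i
    have := sub_mem h (hf i a ha)
    simpa using this

/-- The reduction of a family of linear maps relative to two graded subspaces. -/
def redL (U' : Gr X) (U'' : Gr Y) : L X Y →+ ∀ i, U' i →ₗ[F] Y.V i ⧸ U'' i where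
  toFun f i := (U'' i).mkQ ∘ₗ f i ∘ₗ (U' i).subtype
  map_zero' := by funext i; ext; simp
  map_add' f g := by funext i; ext; simp

theorem redL_surjective (U' : Gr X) (U'' : Gr Y) : Function.Surjective (redL U' U'') := by
  intro c
  have key : ∀ i, ∃ f : X.V i →ₗ[F] Y.V i, (U'' i).mkQ ∘ₗ f ∘ₗ (U' i).subtype = c i := by
    intro i
    obtain ⟨s, hs⟩ := (U'' i).mkQ.exists_rightInverse_of_surjective (Submodule.range_mkQ _)
    obtain ⟨f, hf⟩ := LinearMap.exists_extend (s ∘ₗ c i)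
    refine ⟨f, ?_⟩
    rw [hf, ← LinearMap.comp_assoc, hs, LinearMap.id_comp]
  choose f hf using key
  exact ⟨f, funext hf⟩

theorem sheared_eq_iff (f f' : L X Y) (U' : Gr X) (U'' : Gr Y) :
    sheared f U' U'' = sheared f' U' U'' ↔ redL U' U'' f = redL U' U'' f' := by
  have h1 : redL U' U'' f = redL U' U'' f' ↔ ∀ i, ∀ a ∈ U' i, f i a - f' i a ∈ U'' i := by
    constructor
    · intro h i a ha
      rw [← Submodule.Quotient.eq]
      exact LinearMap.congr_fun (congrFun h i) ⟨a, ha⟩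
    · intro h
      funext i
      ext ⟨a, ha⟩
      exact (Submodule.Quotient.eq _).2 (h i a ha)
  rw [h1]
  constructor
  · intro h i a ha
    have : (a, f i a) ∈ sheared f' U' U'' i := by
      rw [← h]; exact mem_sheared.2 ⟨ha, by simp⟩
    exact (mem_sheared.1 this).2
  · intro h
    funext i
    ext ⟨a, b⟩
    rw [mem_sheared, mem_sheared]
    refine and_congr_right fun ha => ?_
    have e1 : b - f' i a = (b - f i a) + (f i a - f' i a) := by abel
    simp only
    rw [e1, Submodule.add_mem_iff_left _ (h i a ha)]

/-- The number of reductions of families of linear maps. -/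
noncomputable def redCard (U' : Gr X) (U'' : Gr Y) : ℂ :=
  q F ^ ∑ i, Module.finrank F (U' i) * Module.finrank F (Y.V i ⧸ U'' i)

open scoped Classical in
theorem redCard_mul_card_sheared (W : ∀ i, Submodule F (X.V i × Y.V i)) :
    redCard (grFst W) (grSnd W) *
      ∑ f : L X Y, (if sheared f (grFst W) (grSnd W) = W then (1 : ℂ) else 0) = q F ^ G X Y := by
  obtain ⟨f₀, hf₀⟩ := exists_sheared W
  have hfin : Finite (∀ i, grFst W i →ₗ[F] Y.V i ⧸ grSnd W i) := Module.finite_of_finite F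
  let _ : Fintype (∀ i, grFst W i →ₗ[F] Y.V i ⧸ grSnd W i) := Fintype.ofFinite _
  obtain ⟨K, hK, hK'⟩ := exists_fiber_card _ (redL_surjective (grFst W) (grSnd W))
  have h1 : ∀ f : L X Y, (if sheared f (grFst W) (grSnd W) = W then (1 : ℂ) else 0) =
      if redL (grFst W) (grSnd W) f = redL (grFst W) (grSnd W) f₀ then 1 else 0 := by
    intro f
    refine if_congr ?_ rfl rfl
    rw [← sheared_eq_iff, hf₀]
  rw [Finset.sum_congr rfl fun f _ => h1 f,
    hK fun c => if c = redL (grFst W) (grSnd W) f₀ then 1 else 0, Finset.sum_ite_eq',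
    if_pos (Finset.mem_univ _), mul_one, ← card_L, ← hK',
    card_eq_q_pow (F := F), Module.finrank_pi_fintype, mul_comm]
  unfold redCard
  rw [Finset.sum_congr rfl fun i _ => Module.finrank_linearMap F F (grFst W i) (Y.V i ⧸ grSnd W i)]

theorem sum_sheared (H : (∀ i, Submodule F (X.V i × Y.V i)) → ℂ)
    [Fintype (∀ i, Submodule F (X.V i × Y.V i))] :
    q F ^ G X Y * ∑ W, H W =
      ∑ U' : Gr X, ∑ U'' : Gr Y, redCard U' U'' * ∑ f : L X Y, H (sheared f U' U'') := by
  classical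
  have h1 : ∀ (U' : Gr X) (U'' : Gr Y) (f : L X Y), H (sheared f U' U'') =
      ∑ W, if sheared f U' U'' = W then H W else 0 := fun U' U'' f => by
    rw [Finset.sum_ite_eq, if_pos (Finset.mem_univ _)]
  have h2 : ∀ (U' : Gr X) (U'' : Gr Y), redCard U' U'' * ∑ f : L X Y, H (sheared f U' U'') =
      ∑ W, H W * (redCard U' U'' * ∑ f : L X Y, if sheared f U' U'' = W then (1 : ℂ) else 0) := by
    intro U' U''
    simp_rw [h1, Finset.mul_sum]
    rw [Finset.sum_comm]
    refine Finset.sum_congr rfl fun W _ => Finset.sum_congr rfl fun f _ => ?_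
    split_ifs <;> ring
  simp_rw [h2]
  rw [Finset.sum_congr rfl fun U' _ => Finset.sum_comm, Finset.sum_comm, Finset.mul_sum]
  refine Finset.sum_congr rfl fun W _ => ?_
  simp_rw [← Finset.mul_sum]
  rw [mul_comm]
  congr 1
  rw [Finset.sum_eq_single (grFst W), Finset.sum_eq_single (grSnd W), redCard_mul_card_sheared]
  · intro U'' _ hne
    rw [Finset.sum_eq_zero, mul_zero]
    intro f _
    refine if_neg fun h => hne ?_
    rw [← h, grSnd_sheared]
  · exact fun h => absurd (Finset.mem_univ _) h
  · intro U' _ hne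
    refine Finset.sum_eq_zero fun U'' _ => ?_
    rw [Finset.sum_eq_zero, mul_zero]
    intro f _
    refine if_neg fun h => hne ?_
    rw [← h, grFst_sheared]
  · exact fun h => absurd (Finset.mem_univ _) h

/-- The coboundary of a family of linear maps. -/
def cobdry (f : L X Y) : E X Y := fun i => Y.x i ∘ₗ f i - f (i + 1) ∘ₗ X.x i

theorem sum_cvTerm_sheared {f₁ f₂ : QRep F r → ℂ} (h₁ : ClassFun f₁) (h₂ : ClassFun f₂)
    (f : L X Y) (U' : Gr X) (U'' : Gr Y) :
    ∑ η : E X Y, cvTerm f₁ f₂ (ext X Y η) (sheared f U' U'') =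
      ∑ η : E X Y, cvTerm f₁ f₂ (ext X Y η) (fun i => (U' i).prod (U'' i)) := by
  refine Fintype.sum_equiv (Equiv.addRight (cobdry f)) _ _ fun η => ?_
  symm
  exact cvTerm_map h₁ h₂ (extShear (η + cobdry f) η f fun i a => by simp [cobdry])
    (fun i => (U' i).prod (U'' i))

end product

section product

variable {X Y : QRep F r}

/-! ### Extensions compatible with subrepresentations -/

/-- Cocycles mapping a subrepresentation of `X` into a subrepresentation of `Y`. -/
def compat (W' : Sb X) (W'' : Sb Y) : Submodule F (E X Y) where
  carrier := {η | ∀ i, ∀ a ∈ W'.U i, η i a ∈ W''.U (i + 1)}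
  add_mem' := fun h h' i a ha => add_mem (h i a ha) (h' i a ha)
  zero_mem' := fun _ _ _ => zero_mem _
  smul_mem' := fun c _ h i a ha => Submodule.smul_mem _ c (h i a ha)

/-- The subrepresentation of an extension given by a compatible cocycle. -/
def prodSb {W' : Sb X} {W'' : Sb Y} (η : compat W' W'') : Sb (ext X Y η.1) where
  U i := (W'.U i).prod (W''.U i)
  st i _ hu := ⟨W'.st i _ hu.1, add_mem (η.2 i _ hu.1) (W''.st i _ hu.2)⟩

theorem st_prod_iff (η : E X Y) (U' : Gr X) (U'' : Gr Y) :
    (ext X Y η).St (fun i => (U' i).prod (U'' i)) ↔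
      X.St U' ∧ Y.St U'' ∧ ∀ i, ∀ a ∈ U' i, η i a ∈ U'' (i + 1) := by
  constructor
  · intro h
    refine ⟨fun i a ha => ?_, fun i b hb => ?_, fun i a ha => ?_⟩
    · exact (h i (a, 0) ⟨ha, zero_mem _⟩).1
    · have := (h i (0, b) ⟨zero_mem _, hb⟩).2
      simpa using this
    · have := (h i (a, 0) ⟨ha, zero_mem _⟩).2
      simpa using this
  · rintro ⟨h1, h2, h3⟩ i ⟨a, b⟩ ⟨ha, hb⟩
    exact ⟨h1 i a ha, add_mem (h3 i a ha) (h2 i b hb)⟩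

/-- The cocycles induced on subrepresentations and on quotients. -/
def inducedE (W' : Sb X) (W'' : Sb Y) :
    compat W' W'' →+ E (X.quo W') (Y.quo W'') × E (X.sub W') (Y.sub W'') where
  toFun η := (fun i => (W'.U i).mapQ (W''.U (i + 1)) (η.1 i) (η.2 i),
    fun i => (η.1 i).restrict (η.2 i))
  map_zero' := by
    refine Prod.ext ?_ ?_
    · funext i; ext a; rfl
    · funext i; ext a; rfl
  map_add' η η' := by
    refine Prod.ext ?_ ?_
    · funext i; ext a; rfl
    · funext i; ext a; rfl

theorem inducedE_surjective (W' : Sb X) (W'' : Sb Y) :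
    Function.Surjective (inducedE W' W'') := by
  rintro ⟨c₂, c₁⟩
  have key : ∀ i, ∃ f : X.V i →ₗ[F] Y.V (i + 1), (∀ a : W'.U i, f a = c₁ i a) ∧
      ∀ a, (W''.U (i + 1)).mkQ (f a) = c₂ i ((W'.U i).mkQ a) := by
    intro i
    obtain ⟨p, hp⟩ := (W'.U i).subtype.exists_leftInverse_of_injective (Submodule.ker_subtype _)
    obtain ⟨s, hs⟩ := (W''.U (i + 1)).mkQ.exists_rightInverse_of_surjective
      (Submodule.range_mkQ _)
    refine ⟨(W''.U (i + 1)).subtype ∘ₗ c₁ i ∘ₗ p + s ∘ₗ c₂ i ∘ₗ (W'.U i).mkQ,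
      fun a => ?_, fun a => ?_⟩
    · have h1 : p a = a := LinearMap.congr_fun hp a
      have h2 : (W'.U i).mkQ (a : X.V i) = 0 := (Submodule.Quotient.mk_eq_zero _).2 a.2
      simp only [LinearMap.add_apply, LinearMap.comp_apply, h1, h2, map_zero, add_zero]
      rfl
    · have h1 : (W''.U (i + 1)).mkQ ((W''.U (i + 1)).subtype (c₁ i (p a))) = 0 :=
        (Submodule.Quotient.mk_eq_zero _).2 (c₁ i (p a)).2
      have h2 := LinearMap.congr_fun hs (c₂ i ((W'.U i).mkQ a))
      simp only [LinearMap.add_apply, LinearMap.comp_apply, map_add, h1, zero_add]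
      exact h2
  choose f hf1 hf2 using key
  refine ⟨⟨f, fun i a ha => ?_⟩, Prod.ext ?_ ?_⟩
  · rw [hf1 i ⟨a, ha⟩]
    exact (c₁ i ⟨a, ha⟩).2
  · funext i
    refine LinearMap.ext fun a => ?_
    obtain ⟨a, rfl⟩ := Submodule.mkQ_surjective _ a
    exact hf2 i a
  · funext i
    refine LinearMap.ext fun a => ?_
    exact Subtype.ext (hf1 i a)

/-- The subrepresentation of an extension given by a compatible cocycle is an extension. -/
noncomputable def prodSubIso {W' : Sb X} {W'' : Sb Y} (η : compat W' W'') :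
    Iso (ext (X.sub W') (Y.sub W'') (inducedE W' W'' η).2) ((ext X Y η.1).sub (prodSb η)) :=
  isoOfBijective (fun i => LinearMap.codRestrict ((W'.U i).prod (W''.U i))
      ((W'.U i).subtype.prodMap (W''.U i).subtype) fun p => ⟨p.1.2, p.2.2⟩)
    (fun i p => Subtype.ext rfl)
    (fun i => ⟨fun p p' h => by
        have h := congrArg Subtype.val h
        exact Prod.ext (Subtype.ext (congrArg Prod.fst h)) (Subtype.ext (congrArg Prod.snd h)),
      fun p => ⟨(⟨p.1.1, p.2.1⟩, ⟨p.1.2, p.2.2⟩), rfl⟩⟩)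

/-- The quotient of an extension given by a compatible cocycle is an extension. -/
noncomputable def prodQuoIso {W' : Sb X} {W'' : Sb Y} (η : compat W' W'') :
    Iso ((ext X Y η.1).quo (prodSb η)) (ext (X.quo W') (Y.quo W'') (inducedE W' W'' η).1) :=
  isoOfBijective (fun i => ((W'.U i).prod (W''.U i)).liftQ
      ((W'.U i).mkQ.prodMap (W''.U i).mkQ) fun p hp =>
        Prod.ext ((Submodule.Quotient.mk_eq_zero _).2 hp.1)
          ((Submodule.Quotient.mk_eq_zero _).2 hp.2))
    (fun i p => by
      obtain ⟨p, rfl⟩ := Submodule.mkQ_surjective _ p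
      rfl)
    (fun i => ⟨LinearMap.ker_eq_bot.1 <| Submodule.ker_liftQ_eq_bot _ _ _ fun p hp =>
        ⟨(Submodule.Quotient.mk_eq_zero _).1 (congrArg Prod.fst (LinearMap.mem_ker.1 hp)),
          (Submodule.Quotient.mk_eq_zero _).1 (congrArg Prod.snd (LinearMap.mem_ker.1 hp))⟩,
      fun p => by
        obtain ⟨a, ha⟩ := Submodule.mkQ_surjective _ p.1
        obtain ⟨b, hb⟩ := Submodule.mkQ_surjective _ p.2
        exact ⟨Submodule.Quotient.mk (a, b), Prod.ext ha hb⟩⟩)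

/-- The obstruction of a cocycle to being compatible. -/
def obstr (W' : Sb X) (W'' : Sb Y) : E X Y →+ E (X.sub W') (Y.quo W'') where
  toFun η i := (W''.U (i + 1)).mkQ ∘ₗ η i ∘ₗ (W'.U i).subtype
  map_zero' := by funext i; ext; simp
  map_add' f g := by funext i; ext; simp

theorem obstr_surjective (W' : Sb X) (W'' : Sb Y) : Function.Surjective (obstr W' W'') := by
  intro c
  have key : ∀ i, ∃ f : X.V i →ₗ[F] Y.V (i + 1),
      (W''.U (i + 1)).mkQ ∘ₗ f ∘ₗ (W'.U i).subtype = c i := by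
    intro i
    obtain ⟨s, hs⟩ := (W''.U (i + 1)).mkQ.exists_rightInverse_of_surjective
      (Submodule.range_mkQ _)
    obtain ⟨f, hf⟩ := LinearMap.exists_extend (s ∘ₗ c i)
    refine ⟨f, ?_⟩
    rw [hf, ← LinearMap.comp_assoc, hs, LinearMap.id_comp]
  choose f hf using key
  exact ⟨f, funext hf⟩

theorem mem_compat_iff (W' : Sb X) (W'' : Sb Y) (η : E X Y) :
    η ∈ compat W' W'' ↔ obstr W' W'' η = 0 := by
  constructor
  · intro h
    funext i
    ext ⟨a, ha⟩
    exact (Submodule.Quotient.mk_eq_zero _).2 (h i a ha)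
  · intro h i a ha
    exact (Submodule.Quotient.mk_eq_zero _).1 (LinearMap.congr_fun (congrFun h i) ⟨a, ha⟩)

noncomputable instance fintype_compat (W' : Sb X) (W'' : Sb Y) : Fintype (compat W' W'') :=
  Fintype.ofFinite _

theorem card_compat (W' : Sb X) (W'' : Sb Y) :
    (Fintype.card (compat W' W'') : ℂ) * Fintype.card (E (X.sub W') (Y.quo W'')) =
      Fintype.card (E X Y) := by
  classical
  obtain ⟨K, hK, hK'⟩ := exists_fiber_card _ (obstr_surjective W' W'')
  rw [← hK']
  congr 1
  have h := hK fun c => if c = 0 then 1 else 0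
  rw [Finset.sum_ite_eq', if_pos (Finset.mem_univ _), mul_one] at h
  rw [← h, Finset.sum_boole, Fintype.card_subtype]
  simp_rw [mem_compat_iff]

theorem dim_sub_add_dim_quo (A : QRep F r) (W : Sb A) (i : ZMod r) :
    (A.sub W).dim i + (A.quo W).dim i = A.dim i := by
  rw [add_comm]
  exact Submodule.finrank_quotient_add_finrank (W.U i)

theorem sum_inducedE (W' : Sb X) (W'' : Sb Y)
    (w : E (X.quo W') (Y.quo W'') × E (X.sub W') (Y.sub W'') → ℂ) :
    ∑ η, w (inducedE W' W'' η) =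
      q F ^ (∑ i, (X.quo W').dim i * (Y.sub W'').dim (i + 1)) * ∑ c, w c := by
  obtain ⟨K, hK, hK'⟩ := exists_fiber_card _ (inducedE_surjective W' W'')
  rw [hK]
  congr 1
  have h := card_compat W' W''
  rw [← hK', Fintype.card_prod, Nat.cast_mul, card_E, card_E, card_E, card_E] at h
  have hne : q F ^ (∑ i, (X.quo W').dim i * (Y.quo W'').dim (i + 1)) *
      q F ^ (∑ i, (X.sub W').dim i * (Y.sub W'').dim (i + 1)) *
      q F ^ (∑ i, (X.sub W').dim i * (Y.quo W'').dim (i + 1)) ≠ 0 := by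
    simp [q_ne_zero]
  apply mul_right_cancel₀ hne
  rw [← mul_assoc, ← mul_assoc, ← mul_assoc, ← mul_assoc] at *
  rw [h]
  simp only [← pow_add, ← Finset.sum_add_distrib]
  congr 1
  refine Finset.sum_congr rfl fun i _ => ?_
  rw [← dim_sub_add_dim_quo X W' i, ← dim_sub_add_dim_quo Y W'' (i + 1)]
  ring

theorem sum_subtype_eq_sum_dite {α : Type*} [Fintype α] (p : α → Prop) [Fintype (Subtype p)]
    [DecidablePred p] (f : Subtype p → ℂ) :
    ∑ a, f a = ∑ a, if h : p a then f ⟨a, h⟩ else 0 := by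
  rw [← Finset.sum_filter_add_sum_filter_not Finset.univ p]
  have h2 : ∑ a with ¬ p a, (if h : p a then f ⟨a, h⟩ else 0) = 0 :=
    Finset.sum_eq_zero fun a ha => dif_neg (Finset.mem_filter.1 ha).2
  rw [h2, add_zero]
  refine Finset.sum_bij (fun a _ => a.1) (fun a _ => ?_) (fun a _ a' _ h => Subtype.ext h)
    (fun a ha => ⟨⟨a, (Finset.mem_filter.1 ha).2⟩, Finset.mem_univ _, rfl⟩) (fun a _ => ?_)
  · exact Finset.mem_filter.2 ⟨Finset.mem_univ _, a.2⟩
  · simp only [dif_pos a.2]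

theorem sum_cvTerm_prod {f₁ f₂ : QRep F r → ℂ} (h₁ : ClassFun f₁) (h₂ : ClassFun f₂)
    (W' : Sb X) (W'' : Sb Y) :
    ∑ η : E X Y, cvTerm f₁ f₂ (ext X Y η) (fun i => (W'.U i).prod (W''.U i)) =
      q F ^ (∑ i, (X.quo W').dim i * (Y.sub W'').dim (i + 1)) *
        (Rs f₁ (X.quo W') (Y.quo W'') * Rs f₂ (X.sub W') (Y.sub W'')) := by
  classical
  have h := sum_inducedE W' W'' fun c =>
    f₁ (ext (X.quo W') (Y.quo W'') c.1) * f₂ (ext (X.sub W') (Y.sub W'') c.2)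
  rw [Fintype.sum_prod_type] at h
  simp only [← Fintype.sum_mul_sum] at h
  unfold Rs
  rw [← h, sum_subtype_eq_sum_dite (fun η => η ∈ compat W' W'')]
  refine Finset.sum_congr rfl fun η _ => ?_
  by_cases hη : η ∈ compat W' W''
  · have hst := (st_prod_iff η W'.U W''.U).2 ⟨W'.st, W''.st, hη⟩
    unfold cvTerm
    rw [dif_pos hst, dif_pos hη, ← h₁ _ _ (prodQuoIso ⟨η, hη⟩), h₂ _ _ (prodSubIso ⟨η, hη⟩)]
    rfl
  · unfold cvTerm
    rw [dif_neg hη, dif_neg]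
    exact fun hst => hη ((st_prod_iff η W'.U W''.U).1 hst).2.2

theorem rs_cv {f₁ f₂ : QRep F r → ℂ} (h₁ : ClassFun f₁) (h₂ : ClassFun f₂) (X Y : QRep F r) :
    Rs (cv f₁ f₂) X Y = ∑ W' : Sb X, ∑ W'' : Sb Y,
      q F ^ G (X.sub W') (Y.quo W'') *
        (q F ^ (∑ i, (X.quo W').dim i * (Y.sub W'').dim (i + 1)) *
          (Rs f₁ (X.quo W') (Y.quo W'') * Rs f₂ (X.sub W') (Y.sub W''))) := by
  classical
  apply mul_left_cancel₀ (pow_ne_zero (G X Y) (q_ne_zero (F := F)))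
  unfold Rs
  simp_rw [cv_eq_sum]
  rw [Finset.mul_sum]
  rw [Finset.sum_congr rfl fun η _ => @sum_sheared F _ _ r _ X Y (cvTerm f₁ f₂ (ext X Y η))
      (fintype_Gr (ext X Y η)),
    Finset.sum_comm, sum_Sb, Finset.mul_sum]
  refine Finset.sum_congr rfl fun U' _ => ?_
  rw [Finset.sum_comm]
  have key : ∀ U'' : Gr Y, ∑ η : E X Y, redCard U' U'' *
      ∑ f : L X Y, cvTerm f₁ f₂ (ext X Y η) (sheared f U' U'') = q F ^ G X Y * (redCard U' U'' *
        ∑ η : E X Y, cvTerm f₁ f₂ (ext X Y η) (fun i => (U' i).prod (U'' i))) := by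
    intro U''
    rw [← Finset.mul_sum, Finset.sum_comm,
      Finset.sum_congr rfl fun f _ => sum_cvTerm_sheared h₁ h₂ f U' U'', Finset.sum_const,
      Finset.card_univ, nsmul_eq_mul, card_L]
    ring
  rw [Finset.sum_congr rfl fun U'' _ => key U'', ← Finset.mul_sum]
  congr 1
  by_cases hU' : X.St U'
  · rw [dif_pos hU', sum_Sb]
    refine Finset.sum_congr rfl fun U'' _ => ?_
    by_cases hU'' : Y.St U''
    · rw [dif_pos hU'']
      exact congrArg (redCard U' U'' * ·) (sum_cvTerm_prod h₁ h₂ ⟨U', hU'⟩ ⟨U'', hU''⟩)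
    · rw [dif_neg hU'', Finset.sum_eq_zero, mul_zero]
      exact fun η _ => dif_neg fun h => hU'' ((st_prod_iff η U' U'').1 h).2.1
  · rw [dif_neg hU']
    refine Finset.sum_eq_zero fun U'' _ => ?_
    rw [Finset.sum_eq_zero, mul_zero]
    exact fun η _ => dif_neg fun h => hU' ((st_prod_iff η U' U'').1 h).1

end product

/-! ### Primitive functions from grouplike functions -/

/-- The zero subrepresentation. -/
def botSb (A : QRep F r) : Sb A := ⟨fun _ => ⊥, fun i u hu => by
  rw [Submodule.mem_bot] at hu ⊢
  rw [hu, map_zero]⟩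

/-- The full subrepresentation. -/
def topSb (A : QRep F r) : Sb A := ⟨fun _ => ⊤, fun _ _ _ => Submodule.mem_top⟩

/-- The full subrepresentation is isomorphic to the whole representation. -/
noncomputable def subTopIso (A : QRep F r) : Iso (A.sub A.topSb) A :=
  isoOfBijective _ (A.subtype_mem_hom _)
    fun _ => ⟨Subtype.val_injective, fun a => ⟨⟨a, Submodule.mem_top⟩, rfl⟩⟩

/-- The quotient by the zero subrepresentation is isomorphic to the whole representation. -/
noncomputable def quoBotIso (A : QRep F r) : Iso A (A.quo A.botSb) :=
  isoOfBijective _ (A.mkQ_mem_hom _)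
    fun _ => ⟨LinearMap.ker_eq_bot.1 (Submodule.ker_mkQ _), Submodule.mkQ_surjective _⟩

theorem tdim_sub_add_tdim_quo (A : QRep F r) (W : Sb A) :
    (A.sub W).tdim + (A.quo W).tdim = A.tdim := by
  simp only [tdim, ← Finset.sum_add_distrib, dim_sub_add_dim_quo]

theorem tdim_quo_top (A : QRep F r) : (A.quo A.topSb).tdim = 0 := by
  have := A.tdim_sub_add_tdim_quo A.topSb
  have := A.subTopIso.tdim_eq
  omega

theorem tdim_sub_bot (A : QRep F r) : (A.sub A.botSb).tdim = 0 := by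
  have := A.tdim_sub_add_tdim_quo A.botSb
  have := A.quoBotIso.tdim_eq
  omega

theorem eq_botSb {A : QRep F r} {W : Sb A} (h : (A.sub W).tdim = 0) : W = A.botSb := by
  refine Sb.ext (funext fun i => ?_)
  exact Submodule.finrank_eq_zero.1 (dim_eq_zero h i)

theorem eq_topSb {A : QRep F r} {W : Sb A} (h : (A.quo W).tdim = 0) : W = A.topSb := by
  refine Sb.ext (funext fun i => Submodule.eq_top_of_finrank_eq ?_)
  have h1 := Submodule.finrank_quotient_add_finrank (W.U i)
  have h2 : Module.finrank F (A.V i ⧸ W.U i) = 0 := dim_eq_zero h i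
  omega

theorem G_sub_add_G_quo_right (X Y : QRep F r) (W : Sb Y) :
    G X (Y.sub W) + G X (Y.quo W) = G X Y := by
  simp only [G, ← Finset.sum_add_distrib, ← mul_add, dim_sub_add_dim_quo]

theorem G_sub_add_G_quo_left (X Y : QRep F r) (W : Sb X) :
    G (X.sub W) Y + G (X.quo W) Y = G X Y := by
  simp only [G, ← Finset.sum_add_distrib, ← add_mul, dim_sub_add_dim_quo]

theorem Const.sum_dim_mul {X : QRep F r} (h : X.Const) (Y : QRep F r) :
    ∑ i, X.dim i * Y.dim (i + 1) = G X Y := by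
  obtain ⟨n, hn⟩ := h
  simp only [G, hn, ← Finset.mul_sum]
  congr 1
  exact Equiv.sum_comp (Equiv.addRight (1 : ZMod r)) Y.dim

theorem Iso.G_left {X X' : QRep F r} (φ : Iso X X') (Y : QRep F r) : G X Y = G X' Y := by
  simp only [G, φ.dim_eq]

theorem Iso.G_right {Y Y' : QRep F r} (φ : Iso Y Y') (X : QRep F r) : G X Y = G X Y' := by
  simp only [G, φ.dim_eq]

theorem rs_eq_zero_of_cv {c x : QRep F r → ℂ} (hcl : ClassFun c) (hxl : ClassFun x)
    (hc : ∀ X Y : QRep F r, X.Nil → Y.Nil → Rs c X Y = q F ^ G X Y * c X * c Y)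
    (hc0 : ∀ A : QRep F r, A.tdim = 0 → c A = 1)
    (hx0 : ∀ A : QRep F r, A.tdim = 0 → x A = 0)
    (hxc : ∀ A : QRep F r, ¬ A.Const → x A = 0)
    (hcv : ∀ A : QRep F r, A.Nil → cv x c A = A.dim 0 * c A)
    (X Y : QRep F r) (hX : X.Nil) (hY : Y.Nil) (hX0 : X.tdim ≠ 0) (hY0 : Y.tdim ≠ 0) :
    Rs x X Y = 0 := by
  classical
  induction hn : X.tdim + Y.tdim using Nat.strong_induction_on generalizing X Y with
  | _ n ih =>
  subst hn
  have hL : Rs (cv x c) X Y =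
      q F ^ G X Y * c X * (Y.dim 0 * c Y) + q F ^ G X Y * (X.dim 0 * c X) * c Y := by
    have h1 : ∀ η : E X Y, cv x c (ext X Y η) = (X.dim 0 + Y.dim 0) * c (ext X Y η) := by
      intro η
      rw [hcv _ (hX.ext hY η), dim_ext]
      simp
    have h2 : Rs (cv x c) X Y = (X.dim 0 + Y.dim 0) * Rs c X Y := by
      unfold Rs
      rw [Finset.mul_sum]
      exact Finset.sum_congr rfl fun η _ => h1 η
    rw [h2, hc X Y hX hY]
    ring
  rw [rs_cv hxl hcl] at hL
  set t : Sb X → Sb Y → ℂ := fun W' W'' => q F ^ G (X.sub W') (Y.quo W'') *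
        (q F ^ (∑ i, (X.quo W').dim i * (Y.sub W'').dim (i + 1)) *
          (Rs x (X.quo W') (Y.quo W'') * Rs c (X.sub W') (Y.sub W''))) with ht
  have htop : ∀ W'', t X.topSb W'' = q F ^ G X Y * c X * (x (Y.quo W'') * c (Y.sub W'')) := by
    intro W''
    simp only [ht]
    rw [hxl.rs_zero_left X.tdim_quo_top, hc _ _ (hX.sub _) (hY.sub _),
      X.subTopIso.G_left, X.subTopIso.G_left, hcl _ _ X.subTopIso,
      ← G_sub_add_G_quo_right X Y W'', pow_add,
      Finset.sum_eq_zero fun i _ => by rw [dim_eq_zero X.tdim_quo_top, zero_mul]]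
    ring
  have htop' : ∀ W', t W' Y.topSb = (x (X.quo W') * c (X.sub W')) * (q F ^ G X Y * c Y) := by
    intro W'
    simp only [ht]
    rw [hxl.rs_zero_right Y.tdim_quo_top]
    by_cases hW : (X.quo W').Const
    · rw [hW.sum_dim_mul, hc _ _ (hX.sub _) (hY.sub _),
        Y.subTopIso.G_right, Y.subTopIso.G_right, hcl _ _ Y.subTopIso,
        ← G_sub_add_G_quo_left X Y W', pow_add, G_eq_zero_right Y.tdim_quo_top]
      ring
    · rw [hxc _ hW]
      ring
  have hbot : t X.botSb Y.botSb = Rs x X Y := by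
    simp only [ht]
    rw [G_eq_zero_left X.tdim_sub_bot, ← hxl.rs_congr X.quoBotIso Y.quoBotIso,
      hcl.rs_zero_left X.tdim_sub_bot, hc0 _ Y.tdim_sub_bot,
      Finset.sum_eq_zero fun i _ => by rw [dim_eq_zero Y.tdim_sub_bot, mul_zero]]
    ring
  have hne : X.topSb ≠ X.botSb := fun h => hX0 (by
    rw [← X.subTopIso.tdim_eq, h, X.tdim_sub_bot])
  have hne' : Y.topSb ≠ Y.botSb := fun h => hY0 (by
    rw [← Y.subTopIso.tdim_eq, h, Y.tdim_sub_bot])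
  have htt : t X.topSb Y.topSb = 0 := by
    rw [htop, hx0 _ Y.tdim_quo_top]
    ring
  have hsplit : ∀ W' W'', t W' W'' = (if W' = X.topSb then t X.topSb W'' else 0) +
      (if W'' = Y.topSb then t W' Y.topSb else 0) +
      (if W' = X.botSb then if W'' = Y.botSb then t X.botSb Y.botSb else 0 else 0) := by
    intro W' W''
    by_cases h1 : W' = X.topSb
    · subst h1
      rw [if_pos rfl, if_neg hne]
      by_cases h2 : W'' = Y.topSb
      · rw [h2, if_pos rfl, htt]; ring
      · rw [if_neg h2]; ring
    · rw [if_neg h1]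
      by_cases h2 : W'' = Y.topSb
      · subst h2
        rw [if_pos rfl, if_neg hne']
        simp
      · rw [if_neg h2]
        by_cases h3 : W' = X.botSb ∧ W'' = Y.botSb
        · rw [h3.1, h3.2, if_pos rfl, if_pos rfl]; ring
        · have h4 : (if W' = X.botSb then if W'' = Y.botSb then t X.botSb Y.botSb else 0
              else 0) = 0 := by
            split_ifs with h5 h6
            · exact absurd ⟨h5, h6⟩ h3
            · rfl
            · rfl
          rw [h4]
          have e1 := X.tdim_sub_add_tdim_quo W'
          have e2 := Y.tdim_sub_add_tdim_quo W''
          have e3 : ¬ ((X.sub W').tdim = 0 ∧ (Y.sub W'').tdim = 0) :=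
            fun h => h3 ⟨eq_botSb h.1, eq_botSb h.2⟩
          have h5 : Rs x (X.quo W') (Y.quo W'') = 0 :=
            ih _ (by omega) _ _ (hX.quo _) (hY.quo _) (fun h => h1 (eq_topSb h))
              (fun h => h2 (eq_topSb h)) rfl
          simp only [ht, h5]
          ring
  have hsum : ∑ W', ∑ W'', t W' W'' =
      ∑ W'', t X.topSb W'' + ∑ W', t W' Y.topSb + t X.botSb Y.botSb := by
    rw [Finset.sum_congr rfl fun W' _ => Finset.sum_congr rfl fun W'' _ => hsplit W' W'']
    simp only [Finset.sum_add_distrib]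
    congr 1
    · congr 1
      · rw [Finset.sum_comm]
        simp
      · simp
    · rw [Finset.sum_eq_single X.botSb]
      · simp
      · intro W' _ h
        simp [h]
      · simp
  rw [hsum, hbot, Finset.sum_congr rfl fun W'' _ => htop W'', ← Finset.mul_sum,
    Finset.sum_congr rfl fun W' _ => htop' W', ← Finset.sum_mul] at hL
  have e1 := hcv X hX
  have e2 := hcv Y hY
  unfold cv at e1 e2
  rw [e1, e2] at hL
  linear_combination hL

/-! ### Counting short exact sequences -/

instance finite_Iso (A B : QRep F r) : Finite (Iso A B) :=
  Finite.of_injective (fun φ : Iso A B => (fun i => (φ.toFun i).toLinearMap : L A B))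
    fun _ _ h => Iso.ext (funext fun i => LinearEquiv.toLinearMap_injective (congrFun h i))

theorem autCard_ne_zero (A : QRep F r) : A.autCard ≠ 0 :=
  have : Nonempty (Iso A A) := ⟨Iso.refl A⟩
  Nat.card_pos.ne'

open scoped Classical in
theorem card_iso_left (A B : QRep F r) :
    Nat.card (Iso A B) = if Nonempty (Iso A B) then A.autCard else 0 := by
  split_ifs with h
  · obtain ⟨φ⟩ := h
    exact Nat.card_congr ((Iso.refl A).congr φ.symm)
  · have := not_nonempty_iff.1 h
    exact Nat.card_of_isEmpty

open scoped Classical in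
theorem card_iso_right (A B : QRep F r) :
    Nat.card (Iso A B) = if Nonempty (Iso A B) then B.autCard else 0 := by
  split_ifs with h
  · obtain ⟨φ⟩ := h
    exact Nat.card_congr (φ.congr (Iso.refl B))
  · have := not_nonempty_iff.1 h
    exact Nat.card_of_isEmpty

section shortExact

variable {X Y M : QRep F r}

theorem exists_iso_ext (W : Sb M) (α : Iso Y (M.sub W)) (β : Iso (M.quo W) X) (S : L X M)
    (hS : ∀ i a, β.toFun i ((W.U i).mkQ (S i a)) = a) :
    ∃ (η : E X Y) (φ : Iso (ext X Y η) M),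
      ∀ i (p : X.V i × Y.V i), φ.toFun i p = S i p.1 + (α.toFun i p.2 : M.V i) := by
  have hmem : ∀ i a, (M.x i ∘ₗ S i - S (i + 1) ∘ₗ X.x i) a ∈ W.U (i + 1) := by
    intro i a
    rw [← Submodule.Quotient.mk_eq_zero]
    apply (β.toFun (i + 1)).injective
    rw [map_zero]
    have h1 := β.comm i ((W.U i).mkQ (S i a))
    rw [hS] at h1
    have h2 := hS (i + 1) (X.x i a)
    have h3 : (Submodule.Quotient.mk ((M.x i ∘ₗ S i - S (i + 1) ∘ₗ X.x i) a) :
        M.V (i + 1) ⧸ W.U (i + 1)) = (M.quo W).x i ((W.U i).mkQ (S i a)) -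
          (W.U (i + 1)).mkQ (S (i + 1) (X.x i a)) := rfl
    rw [h3, map_sub, h1, h2, sub_self]
  let η : E X Y := fun i => (α.toFun (i + 1)).symm.toLinearMap ∘ₗ
    LinearMap.codRestrict (W.U (i + 1)) _ (hmem i)
  have hη : ∀ i a, (α.toFun (i + 1) (η i a) : M.V (i + 1)) =
      M.x i (S i a) - S (i + 1) (X.x i a) := by
    intro i a
    simp only [η, LinearMap.comp_apply, LinearEquiv.coe_coe, LinearEquiv.apply_symm_apply]
    rfl
  have hα : ∀ i b, (α.toFun (i + 1) (Y.x i b) : M.V (i + 1)) = M.x i (α.toFun i b) :=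
    fun i b => congrArg Subtype.val (α.comm i b)
  refine ⟨η, isoOfBijective (fun i => (S i).coprod ((W.U i).subtype ∘ₗ (α.toFun i).toLinearMap))
    (fun i p => ?_) (fun i => ⟨?_, fun m => ?_⟩), fun i p => rfl⟩
  · change S (i + 1) (X.x i p.1) + (α.toFun (i + 1) (η i p.1 + Y.x i p.2) : M.V (i + 1)) =
      M.x i (S i p.1 + (α.toFun i p.2 : M.V i))
    rw [map_add, Submodule.coe_add, hη, hα, map_add]
    abel
  · refine (injective_iff_map_eq_zero _).2 fun p hp => ?_
    have hp : S i p.1 + (α.toFun i p.2 : M.V i) = 0 := hp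
    have h1 : (W.U i).mkQ (S i p.1) = 0 := by
      refine (Submodule.Quotient.mk_eq_zero _).2 ?_
      rw [eq_neg_of_add_eq_zero_left hp]
      exact neg_mem (α.toFun i p.2).2
    have h2 : p.1 = 0 := by rw [← hS i p.1, h1, map_zero]
    rw [h2, map_zero, zero_add] at hp
    have h3 : α.toFun i p.2 = 0 := Subtype.ext hp
    have h4 : p.2 = 0 := (α.toFun i).map_eq_zero_iff.1 h3
    exact Prod.ext h2 h4
  · have h1 : m - S i (β.toFun i ((W.U i).mkQ m)) ∈ W.U i := by
      rw [← Submodule.Quotient.eq]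
      apply (β.toFun i).injective
      exact (hS i _).symm
    refine ⟨(β.toFun i ((W.U i).mkQ m), (α.toFun i).symm ⟨_, h1⟩), ?_⟩
    change S i _ + ((α.toFun i ((α.toFun i).symm ⟨_, h1⟩)) : M.V i) = m
    rw [LinearEquiv.apply_symm_apply]
    exact add_sub_cancel _ _

theorem exists_of_iso_ext {η : E X Y} (φ : Iso (ext X Y η) M) :
    ∃ (W : Sb M) (α : Iso Y (M.sub W)) (β : Iso (M.quo W) X),
      (∀ i b, (α.toFun i b : M.V i) = φ.toFun i (0, b)) ∧
      ∀ i a, β.toFun i ((W.U i).mkQ (φ.toFun i (a, 0))) = a := by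
  have hf : (fun i => (φ.toFun i).toLinearMap ∘ₗ LinearMap.inr F (X.V i) (Y.V i)) ∈ hom Y M := by
    intro i b
    have h := φ.comm i (0, b)
    rw [ext_x] at h
    simpa using h
  have hg : (fun i => LinearMap.fst F (X.V i) (Y.V i) ∘ₗ (φ.toFun i).symm.toLinearMap) ∈
      hom M X := by
    intro i m
    have h := φ.symm.comm i m
    exact congrArg Prod.fst h
  have hmem : ∀ i m, m ∈ (rangeSb hf).U i ↔ ((φ.toFun i).symm m).1 = 0 := by
    intro i m
    constructor
    · rintro ⟨b, rfl⟩
      simp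
    · intro h
      refine ⟨((φ.toFun i).symm m).2, ?_⟩
      change φ.toFun i (0, _) = m
      rw [← LinearEquiv.eq_symm_apply]
      exact Prod.ext h.symm rfl
  refine ⟨rangeSb hf, isoOfBijective (fun i => LinearMap.rangeRestrict _)
      (fun i b => Subtype.ext (hf i b))
      (fun i => ⟨fun b b' h => ?_, LinearMap.surjective_rangeRestrict _⟩),
    isoOfBijective (fun i => ((rangeSb hf).U i).liftQ
        (LinearMap.fst F (X.V i) (Y.V i) ∘ₗ (φ.toFun i).symm.toLinearMap)
        fun m hm => (hmem i m).1 hm)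
      (fun i m => ?_) (fun i => ⟨LinearMap.ker_eq_bot.1 <|
          Submodule.ker_liftQ_eq_bot _ _ _ fun m hm => (hmem i m).2 hm, fun a => ?_⟩),
    fun i b => rfl, fun i a => ?_⟩
  · have h1 : φ.toFun i (0, b) = φ.toFun i (0, b') := congrArg Subtype.val h
    exact congrArg Prod.snd ((φ.toFun i).injective h1)
  · obtain ⟨m, rfl⟩ := Submodule.mkQ_surjective _ m
    exact hg i m
  · refine ⟨Submodule.Quotient.mk (φ.toFun i (a, 0)), ?_⟩
    change ((φ.toFun i).symm (φ.toFun i (a, 0))).1 = a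
    rw [LinearEquiv.symm_apply_apply]
  · change ((φ.toFun i).symm (φ.toFun i (a, 0))).1 = a
    rw [LinearEquiv.symm_apply_apply]

/-- Linear sections of the projection in a short exact sequence. -/
def Sections {W : Sb M} (β : Iso (M.quo W) X) : Type :=
  {S : L X M // ∀ i a, β.toFun i ((W.U i).mkQ (S i a)) = a}

theorem card_sections {W : Sb M} (α : Iso Y (M.sub W)) (β : Iso (M.quo W) X) :
    (Nat.card (Sections β) : ℂ) = q F ^ G X Y := by
  have h0 : ∀ i, ∃ s : X.V i →ₗ[F] M.V i, ∀ a, β.toFun i ((W.U i).mkQ (s a)) = a := by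
    intro i
    obtain ⟨s, hs⟩ := (W.U i).mkQ.exists_rightInverse_of_surjective (Submodule.range_mkQ _)
    refine ⟨s ∘ₗ (β.toFun i).symm.toLinearMap, fun a => ?_⟩
    have := LinearMap.congr_fun hs ((β.toFun i).symm a)
    change β.toFun i ((W.U i).mkQ (s ((β.toFun i).symm a))) = a
    rw [← LinearEquiv.eq_symm_apply]
    exact this
  choose s hs using h0
  have hmem : ∀ (S : Sections β) i a, (S.1 i - s i) a ∈ W.U i := by
    intro S i a
    rw [LinearMap.sub_apply, ← Submodule.Quotient.eq]
    apply (β.toFun i).injective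
    exact (S.2 i a).trans (hs i a).symm
  let ε : Sections β ≃ L X (M.sub W) :=
    { toFun := fun S i => LinearMap.codRestrict (W.U i) _ (hmem S i)
      invFun := fun f => ⟨fun i => s i + (W.U i).subtype ∘ₗ f i, fun i a => by
        have h1 : (W.U i).mkQ ((s i + (W.U i).subtype ∘ₗ f i) a) = (W.U i).mkQ (s i a) := by
          refine (Submodule.Quotient.eq _).2 ?_
          simp
        rw [h1, hs]⟩
      left_inv := fun S => Subtype.ext (funext fun i => LinearMap.ext fun a => by
        change s i a + (S.1 i a - s i a) = S.1 i a
        abel)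
      right_inv := fun f => funext fun i => LinearMap.ext fun a => Subtype.ext (by
        change (s i a + (f i a : M.V i)) - s i a = (f i a : M.V i)
        abel) }
  rw [Nat.card_congr ε, Nat.card_eq_fintype_card, card_L, α.G_right]

/-- An isomorphism from some extension is determined by its underlying map. -/
theorem sigma_iso_ext {p p' : Σ η : E X Y, Iso (ext X Y η) M}
    (h : ∀ i (a : X.V i × Y.V i), p.2.toFun i a = p'.2.toFun i a) : p = p' := by
  obtain ⟨η, φ⟩ := p
  obtain ⟨η', φ'⟩ := p'
  have : η = η' := by
    funext i
    refine LinearMap.ext fun a => ?_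
    have h1 := φ.comm i (a, 0)
    have h2 := φ'.comm i (a, 0)
    rw [h, h, ← h2] at h1
    have h3 := (φ'.toFun (i + 1)).injective h1
    rw [ext_x, ext_x] at h3
    simpa using congrArg Prod.snd h3
  subst this
  have : φ = φ' := Iso.ext (funext fun i => LinearEquiv.ext fun a => h i a)
  rw [this]

theorem card_sigma_iso :
    Nat.card (Σ η : E X Y, Iso (ext X Y η) M) =
      Nat.card (Σ W : Sb M, Σ p : Iso Y (M.sub W) × Iso (M.quo W) X, Sections p.2) := by
  symm
  choose! η φ h using fun (z : Σ W : Sb M, Σ p : Iso Y (M.sub W) × Iso (M.quo W) X,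
    Sections p.2) => exists_iso_ext z.1 z.2.1.1 z.2.1.2 z.2.2.1 z.2.2.2
  refine Nat.card_eq_of_bijective
    (fun z => (⟨η z, φ z⟩ : Σ η : E X Y, Iso (ext X Y η) M)) ⟨?_, ?_⟩
  · intro z z' hz
    have hp : ∀ i (p : X.V i × Y.V i), (φ z).toFun i p = (φ z').toFun i p := by
      intro i p
      have := congrArg (fun w : Σ η : E X Y, Iso (ext X Y η) M => w.2.toFun i p) hz
      exact this
    simp only [h] at hp
    obtain ⟨W, ⟨α, β⟩, S⟩ := z
    obtain ⟨W', ⟨α', β'⟩, S'⟩ := z'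
    have hα : ∀ i b, (α.toFun i b : M.V i) = α'.toFun i b := fun i b => by
      simpa using hp i (0, b)
    have hS : ∀ i a, S.1 i a = S'.1 i a := fun i a => by
      simpa using hp i (a, 0)
    have hW : W = W' := by
      refine Sb.ext (funext fun i => le_antisymm (fun m hm => ?_) fun m hm => ?_)
      · have := hα i ((α.toFun i).symm ⟨m, hm⟩)
        rw [LinearEquiv.apply_symm_apply] at this
        change m = _ at this
        rw [this]
        exact (α'.toFun i _).2
      · have := hα i ((α'.toFun i).symm ⟨m, hm⟩)
        rw [LinearEquiv.apply_symm_apply] at this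
        change _ = m at this
        rw [← this]
        exact (α.toFun i _).2
    subst hW
    have hα' : α = α' := Iso.ext (funext fun i => LinearEquiv.ext fun b => Subtype.ext (hα i b))
    subst hα'
    have hβ : β = β' := by
      have h1 : β.symm = β'.symm := by
        refine Iso.ext (funext fun i => LinearEquiv.ext fun a => ?_)
        change (β.toFun i).symm a = (β'.toFun i).symm a
        rw [LinearEquiv.symm_apply_eq]
        have h2 := S.2 i a
        have h3 := S'.2 i a
        rw [← hS, ← LinearEquiv.eq_symm_apply] at h3
        rw [← h3]
        exact h2.symm
      exact congrArg Iso.symm h1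
    subst hβ
    have hS' : S = S' := Subtype.ext (funext fun i => LinearMap.ext fun a => hS i a)
    rw [hS']
  · rintro ⟨ξ, ψ⟩
    obtain ⟨W, α, β, h1, h2⟩ := exists_of_iso_ext ψ
    refine ⟨⟨W, (α, β), ⟨fun i => (ψ.toFun i).toLinearMap ∘ₗ LinearMap.inl F _ _, h2⟩⟩,
      sigma_iso_ext fun i p => ?_⟩
    rw [h]
    change ψ.toFun i (p.1, 0) + (α.toFun i p.2 : M.V i) = _
    rw [h1, ← map_add]
    congr 1
    exact Prod.ext (add_zero _) (zero_add _)

open scoped Classical in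
/-- Riedtmann's formula. -/
theorem riedtmann (X Y M : QRep F r) :
    (∑ W : Sb M, if Nonempty (Iso Y (M.sub W)) ∧ Nonempty (Iso (M.quo W) X) then (1 : ℂ) else 0) *
        (X.autCard * Y.autCard * q F ^ G X Y) =
      (∑ η : E X Y, if Nonempty (Iso (ext X Y η) M) then (1 : ℂ) else 0) * M.autCard := by
  have h := congrArg (Nat.cast : ℕ → ℂ) (card_sigma_iso (X := X) (Y := Y) (M := M))
  have hfin : ∀ W (p : Iso Y (M.sub W) × Iso (M.quo W) X), Finite (Sections p.2) :=
    fun W p => Subtype.finite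
  rw [Nat.card_sigma, Nat.card_sigma, Nat.cast_sum, Nat.cast_sum] at h
  rw [Finset.sum_mul, Finset.sum_mul]
  have e1 : ∀ η : E X Y, (if Nonempty (Iso (ext X Y η) M) then (1 : ℂ) else 0) * M.autCard =
      (Nat.card (Iso (ext X Y η) M) : ℂ) := by
    intro η
    rw [card_iso_right]
    split_ifs <;> simp
  have e2 : ∀ W : Sb M, (if Nonempty (Iso Y (M.sub W)) ∧ Nonempty (Iso (M.quo W) X)
      then (1 : ℂ) else 0) * (X.autCard * Y.autCard * q F ^ G X Y) =
      (Nat.card (Σ p : Iso Y (M.sub W) × Iso (M.quo W) X, Sections p.2) : ℂ) := by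
    intro W
    let _ : Fintype (Iso Y (M.sub W) × Iso (M.quo W) X) := Fintype.ofFinite _
    rw [Nat.card_sigma, Nat.cast_sum,
      Finset.sum_congr rfl fun p _ => card_sections p.1 p.2, Finset.sum_const, Finset.card_univ,
      ← Nat.card_eq_fintype_card, Nat.card_prod, card_iso_left, card_iso_right, nsmul_eq_mul]
    by_cases h1 : Nonempty (Iso Y (M.sub W)) <;> by_cases h2 : Nonempty (Iso (M.quo W) X) <;>
      simp [h1, h2, mul_comm]
  rw [Finset.sum_congr rfl fun η _ => e1 η, Finset.sum_congr rfl fun W _ => e2 W]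
  exact h.symm

end shortExact

end QRep

/-! ### Matrix representations -/

namespace NRep

/-- The representation on coordinate spaces underlying a matrix representation. -/
@[reducible] def toQ (M : NRep F r) : QRep F r where
  V i := Fin (M.d i) → F
  x i := Matrix.mulVecLin (M.x i)

theorem dim_toQ (M : NRep F r) : M.toQ.dim = M.d := by
  funext i
  exact Module.finrank_fin_fun F

/-- The two notions of isomorphism agree. -/
def isoEquiv (M N : NRep F r) : RepIso M N ≃ QRep.Iso M.toQ N.toQ where
  toFun φ := ⟨φ.1, fun i a => (LinearMap.congr_fun (φ.2 i) a).symm⟩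
  invFun φ := ⟨φ.toFun, fun i => LinearMap.ext fun a => (φ.comm i a).symm⟩
  left_inv _ := rfl
  right_inv _ := rfl

theorem aut_eq (M : NRep F r) : aut M = M.toQ.autCard := Nat.card_congr (isoEquiv M M)

theorem dimEnd_eq (M : NRep F r) : dimEnd M = M.toQ.e := by
  have : endSub M = QRep.hom M.toQ M.toQ := by
    ext f
    exact ⟨fun h i a => (LinearMap.congr_fun (h i) a).symm,
      fun h i => LinearMap.ext fun a => (h i a).symm⟩
  rw [dimEnd, this]
  rfl

end NRep

theorem shift_apply_succ (d : ZMod r → ℕ) (x : ∀ i : ZMod r, Matrix (Fin (d (i + 1))) (Fin (d i)) F)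
    (w : ∀ i : ZMod r, Fin (d i) → F) (i : ZMod r) :
    shift F r d x w (i + 1) = (x i).mulVec (w i) := by
  have key : ∀ (j : ZMod r) (_ : j = i) (h : (Fin (d (j + 1)) → F) = (Fin (d (i + 1)) → F)),
      cast h ((x j).mulVec (w j)) = (x i).mulVec (w i) := by
    rintro j rfl h
    rfl
  exact key (i + 1 - 1) (add_sub_cancel_right i 1) _

namespace QRep

/-- The shift of a matrix representation is the total operator. -/
theorem shift_eq_T (d : ZMod r → ℕ) (x : ∀ i : ZMod r, Matrix (Fin (d (i + 1))) (Fin (d i)) F)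
    (w : ∀ i : ZMod r, Fin (d i) → F) :
    shift F r d x w =
      T (⟨fun i => Fin (d i) → F, fun i => Matrix.mulVecLin (x i)⟩ : QRep F r) w :=
  tot_ext (A := ⟨fun i => Fin (d i) → F, fun i => Matrix.mulVecLin (x i)⟩) fun i => by
    rw [T_apply_succ]
    exact shift_apply_succ d x w i

theorem nil_iff_shift (d : ZMod r → ℕ)
    (x : ∀ i : ZMod r, Matrix (Fin (d (i + 1))) (Fin (d i)) F) :
    Nil (⟨fun i => Fin (d i) → F, fun i => Matrix.mulVecLin (x i)⟩ : QRep F r) ↔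
      ∃ N : ℕ, ∀ w : ∀ i : ZMod r, Fin (d i) → F, (shift F r d x)^[N] w = 0 := by
  refine exists_congr fun N => ?_
  rw [LinearMap.ext_iff]
  refine forall_congr' fun w => ?_
  rw [Module.End.pow_apply, funext (shift_eq_T d x)]
  rfl

theorem nil_toQ (M : NRep F r) : M.toQ.Nil := (nil_iff_shift M.d M.x).2 M.nil

theorem exists_toQ {A : QRep F r} (hA : A.Nil) : ∃ M : NRep F r, Nonempty (Iso A M.toQ) := by
  let b : ∀ i, A.V i ≃ₗ[F] (Fin (A.dim i) → F) := fun i => (Module.finBasis F (A.V i)).equivFun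
  let x : ∀ i : ZMod r, Matrix (Fin (A.dim (i + 1))) (Fin (A.dim i)) F := fun i =>
    LinearMap.toMatrix' ((b (i + 1)).toLinearMap ∘ₗ A.x i ∘ₗ (b i).symm.toLinearMap)
  let φ : Iso A ⟨fun i => Fin (A.dim i) → F, fun i => Matrix.mulVecLin (x i)⟩ :=
    ⟨b, fun i a => by
      change _ = (x i).mulVec (b i a)
      simp only [x]
      rw [LinearMap.toMatrix'_mulVec]
      simp⟩
  exact ⟨⟨A.dim, x, (nil_iff_shift A.dim x).1 (hA.iso φ)⟩, ⟨φ⟩⟩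

/-- Subrepresentations of a matrix representation. -/
def subRepEquiv (M : NRep F r) : SubRep M ≃ Sb M.toQ where
  toFun U := ⟨U.1, U.2⟩
  invFun W := ⟨W.U, W.st⟩
  left_inv _ := rfl
  right_inv _ := rfl

theorem subIso_iff (M : NRep F r) (U : SubRep M) (N : NRep F r) :
    SubIso M U N ↔ Nonempty (Iso N.toQ (M.toQ.sub (subRepEquiv M U))) := by
  constructor
  · rintro ⟨φ, h⟩
    exact ⟨⟨φ, fun i a => Subtype.ext (h i a).symm⟩⟩
  · rintro ⟨φ⟩
    exact ⟨φ.toFun, fun i a => (congrArg Subtype.val (φ.comm i a)).symm⟩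

theorem quotIso_iff (M : NRep F r) (U : SubRep M) (N : NRep F r) :
    QuotIso M U N ↔ Nonempty (Iso (M.toQ.quo (subRepEquiv M U)) N.toQ) := by
  constructor
  · rintro ⟨φ, h⟩
    exact ⟨Iso.symm ⟨φ, fun i a => (h i a).symm⟩⟩
  · rintro ⟨φ⟩
    exact ⟨φ.symm.toFun, fun i a => (φ.symm.comm i a).symm⟩

open scoped Classical in
theorem hall_eq (M X Y : NRep F r) :
    (hall M X Y : ℂ) = ∑ W : Sb M.toQ, if Nonempty (Iso Y.toQ (M.toQ.sub W)) ∧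
      Nonempty (Iso (M.toQ.quo W) X.toQ) then (1 : ℂ) else 0 := by
  rw [Finset.sum_boole, hall]
  congr 1
  rw [← Fintype.card_subtype, ← Nat.card_eq_fintype_card]
  refine Nat.card_congr ((subRepEquiv M).subtypeEquiv fun U => ?_)
  rw [subIso_iff, quotIso_iff]

/-! ### Functions on a skeleton -/

section skeleton

variable {ι : Type} {Rp : ι → NRep F r}

open scoped Classical in
/-- The class function given by coefficients on a skeleton. -/
noncomputable def lift (Rp : ι → NRep F r) (u : ι → ℂ) (A : QRep F r) : ℂ :=
  if h : ∃ i, Nonempty (Iso A (Rp i).toQ) then u h.choose else 0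

theorem lift_eq (hskel : ∀ i j : ι, Nonempty (RepIso (Rp i) (Rp j)) → i = j) (u : ι → ℂ)
    {A : QRep F r} {i : ι} (φ : Iso A (Rp i).toQ) : lift Rp u A = u i := by
  have h : ∃ i, Nonempty (Iso A (Rp i).toQ) := ⟨i, ⟨φ⟩⟩
  unfold lift
  rw [dif_pos h]
  obtain ⟨ψ⟩ := h.choose_spec
  exact congrArg u (hskel _ _ ⟨(NRep.isoEquiv _ _).symm (ψ.symm.trans φ)⟩)

theorem classFun_lift (hskel : ∀ i j : ι, Nonempty (RepIso (Rp i) (Rp j)) → i = j) (u : ι → ℂ) :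
    ClassFun (lift Rp u) := by
  intro A B φ
  by_cases h : ∃ i, Nonempty (Iso A (Rp i).toQ)
  · obtain ⟨i, ⟨ψ⟩⟩ := h
    rw [lift_eq hskel u ψ, lift_eq hskel u (φ.symm.trans ψ)]
  · have h' : ¬ ∃ i, Nonempty (Iso B (Rp i).toQ) :=
      fun ⟨i, ⟨ψ⟩⟩ => h ⟨i, ⟨φ.trans ψ⟩⟩
    unfold lift
    rw [dif_neg h, dif_neg h']

theorem exists_iso (hcompl : ∀ M : NRep F r, ∃ i : ι, Nonempty (RepIso M (Rp i)))
    {A : QRep F r} (hA : A.Nil) : ∃ i, Nonempty (Iso A (Rp i).toQ) := by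
  obtain ⟨M, ⟨φ⟩⟩ := exists_toQ hA
  obtain ⟨i, ⟨ψ⟩⟩ := hcompl M
  exact ⟨i, ⟨φ.trans (NRep.isoEquiv _ _ ψ)⟩⟩

open scoped Classical in
theorem sum_iso_eq_lift (hskel : ∀ i j : ι, Nonempty (RepIso (Rp i) (Rp j)) → i = j)
    (hcompl : ∀ M : NRep F r, ∃ i : ι, Nonempty (RepIso M (Rp i)))
    {S : (ZMod r → ℕ) → Finset ι} (hS : ∀ dd (i : ι), i ∈ S dd ↔ (Rp i).d = dd)
    (u : ι → ℂ) {A : QRep F r} (hA : A.Nil) (d : ZMod r → ℕ) :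
    ∑ i ∈ S d, (if Nonempty (Iso A (Rp i).toQ) then u i else 0) =
      if A.dim = d then lift Rp u A else 0 := by
  obtain ⟨i, ⟨φ⟩⟩ := exists_iso hcompl hA
  have hd : A.dim = (Rp i).d := by rw [φ.dim_eq, NRep.dim_toQ]
  have huniq : ∀ k, Nonempty (Iso A (Rp k).toQ) → k = i := fun k ⟨ψ⟩ =>
    hskel _ _ ⟨(NRep.isoEquiv _ _).symm (ψ.symm.trans φ)⟩
  rw [lift_eq hskel u φ]
  by_cases h : A.dim = d
  · rw [if_pos h, Finset.sum_eq_single i, if_pos ⟨φ⟩]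
    · exact fun k _ hk => if_neg fun h' => hk (huniq k h')
    · exact fun h' => absurd ((hS d i).2 (hd ▸ h)) h'
  · rw [if_neg h]
    refine Finset.sum_eq_zero fun k hk => if_neg fun h' => h ?_
    rw [hd, ← huniq k h']
    exact (hS d k).1 hk

theorem comulCoef_eq (v : ℂ) (hskel : ∀ i j : ι, Nonempty (RepIso (Rp i) (Rp j)) → i = j)
    (hcompl : ∀ M : NRep F r, ∃ i : ι, Nonempty (RepIso M (Rp i)))
    {S : (ZMod r → ℕ) → Finset ι} (hS : ∀ dd (i : ι), i ∈ S dd ↔ (Rp i).d = dd)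
    (u : ι → ℂ) (j k : ι) :
    comulCoef v Rp S u j k = v ^ euler r (Rp j).d (Rp k).d *
      (q F ^ G (Rp j).toQ (Rp k).toQ)⁻¹ * Rs (lift Rp u) (Rp j).toQ (Rp k).toQ := by
  classical
  have h1 : ∀ i, (aut (Rp j) : ℂ) * (aut (Rp k) : ℂ) / (aut (Rp i) : ℂ) *
      (hall (Rp i) (Rp j) (Rp k) : ℂ) = (q F ^ G (Rp j).toQ (Rp k).toQ)⁻¹ *
      ∑ η : E (Rp j).toQ (Rp k).toQ,
        if Nonempty (Iso (ext (Rp j).toQ (Rp k).toQ η) (Rp i).toQ) then (1 : ℂ) else 0 := by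
    intro i
    have h := riedtmann (Rp j).toQ (Rp k).toQ (Rp i).toQ
    rw [← hall_eq] at h
    have ha : ((Rp i).toQ.autCard : ℂ) ≠ 0 := Nat.cast_ne_zero.2 (autCard_ne_zero _)
    have hq : q F ^ G (Rp j).toQ (Rp k).toQ ≠ 0 := pow_ne_zero _ q_ne_zero
    rw [NRep.aut_eq, NRep.aut_eq, NRep.aut_eq]
    field_simp
    linear_combination h
  have h2 : ∀ η : E (Rp j).toQ (Rp k).toQ, lift Rp u (ext (Rp j).toQ (Rp k).toQ η) =
      ∑ i ∈ S ((Rp j).d + (Rp k).d),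
        if Nonempty (Iso (ext (Rp j).toQ (Rp k).toQ η) (Rp i).toQ) then u i else 0 := by
    intro η
    rw [sum_iso_eq_lift hskel hcompl hS u ((nil_toQ _).ext (nil_toQ _) η), if_pos]
    rw [dim_ext, NRep.dim_toQ, NRep.dim_toQ]
  unfold Rs comulCoef
  rw [Finset.sum_congr rfl fun η _ => h2 η, Finset.sum_comm, Finset.mul_sum]
  refine Finset.sum_congr rfl fun i _ => ?_
  rw [mul_assoc (v ^ _) _ (hall _ _ _ : ℂ), h1, mul_assoc, mul_assoc, mul_assoc, Finset.sum_mul]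
  congr 2
  refine Finset.sum_congr rfl fun η _ => ?_
  split_ifs <;> simp

open scoped Classical in
theorem mulCoef_eq (v : ℂ) (hskel : ∀ i j : ι, Nonempty (RepIso (Rp i) (Rp j)) → i = j)
    (hcompl : ∀ M : NRep F r, ∃ i : ι, Nonempty (RepIso M (Rp i)))
    {S : (ZMod r → ℕ) → Finset ι} (hS : ∀ dd (i : ι), i ∈ S dd ↔ (Rp i).d = dd)
    (y z : ι → ℂ) (dy dz : ZMod r → ℕ) (i : ι) :
    mulCoef v Rp S y z dy dz i = v ^ euler r dy dz * ∑ W : Sb (Rp i).toQ,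
      (if ((Rp i).toQ.quo W).dim = dy then lift Rp y ((Rp i).toQ.quo W) else 0) *
        (if ((Rp i).toQ.sub W).dim = dz then lift Rp z ((Rp i).toQ.sub W) else 0) := by
  have h1 : ∀ W : Sb (Rp i).toQ,
      (if ((Rp i).toQ.quo W).dim = dy then lift Rp y ((Rp i).toQ.quo W) else 0) *
        (if ((Rp i).toQ.sub W).dim = dz then lift Rp z ((Rp i).toQ.sub W) else 0) =
      ∑ j ∈ S dy, ∑ k ∈ S dz, (if Nonempty (Iso (Rp k).toQ ((Rp i).toQ.sub W)) ∧
        Nonempty (Iso ((Rp i).toQ.quo W) (Rp j).toQ) then (1 : ℂ) else 0) * y j * z k := by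
    intro W
    rw [← sum_iso_eq_lift hskel hcompl hS y ((nil_toQ _).quo W),
      ← sum_iso_eq_lift hskel hcompl hS z ((nil_toQ _).sub W), Finset.sum_mul_sum]
    refine Finset.sum_congr rfl fun j _ => Finset.sum_congr rfl fun k _ => ?_
    have hsymm : Nonempty (Iso (Rp k).toQ ((Rp i).toQ.sub W)) ↔
        Nonempty (Iso ((Rp i).toQ.sub W) (Rp k).toQ) := ⟨fun ⟨φ⟩ => ⟨φ.symm⟩, fun ⟨φ⟩ => ⟨φ.symm⟩⟩
    rw [hsymm]
    by_cases ha : Nonempty (Iso ((Rp i).toQ.sub W) (Rp k).toQ) <;>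
      by_cases hb : Nonempty (Iso ((Rp i).toQ.quo W) (Rp j).toQ) <;> simp [ha, hb]
  rw [Finset.sum_congr rfl fun W _ => h1 W, Finset.sum_comm, Finset.mul_sum]
  unfold mulCoef
  refine Finset.sum_congr rfl fun j _ => ?_
  rw [Finset.sum_comm, Finset.mul_sum]
  refine Finset.sum_congr rfl fun k _ => ?_
  rw [hall_eq, ← Finset.sum_mul, ← Finset.sum_mul]
  ring

theorem euler_const_left (n : ℕ) (d : ZMod r → ℕ) : euler r (fun _ => n) d = 0 := by
  unfold euler
  rw [sub_eq_zero, ← Finset.mul_sum, ← Finset.mul_sum]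
  congr 1
  exact (Equiv.sum_comp (Equiv.addRight (1 : ZMod r)) fun i => (d i : ℤ)).symm

end skeleton

/-! ### The central elements as functions on representations -/

/-- The function on representations whose values are the coefficients of the central elements. -/
noncomputable def cfun (v : ℂ) (A : QRep F r) : ℂ := (-v ^ (-(2 * (r : ℤ)))) ^ A.dim 0 * A.g

theorem classFun_cfun (v : ℂ) : ClassFun (cfun v : QRep F r → ℂ) := fun A B φ => by
  unfold cfun
  rw [φ.dim_eq, classFun_g _ _ φ]

theorem rs_cfun (hr : 1 < r) (v : ℂ) {X Y : QRep F r} (hX : X.Nil) (hY : Y.Nil) :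
    Rs (cfun v) X Y = q F ^ G X Y * cfun v X * cfun v Y := by
  have h : Rs (cfun v) X Y = (-v ^ (-(2 * (r : ℤ)))) ^ (X.dim 0 + Y.dim 0) * Rs g X Y := by
    unfold Rs cfun
    rw [Finset.mul_sum]
    refine Finset.sum_congr rfl fun η _ => ?_
    rw [dim_ext]
    rfl
  rw [h, rs_g hr hX hY, cfun, cfun, pow_add]
  ring

theorem cfun_eq_one (v : ℂ) {A : QRep F r} (h : A.tdim = 0) : cfun v A = 1 := by
  rw [cfun, dim_eq_zero h, g_eq_one h, pow_zero, one_mul]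

theorem cfun_eq_zero (v : ℂ) {A : QRep F r} (h : ¬ A.Const) : cfun v A = 0 := by
  rw [cfun, g, if_neg fun h' => h h'.1, mul_zero]

section skeleton

variable {ι : Type} {Rp : ι → NRep F r}

open scoped Classical in
theorem ccoef_eq (v : ℂ) (n : ℕ) (i : ι) :
    ccoef v Rp n i = if (Rp i).toQ.dim = fun _ => n then cfun v (Rp i).toQ else 0 := by
  rw [NRep.dim_toQ]
  unfold ccoef
  by_cases hd : (Rp i).d = fun _ => n
  · rw [if_pos hd]
    have hdim : ∀ k, (Rp i).toQ.dim k = n := fun k => by rw [NRep.dim_toQ, hd]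
    have hconst : (Rp i).toQ.Const := ⟨n, hdim⟩
    unfold cfun g
    by_cases hs : socSquareFree (Rp i)
    · rw [if_pos ⟨hd, hs⟩, if_pos ⟨hconst, hs⟩, hdim, NRep.aut_eq, NRep.dimEnd_eq, ← neg_mul,
        zpow_mul, zpow_natCast, neg_pow (v ^ (-(2 * (r : ℤ)))) n]
      ring
    · rw [if_neg fun h => hs h.2, if_neg fun h => hs h.2, mul_zero]
  · rw [if_neg hd, if_neg fun h => hd h.1]

open scoped Classical in
theorem lift_ccoef (v : ℂ) (hskel : ∀ i j : ι, Nonempty (RepIso (Rp i) (Rp j)) → i = j)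
    (hcompl : ∀ M : NRep F r, ∃ i : ι, Nonempty (RepIso M (Rp i))) (n : ℕ)
    {A : QRep F r} (hA : A.Nil) :
    lift Rp (ccoef v Rp n) A = if A.dim = fun _ => n then cfun v A else 0 := by
  obtain ⟨i, ⟨φ⟩⟩ := exists_iso hcompl hA
  rw [lift_eq hskel _ φ, ccoef_eq, φ.dim_eq, classFun_cfun v _ _ φ]

theorem const_of_dim_eq {A : QRep F r} {n : ℕ} (h : A.dim = fun _ => n) : A.Const :=
  ⟨n, fun i => congrFun h i⟩

theorem comulCoef_ccoef (hr : 1 < r) (v : ℂ)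
    (hskel : ∀ i j : ι, Nonempty (RepIso (Rp i) (Rp j)) → i = j)
    (hcompl : ∀ M : NRep F r, ∃ i : ι, Nonempty (RepIso M (Rp i)))
    {S : (ZMod r → ℕ) → Finset ι} (hS : ∀ dd (i : ι), i ∈ S dd ↔ (Rp i).d = dd)
    (n : ℕ) (j k : ι) :
    comulCoef v Rp S (ccoef v Rp n) j k =
      ∑ s ∈ Finset.range (n + 1), ccoef v Rp s j * ccoef v Rp (n - s) k := by
  classical
  set X := (Rp j).toQ with hX
  set Y := (Rp k).toQ with hY
  have hXn : X.Nil := nil_toQ _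
  have hYn : Y.Nil := nil_toQ _
  rw [comulCoef_eq v hskel hcompl hS]
  have h1 : Rs (lift Rp (ccoef v Rp n)) X Y =
      if X.dim + Y.dim = fun _ => n then q F ^ G X Y * cfun v X * cfun v Y else 0 := by
    rw [← rs_cfun hr v hXn hYn]
    unfold Rs
    split_ifs with h
    · refine Finset.sum_congr rfl fun η _ => ?_
      rw [lift_ccoef v hskel hcompl n (hXn.ext hYn η), dim_ext, if_pos h]
    · refine Finset.sum_eq_zero fun η _ => ?_
      rw [lift_ccoef v hskel hcompl n (hXn.ext hYn η), dim_ext, if_neg h]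
  rw [h1]
  simp only [ccoef_eq, ← hX, ← hY]
  have hq : q F ^ G X Y ≠ 0 := pow_ne_zero _ q_ne_zero
  by_cases hc : X.Const
  · obtain ⟨s, hs⟩ := hc
    have hs' : X.dim = fun _ => s := funext hs
    have he : euler r (Rp j).d (Rp k).d = 0 := by
      rw [← NRep.dim_toQ (Rp j), ← hX, hs', euler_const_left]
    rw [he, zpow_zero, one_mul]
    by_cases hn : X.dim + Y.dim = fun _ => n
    · have hn' : ∀ i, s + Y.dim i = n := fun i => by
        rw [← hs i]; exact congrFun hn i
      have hY' : Y.dim = fun _ => n - s := funext fun i => by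
        have := hn' i; omega
      have hsn : s ≤ n := by have := hn' 0; omega
      rw [if_pos hn, Finset.sum_eq_single s, if_pos hs', if_pos hY']
      · rw [mul_assoc, inv_mul_cancel_left₀ hq]
      · intro t _ ht
        rw [if_neg, zero_mul]
        intro h
        exact ht (by rw [← hs 0, h])
      · intro h
        exact absurd (Finset.mem_range.2 (by omega)) h
    · rw [if_neg hn, mul_zero]
      symm
      refine Finset.sum_eq_zero fun t ht => ?_
      by_cases h2 : X.dim = fun _ => t
      · by_cases h3 : Y.dim = fun _ => n - t
        · refine absurd (funext fun i => ?_) hn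
          have := Finset.mem_range.1 ht
          rw [Pi.add_apply, h2, h3]
          dsimp only
          omega
        · rw [if_neg h3, mul_zero]
      · rw [if_neg h2, zero_mul]
  · rw [cfun_eq_zero v hc, mul_zero, zero_mul, ite_self, mul_zero]
    symm
    refine Finset.sum_eq_zero fun t _ => ?_
    rw [if_neg fun h => hc (const_of_dim_eq h), zero_mul]

/-! ### The elements `x_n` -/

section primitive

variable {v : ℂ} {S : (ZMod r → ℕ) → Finset ι} {xc : ℕ → ι → ℂ}

open scoped Classical in
/-- The function on representations collecting the coefficients of all `x_n`, `n ≥ 1`. -/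
noncomputable def xfun (Rp : ι → NRep F r) (xc : ℕ → ι → ℂ) (A : QRep F r) : ℂ :=
  if A.Const ∧ A.dim 0 ≠ 0 then lift Rp (xc (A.dim 0)) A else 0

theorem classFun_xfun (hskel : ∀ i j : ι, Nonempty (RepIso (Rp i) (Rp j)) → i = j) :
    ClassFun (xfun Rp xc) := fun A B φ => by
  classical
  unfold xfun
  rw [φ.dim_eq, classFun_lift hskel _ _ _ φ]
  exact if_congr (and_congr_left fun _ => φ.const_iff) rfl rfl

theorem xfun_eq {A : QRep F r} {n : ℕ} (h : A.dim = fun _ => n) (hn : n ≠ 0) :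
    xfun Rp xc A = lift Rp (xc n) A := by
  have h0 : A.dim 0 = n := congrFun h 0
  unfold xfun
  rw [h0, if_pos ⟨const_of_dim_eq h, hn⟩]

open scoped Classical in
theorem xc_eq (hskel : ∀ i j : ι, Nonempty (RepIso (Rp i) (Rp j)) → i = j)
    (hcompl : ∀ M : NRep F r, ∃ i : ι, Nonempty (RepIso M (Rp i)))
    (hS : ∀ dd (i : ι), i ∈ S dd ↔ (Rp i).d = dd)
    (hxc : ∀ n, 1 ≤ n → ∀ i : ι,
      xc n i = n * ccoef v Rp n i
        - ∑ s ∈ Finset.Ico 1 n,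
            mulCoef v Rp S (xc s) (ccoef v Rp (n - s)) (fun _ => s) (fun _ => n - s) i)
    {n : ℕ} (hn : 1 ≤ n) (i : ι) :
    xc n i = n * (if (Rp i).toQ.dim = fun _ => n then cfun v (Rp i).toQ else 0) -
      ∑ W : Sb (Rp i).toQ, ∑ s ∈ Finset.Ico 1 n,
        (if ((Rp i).toQ.quo W).dim = fun _ => s then xfun Rp xc ((Rp i).toQ.quo W) else 0) *
        (if ((Rp i).toQ.sub W).dim = fun _ => n - s then cfun v ((Rp i).toQ.sub W) else 0) := by
  rw [hxc n hn i, ccoef_eq, Finset.sum_comm]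
  congr 1
  refine Finset.sum_congr rfl fun s hs => ?_
  rw [mulCoef_eq v hskel hcompl hS, euler_const_left, zpow_zero, one_mul]
  refine Finset.sum_congr rfl fun W _ => ?_
  congr 1
  · split_ifs with h
    · have := (Finset.mem_Ico.1 hs).1
      rw [xfun_eq h (by omega)]
    · rfl
  · rw [lift_ccoef v hskel hcompl _ ((nil_toQ _).sub W)]
    split_ifs <;> rfl

theorem xc_eq_zero (hskel : ∀ i j : ι, Nonempty (RepIso (Rp i) (Rp j)) → i = j)
    (hcompl : ∀ M : NRep F r, ∃ i : ι, Nonempty (RepIso M (Rp i)))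
    (hS : ∀ dd (i : ι), i ∈ S dd ↔ (Rp i).d = dd)
    (hxc : ∀ n, 1 ≤ n → ∀ i : ι,
      xc n i = n * ccoef v Rp n i
        - ∑ s ∈ Finset.Ico 1 n,
            mulCoef v Rp S (xc s) (ccoef v Rp (n - s)) (fun _ => s) (fun _ => n - s) i)
    {n : ℕ} (hn : 1 ≤ n) {i : ι} (hi : (Rp i).toQ.dim ≠ fun _ => n) : xc n i = 0 := by
  classical
  rw [xc_eq hskel hcompl hS hxc hn, if_neg hi, mul_zero, zero_sub, neg_eq_zero]
  refine Finset.sum_eq_zero fun W _ => Finset.sum_eq_zero fun s hs => ?_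
  by_cases h1 : ((Rp i).toQ.quo W).dim = fun _ => s
  · by_cases h2 : ((Rp i).toQ.sub W).dim = fun _ => n - s
    · refine absurd (funext fun k => ?_) hi
      rw [← dim_sub_add_dim_quo _ W k, h1, h2]
      have := Finset.mem_Ico.1 hs
      dsimp only
      omega
    · rw [if_neg h2, mul_zero]
  · rw [if_neg h1, zero_mul]

theorem cv_xfun (hskel : ∀ i j : ι, Nonempty (RepIso (Rp i) (Rp j)) → i = j)
    (hcompl : ∀ M : NRep F r, ∃ i : ι, Nonempty (RepIso M (Rp i)))
    (hS : ∀ dd (i : ι), i ∈ S dd ↔ (Rp i).d = dd)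
    (hxc : ∀ n, 1 ≤ n → ∀ i : ι,
      xc n i = n * ccoef v Rp n i
        - ∑ s ∈ Finset.Ico 1 n,
            mulCoef v Rp S (xc s) (ccoef v Rp (n - s)) (fun _ => s) (fun _ => n - s) i)
    {A : QRep F r} (hA : A.Nil) : cv (xfun Rp xc) (cfun v) A = A.dim 0 * cfun v A := by
  classical
  obtain ⟨i, ⟨φ⟩⟩ := exists_iso hcompl hA
  rw [(classFun_xfun hskel).cv (classFun_cfun v) _ _ φ, φ.dim_eq, classFun_cfun v _ _ φ]
  have hx := fun n (hn : 1 ≤ n) => xc_eq hskel hcompl hS hxc hn i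
  have hl := fun n => lift_eq hskel (xc n) (Iso.refl (Rp i).toQ)
  generalize (Rp i).toQ = B at hx hl ⊢
  unfold cv
  have hsum := dim_sub_add_dim_quo B
  by_cases hc : B.Const
  · obtain ⟨n, hn⟩ := hc
    rw [hn]
    rcases Nat.eq_zero_or_pos n with rfl | hpos
    · rw [Nat.cast_zero, zero_mul]
      refine Finset.sum_eq_zero fun W _ => ?_
      have : (B.quo W).dim 0 = 0 := by have := hsum W 0; rw [hn] at this; omega
      rw [xfun, if_neg fun h => h.2 this, zero_mul]
    have hxn := hx n hpos
    rw [if_pos (funext hn)] at hxn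
    have hB : B.tdim ≠ 0 := fun h => by have := dim_eq_zero h 0; rw [hn] at this; omega
    have hsplit : ∀ W : Sb B, xfun Rp xc (B.quo W) * cfun v (B.sub W) =
        (if W = B.botSb then xc n i else 0) + ∑ s ∈ Finset.Ico 1 n,
        (if (B.quo W).dim = fun _ => s then xfun Rp xc (B.quo W) else 0) *
        (if (B.sub W).dim = fun _ => n - s then cfun v (B.sub W) else 0) := by
      intro W
      by_cases hW : W = B.botSb
      · subst hW
        have hd : ∀ k, (B.quo B.botSb).dim k = n := fun k => by
          rw [← B.quoBotIso.dim_eq, hn]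
        rw [if_pos rfl, cfun_eq_one v B.tdim_sub_bot, ← classFun_xfun hskel _ _ B.quoBotIso,
          xfun_eq (funext hn) (by omega), hl, mul_one, Finset.sum_eq_zero, add_zero]
        intro s hs
        rw [if_neg, zero_mul]
        intro h
        have h1 := congrFun h 0
        rw [hd] at h1
        have := Finset.mem_Ico.1 hs
        omega
      · rw [if_neg hW, zero_add]
        by_cases hq : (B.quo W).Const ∧ (B.quo W).dim 0 ≠ 0
        · obtain ⟨⟨s, hs⟩, h0⟩ := hq
          rw [hs] at h0
          have hsub : ∀ k, (B.sub W).dim k + s = n := fun k => by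
            rw [← hs k, hsum W k, hn]
          have hsub' : (B.sub W).dim = fun _ => n - s := funext fun k => by
            have := hsub k; omega
          have hlt : s < n := by
            by_contra hge
            refine hW (eq_botSb (Finset.sum_eq_zero fun k _ => ?_))
            have := hsub k
            omega
          rw [Finset.sum_eq_single s, if_pos (funext hs), if_pos hsub']
          · intro t _ ht
            rw [if_neg, zero_mul]
            intro h
            exact ht (by rw [← hs 0, h])
          · intro h
            exact absurd (Finset.mem_Ico.2 ⟨by omega, hlt⟩) h
        · have hz : xfun Rp xc (B.quo W) = 0 := if_neg hq
          simp [hz]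
    rw [Finset.sum_congr rfl fun W _ => hsplit W, Finset.sum_add_distrib, Finset.sum_ite_eq',
      if_pos (Finset.mem_univ _), hxn]
    ring
  · rw [cfun_eq_zero v hc, mul_zero]
    refine Finset.sum_eq_zero fun W _ => ?_
    by_cases h1 : (B.quo W).Const
    · by_cases h2 : (B.sub W).Const
      · obtain ⟨s, hs⟩ := h1
        obtain ⟨t, ht⟩ := h2
        exact absurd ⟨t + s, fun k => by rw [← hsum W k, hs, ht]⟩ hc
      · rw [cfun_eq_zero v h2, mul_zero]
    · rw [xfun, if_neg fun h => h1 h.1, zero_mul]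

theorem comulCoef_xc (hr : 1 < r)
    (hskel : ∀ i j : ι, Nonempty (RepIso (Rp i) (Rp j)) → i = j)
    (hcompl : ∀ M : NRep F r, ∃ i : ι, Nonempty (RepIso M (Rp i)))
    (hS : ∀ dd (i : ι), i ∈ S dd ↔ (Rp i).d = dd)
    (hxc : ∀ n, 1 ≤ n → ∀ i : ι,
      xc n i = n * ccoef v Rp n i
        - ∑ s ∈ Finset.Ico 1 n,
            mulCoef v Rp S (xc s) (ccoef v Rp (n - s)) (fun _ => s) (fun _ => n - s) i)
    {n : ℕ} (hn : 1 ≤ n) {j k : ι} (hj : (Rp j).d ≠ 0) (hk : (Rp k).d ≠ 0) :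
    comulCoef v Rp S (xc n) j k = 0 := by
  have htd : ∀ i, (Rp i).d ≠ 0 → (Rp i).toQ.tdim ≠ 0 := fun i hi h => hi (by
    rw [← NRep.dim_toQ]
    exact funext (dim_eq_zero h))
  have h0 : Rs (xfun Rp xc) (Rp j).toQ (Rp k).toQ = 0 :=
    rs_eq_zero_of_cv (classFun_cfun v) (classFun_xfun hskel)
      (fun X Y hX hY => rs_cfun hr v hX hY) (fun A hA => cfun_eq_one v hA)
      (fun A hA => if_neg fun h => h.2 (dim_eq_zero hA 0)) (fun A hA => if_neg fun h => hA h.1)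
      (fun A hA => cv_xfun hskel hcompl hS hxc hA) _ _ (nil_toQ _) (nil_toQ _) (htd j hj)
      (htd k hk)
  have h1 : Rs (lift Rp (xc n)) (Rp j).toQ (Rp k).toQ = 0 := by
    by_cases hd : (Rp j).toQ.dim + (Rp k).toQ.dim = fun _ => n
    · rw [← h0]
      refine Finset.sum_congr rfl fun η _ => ?_
      rw [xfun_eq ((dim_ext _ _ η).trans hd) (by omega)]
    · refine Finset.sum_eq_zero fun η _ => ?_
      obtain ⟨i, ⟨φ⟩⟩ := exists_iso hcompl ((nil_toQ (Rp j)).ext (nil_toQ (Rp k)) η)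
      rw [lift_eq hskel _ φ]
      refine xc_eq_zero hskel hcompl hS hxc hn ?_
      rw [← φ.dim_eq, dim_ext]
      exact hd
  rw [comulCoef_eq v hskel hcompl hS, h1, mul_zero]

end primitive

end skeleton

end QRep

/-- In the twisted Ringel–Hall algebra `H⁰_v(C_r)` of nilpotent
representations of the cyclic quiver `C_r` (`r > 1`) over `F_q` (`v = √q`), the central
elements `c_n` form a divided-power sequence, `Δ(c_n) = ∑_{s=0}^n c_s ⊗ c_{n-s}`, and
consequently the elements `x_n = n·c_n − ∑_{s=1}^{n-1} x_s c_{n-s}` are primitive.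
Everything is expressed through coefficients with respect to a skeleton `(Rp i)_{i ∈ ι}`
of the category of nilpotent representations. -/
theorem central_elements_divided_power_and_primitive
    (hr : 1 < r) (v : ℂ) (hv : v = Real.sqrt (Fintype.card F))
    (ι : Type) (Rp : ι → NRep F r)
    (hskel : ∀ i j : ι, Nonempty (RepIso (Rp i) (Rp j)) → i = j)
    (hcompl : ∀ M : NRep F r, ∃ i : ι, Nonempty (RepIso M (Rp i)))
    (S : (ZMod r → ℕ) → Finset ι)
    (hS : ∀ dd (i : ι), i ∈ S dd ↔ (Rp i).d = dd)
    (xc : ℕ → ι → ℂ)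
    (hxc : ∀ n, 1 ≤ n → ∀ i : ι,
      xc n i = n * ccoef v Rp n i
        - ∑ s ∈ Finset.Ico 1 n,
            mulCoef v Rp S (xc s) (ccoef v Rp (n - s))
              (fun _ => s) (fun _ => n - s) i) :
    (∀ n : ℕ, ∀ j k : ι,
        comulCoef v Rp S (ccoef v Rp n) j k
          = ∑ s ∈ Finset.range (n + 1), ccoef v Rp s j * ccoef v Rp (n - s) k)
    ∧ (∀ n, 1 ≤ n → ∀ j k : ι, (Rp j).d ≠ 0 → (Rp k).d ≠ 0 →
        comulCoef v Rp S (xc n) j k = 0) := by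
  exact ⟨fun n j k => QRep.comulCoef_ccoef hr v hskel hcompl hS n j k,
    fun n hn j k hj hk => QRep.comulCoef_xc hr hskel hcompl hS hxc hn hj hk⟩

end CyclicHall
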